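/- For every ε > 0 there is a constant C = C(ε) > 0 such that for all T ≥ 2 one has ∫₀^T |ζ(1/2+it)|^{12} dt ≤ C · T^{2+ε}. -/

import Mathlib

open Real MeasureTheory
open scoped FourierTransform ComplexConjugate

namespace TwelfthMoment

/-- First derivative test for `∫ (c / p) e^{if}` with `f' = q / p` and `q` monotone. -/
lemma osc_first_aux {α β η Cc C' : ℝ} (hαβ : α ≤ β) (hη : 0 < η)
    {f q q' p : ℝ → ℝ} {c c' : ℝ → ℂ}
    (hf : ∀ x ∈ Set.Icc α β, HasDerivAt f (q x / p x) x)
    (hq : ∀ x ∈ Set.Icc α β, HasDerivAt q (q' x) x)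
    (hc : ∀ x ∈ Set.Icc α β, HasDerivAt c (c' x) x)
    (hq'c : ContinuousOn q' (Set.Icc α β)) (hc'c : ContinuousOn c' (Set.Icc α β))
    (hpc : ContinuousOn p (Set.Icc α β)) (hp : ∀ x ∈ Set.Icc α β, 0 < p x)
    (hq' : ∀ x ∈ Set.Icc α β, 0 ≤ q' x) (hqη : ∀ x ∈ Set.Icc α β, η ≤ |q x|)
    (hCc : ∀ x ∈ Set.Icc α β, ‖c x‖ ≤ Cc) (hC' : ∀ x ∈ Set.Icc α β, ‖c' x‖ ≤ C') :
    ‖∫ x in α..β, c x / p x * Complex.exp (f x * Complex.I)‖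
      ≤ (4 * Cc + (β - α) * C') / η := by
  have hIcc : Set.uIcc α β = Set.Icc α β := Set.uIcc_of_le hαβ
  have hqne : ∀ x ∈ Set.Icc α β, q x ≠ 0 := fun x hx h => by
    have := hqη x hx; rw [h, abs_zero] at this; linarith
  have hqcont : ContinuousOn q (Set.Icc α β) := fun x hx => (hq x hx).continuousAt.continuousWithinAt
  have hccont : ContinuousOn c (Set.Icc α β) := fun x hx => (hc x hx).continuousAt.continuousWithinAt
  have hfcont : ContinuousOn f (Set.Icc α β) := fun x hx => (hf x hx).continuousAt.continuousWithinAt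
  have hqC : ContinuousOn (fun x => ((q x : ℝ) : ℂ)) (Set.Icc α β) :=
    Complex.continuous_ofReal.comp_continuousOn hqcont
  have hq'C : ContinuousOn (fun x => ((q' x : ℝ) : ℂ)) (Set.Icc α β) :=
    Complex.continuous_ofReal.comp_continuousOn hq'c
  have hpC : ContinuousOn (fun x => ((p x : ℝ) : ℂ)) (Set.Icc α β) :=
    Complex.continuous_ofReal.comp_continuousOn hpc
  have hfC : ContinuousOn (fun x => Complex.exp (f x * Complex.I)) (Set.Icc α β) :=
    Complex.continuous_exp.comp_continuousOn
      ((Complex.continuous_ofReal.comp_continuousOn hfcont).mul continuousOn_const)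
  have hqneC : ∀ x ∈ Set.Icc α β, (q x : ℂ) ≠ 0 := fun x hx => by exact_mod_cast hqne x hx
  have hpneC : ∀ x ∈ Set.Icc α β, (p x : ℂ) ≠ 0 := fun x hx => by exact_mod_cast (hp x hx).ne'
  set E : ℝ → ℂ := fun x => Complex.exp (f x * Complex.I) with hE
  have hEn : ∀ x, ‖E x‖ = 1 := fun x => Complex.norm_exp_ofReal_mul_I _
  set g : ℝ → ℂ := fun x => -Complex.I * (c x / q x) * E x with hg
  set r : ℝ → ℂ := fun x => -Complex.I * ((c' x * q x - c x * q' x) / (q x)^2) * E x with hr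
  have hder : ∀ x ∈ Set.uIcc α β, HasDerivAt g (r x + c x / p x * E x) x := by
    intro x hx
    rw [hIcc] at hx
    have h1 := ((hc x hx).div (hq x hx).ofReal_comp (hqneC x hx)).const_mul (-Complex.I)
    have h2 := (((hf x hx).ofReal_comp).mul_const Complex.I).cexp
    have h3 := h1.mul h2
    refine h3.congr_deriv ?_
    simp only [hr, hE, Pi.div_apply, Complex.ofReal_div]
    have := hqneC x hx
    have := hpneC x hx
    field_simp
    ring_nf
    simp only [Complex.I_sq]
    ring
  have hrc : ContinuousOn r (Set.Icc α β) := by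
    refine ContinuousOn.mul (ContinuousOn.mul continuousOn_const (ContinuousOn.div ?_ (hqC.pow 2) ?_)) hfC
    · exact (hc'c.mul hqC).sub (hccont.mul hq'C)
    · intro x hx; exact pow_ne_zero 2 (hqneC x hx)
  have hmc : ContinuousOn (fun x => c x / p x * E x) (Set.Icc α β) :=
    (hccont.div hpC hpneC).mul hfC
  have hri : IntervalIntegrable r volume α β := by
    apply ContinuousOn.intervalIntegrable; rwa [hIcc]
  have hmi : IntervalIntegrable (fun x => c x / p x * E x) volume α β := by
    apply ContinuousOn.intervalIntegrable; rwa [hIcc]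
  have hFTC := intervalIntegral.integral_eq_sub_of_hasDerivAt hder (hri.add hmi)
  rw [intervalIntegral.integral_add hri hmi] at hFTC
  have hval : ∫ x in α..β, c x / p x * E x = g β - g α - ∫ x in α..β, r x := by
    rw [← hFTC]; ring
  have hgb : ∀ x ∈ Set.Icc α β, ‖g x‖ ≤ Cc / η := by
    intro x hx
    simp only [hg, norm_mul, norm_neg, Complex.norm_I, one_mul, norm_div, hEn, mul_one,
      Complex.norm_real, Real.norm_eq_abs]
    have := hCc x hx
    have h0 : 0 ≤ Cc := (norm_nonneg _).trans this
    exact div_le_div₀ h0 this hη (hqη x hx)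
  have hCc0 : 0 ≤ Cc := (norm_nonneg _).trans (hCc α ⟨le_rfl, hαβ⟩)
  have hrb : ∀ x ∈ Set.Icc α β, ‖r x‖ ≤ C' / η + Cc * (q' x / (q x)^2) := by
    intro x hx
    have e1 : r x = -Complex.I * (c' x / q x) * E x - (-Complex.I * (c x * (q' x / (q x)^2)) * E x) := by
      simp only [hr]
      have := hqneC x hx
      field_simp
      ring
    rw [e1]
    refine (norm_sub_le _ _).trans ?_
    simp only [norm_mul, norm_neg, Complex.norm_I, one_mul, norm_div, hEn, mul_one,
      Complex.norm_real, Real.norm_eq_abs, norm_pow, sq_abs, abs_of_nonneg (hq' x hx)]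
    have h0 : 0 ≤ C' := (norm_nonneg _).trans (hC' x hx)
    have := div_le_div₀ h0 (hC' x hx) hη (hqη x hx)
    have h2 : ‖c x‖ * (q' x / q x ^ 2) ≤ Cc * (q' x / q x ^ 2) :=
      mul_le_mul_of_nonneg_right (hCc x hx) (div_nonneg (hq' x hx) (sq_nonneg _))
    linarith
  have hqint : ∫ x in α..β, q' x / (q x)^2 = -(q β)⁻¹ - -(q α)⁻¹ := by
    apply intervalIntegral.integral_eq_sub_of_hasDerivAt
    · intro x hx
      rw [hIcc] at hx
      have := ((hq x hx).inv (hqne x hx)).neg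
      refine this.congr_deriv ?_
      ring
    · apply ContinuousOn.intervalIntegrable
      rw [hIcc]
      exact hq'c.div (hqcont.pow 2) (fun x hx => pow_ne_zero 2 (hqne x hx))
  have hinv : ∀ x ∈ Set.Icc α β, |(q x)⁻¹| ≤ 1 / η := by
    intro x hx
    rw [abs_inv, ← one_div]
    exact one_div_le_one_div_of_le hη (hqη x hx)
  have hrint : ‖∫ x in α..β, r x‖ ≤ (β - α) * (C' / η) + Cc * (2 / η) := by
    have hi2 : IntervalIntegrable (fun x => q' x / (q x)^2) volume α β := by
      apply ContinuousOn.intervalIntegrable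
      rw [hIcc]
      exact hq'c.div (hqcont.pow 2) (fun x hx => pow_ne_zero 2 (hqne x hx))
    have hle : ‖∫ x in α..β, r x‖ ≤ ∫ x in α..β, (C' / η + Cc * (q' x / (q x)^2)) := by
      apply intervalIntegral.norm_integral_le_of_norm_le hαβ
      · filter_upwards with x hx using hrb x ⟨hx.1.le, hx.2⟩
      · exact intervalIntegrable_const.add (hi2.const_mul Cc)
    rw [intervalIntegral.integral_add intervalIntegrable_const (hi2.const_mul Cc),
      intervalIntegral.integral_const, intervalIntegral.integral_const_mul, hqint, smul_eq_mul] at hle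
    have h1 := abs_le.1 (hinv β ⟨hαβ, le_rfl⟩)
    have h2 := abs_le.1 (hinv α ⟨le_rfl, hαβ⟩)
    have h3 : Cc * (-(q β)⁻¹ - -(q α)⁻¹) ≤ Cc * (2 / η) := by
      apply mul_le_mul_of_nonneg_left _ hCc0
      have : (2:ℝ) / η = 1 / η + 1 / η := by ring
      linarith [h1.1, h2.2]
    linarith
  rw [hval]
  calc ‖g β - g α - ∫ x in α..β, r x‖ ≤ ‖g β‖ + ‖g α‖ + ‖∫ x in α..β, r x‖ :=
        (norm_sub_le _ _).trans (add_le_add (norm_sub_le _ _) le_rfl)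
    _ ≤ Cc / η + Cc / η + ((β - α) * (C' / η) + Cc * (2 / η)) :=
        add_le_add (add_le_add (hgb β ⟨hαβ, le_rfl⟩) (hgb α ⟨le_rfl, hαβ⟩)) hrint
    _ = (4 * Cc + (β - α) * C') / η := by ring

/-- Second derivative test for `∫ (c / p) e^{if}` with `f' = q / p` and `q' ≥ lam`. -/
lemma osc_second_aux {α β η lam Cb Cc C' : ℝ} (hαβ : α ≤ β) (hη : 0 < η) (hlam : 0 < lam)
    {f q q' p : ℝ → ℝ} {c c' : ℝ → ℂ}
    (hf : ∀ x ∈ Set.Icc α β, HasDerivAt f (q x / p x) x)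
    (hq : ∀ x ∈ Set.Icc α β, HasDerivAt q (q' x) x)
    (hc : ∀ x ∈ Set.Icc α β, HasDerivAt c (c' x) x)
    (hq'c : ContinuousOn q' (Set.Icc α β)) (hc'c : ContinuousOn c' (Set.Icc α β))
    (hpc : ContinuousOn p (Set.Icc α β)) (hp : ∀ x ∈ Set.Icc α β, 0 < p x)
    (hq' : ∀ x ∈ Set.Icc α β, lam ≤ q' x)
    (hCc : ∀ x ∈ Set.Icc α β, ‖c x‖ ≤ Cc) (hC' : ∀ x ∈ Set.Icc α β, ‖c' x‖ ≤ C')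
    (hCb : ∀ x ∈ Set.Icc α β, ‖c x / p x‖ ≤ Cb) :
    ‖∫ x in α..β, c x / p x * Complex.exp (f x * Complex.I)‖
      ≤ 2 * ((4 * Cc + (β - α) * C') / η) + Cb * (2 * η / lam) := by
  have hqcont : ContinuousOn q (Set.Icc α β) := fun x hx => (hq x hx).continuousAt.continuousWithinAt
  have hCc0 : 0 ≤ Cc := (norm_nonneg _).trans (hCc α ⟨le_rfl, hαβ⟩)
  have hC'0 : 0 ≤ C' := (norm_nonneg _).trans (hC' α ⟨le_rfl, hαβ⟩)
  have hCb0 : 0 ≤ Cb := (norm_nonneg _).trans (hCb α ⟨le_rfl, hαβ⟩)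
  have hgrow : ∀ x ∈ Set.Icc α β, ∀ y ∈ Set.Icc α β, x ≤ y → lam * (y - x) ≤ q y - q x := by
    intro x hx y hy hxy
    refine (convex_Icc α β).mul_sub_le_image_sub_of_le_deriv hqcont ?_ ?_ x hx y hy hxy
    · intro z hz
      exact (hq z (interior_subset hz)).differentiableAt.differentiableWithinAt
    · intro z hz
      rw [(hq z (interior_subset hz)).deriv]
      exact hq' z (interior_subset hz)
  obtain ⟨x0, hx0, hpos, hneg⟩ : ∃ x0 ∈ Set.Icc α β, (∀ x ∈ Set.Icc α β, x0 < x → lam * (x - x0) ≤ q x) ∧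
      (∀ x ∈ Set.Icc α β, x < x0 → q x ≤ - (lam * (x0 - x))) := by
    by_cases h1 : 0 ≤ q α
    · refine ⟨α, ⟨le_rfl, hαβ⟩, fun x hx hx' => ?_, fun x hx hx' => absurd hx.1 (not_le.2 hx')⟩
      linarith [hgrow α ⟨le_rfl, hαβ⟩ x hx hx.1]
    by_cases h2 : q β ≤ 0
    · refine ⟨β, ⟨hαβ, le_rfl⟩, fun x hx hx' => absurd hx.2 (not_le.2 hx'), fun x hx hx' => ?_⟩
      linarith [hgrow x hx β ⟨hαβ, le_rfl⟩ hx.2]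
    push Not at h1 h2
    obtain ⟨x0, hx0, hq0⟩ := intermediate_value_Icc hαβ hqcont ⟨h1.le, h2.le⟩
    refine ⟨x0, hx0, fun x hx hx' => ?_, fun x hx hx' => ?_⟩
    · linarith [hgrow x0 hx0 x hx hx'.le]
    · linarith [hgrow x hx x0 hx0 hx'.le]
  set x1 := max α (x0 - η / lam) with hx1
  set x2 := min β (x0 + η / lam) with hx2
  have hd : 0 < η / lam := div_pos hη hlam
  have hαx1 : α ≤ x1 := le_max_left _ _
  have hx10 : x1 ≤ x0 := max_le hx0.1 (by linarith)
  have hx02 : x0 ≤ x2 := le_min hx0.2 (by linarith)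
  have hx2β : x2 ≤ β := min_le_left _ _
  have hx12 : x2 - x1 ≤ 2 * η / lam := by
    have a := le_max_right α (x0 - η / lam)
    have b := min_le_right β (x0 + η / lam)
    have : 2 * η / lam = η / lam + η / lam := by ring
    linarith
  set F : ℝ → ℂ := fun x => c x / p x * Complex.exp (f x * Complex.I) with hF
  have hFc : ContinuousOn F (Set.Icc α β) := by
    have hccont : ContinuousOn c (Set.Icc α β) := fun x hx => (hc x hx).continuousAt.continuousWithinAt
    have hfcont : ContinuousOn f (Set.Icc α β) := fun x hx => (hf x hx).continuousAt.continuousWithinAt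
    refine ContinuousOn.mul (hccont.div (Complex.continuous_ofReal.comp_continuousOn hpc)
      (fun x hx => by exact_mod_cast (hp x hx).ne')) ?_
    exact Complex.continuous_exp.comp_continuousOn
      ((Complex.continuous_ofReal.comp_continuousOn hfcont).mul continuousOn_const)
  have hintegr : ∀ a b, α ≤ a → a ≤ b → b ≤ β → IntervalIntegrable F volume a b := by
    intro a b h1 h2 h3
    apply ContinuousOn.intervalIntegrable
    rw [Set.uIcc_of_le h2]
    exact hFc.mono (Set.Icc_subset_Icc h1 h3)
  have hsub : ∀ a b, α ≤ a → a ≤ b → b ≤ β → (∀ x ∈ Set.Icc a b, η ≤ |q x|) →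
      ‖∫ x in a..b, F x‖ ≤ (4 * Cc + (β - α) * C') / η := by
    intro a b h1 h2 h3 h4
    have hs : ∀ x ∈ Set.Icc a b, x ∈ Set.Icc α β := fun x hx => ⟨h1.trans hx.1, hx.2.trans h3⟩
    have hS : Set.Icc a b ⊆ Set.Icc α β := hs
    refine (osc_first_aux h2 hη (fun x hx => hf x (hs x hx)) (fun x hx => hq x (hs x hx))
      (fun x hx => hc x (hs x hx)) (hq'c.mono hS) (hc'c.mono hS) (hpc.mono hS)
      (fun x hx => hp x (hs x hx)) (fun x hx => hlam.le.trans (hq' x (hs x hx))) h4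
      (fun x hx => hCc x (hs x hx)) (fun x hx => hC' x (hs x hx))).trans ?_
    gcongr
  have hlampos : lam * (η / lam) = η := by field_simp
  have hD : 0 ≤ (4 * Cc + (β - α) * C') / η := by
    have : 0 ≤ β - α := by linarith
    positivity
  have b1 : ‖∫ x in α..x1, F x‖ ≤ (4 * Cc + (β - α) * C') / η := by
    rcases hαx1.eq_or_lt with h | h
    · rw [← h]; simpa using hD
    · have hx1' : x1 = x0 - η / lam := by
        rcases max_choice α (x0 - η / lam) with h' | h'
        · exact absurd h (by rw [hx1, h']; exact lt_irrefl _)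
        · exact h'
      refine hsub α x1 le_rfl hαx1 (hx10.trans hx0.2) (fun x hx => ?_)
      have := hneg x ⟨hx.1, hx.2.trans (hx10.trans hx0.2)⟩ (by linarith [hx.2])
      have h5 : lam * (η / lam) ≤ lam * (x0 - x) :=
        mul_le_mul_of_nonneg_left (by linarith [hx.2]) hlam.le
      rw [le_abs]; right; linarith
  have b3 : ‖∫ x in x2..β, F x‖ ≤ (4 * Cc + (β - α) * C') / η := by
    rcases hx2β.eq_or_lt with h | h
    · rw [h]; simpa using hD
    · have hx2' : x2 = x0 + η / lam := by
        rcases min_choice β (x0 + η / lam) with h' | h'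
        · exact absurd h (by rw [hx2, h']; exact lt_irrefl _)
        · exact h'
      refine hsub x2 β (hx0.1.trans hx02) hx2β le_rfl (fun x hx => ?_)
      have := hpos x ⟨(hx0.1.trans hx02).trans hx.1, hx.2⟩ (by linarith [hx.1])
      have h5 : lam * (η / lam) ≤ lam * (x - x0) :=
        mul_le_mul_of_nonneg_left (by linarith [hx.1]) hlam.le
      rw [le_abs]; left; linarith
  have b2 : ‖∫ x in x1..x2, F x‖ ≤ Cb * (2 * η / lam) := by
    have := intervalIntegral.norm_integral_le_of_norm_le_const (a := x1) (b := x2) (C := Cb) (f := F)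
      (fun x hx => by
        rw [Set.uIoc_of_le (hx10.trans hx02)] at hx
        have hx' : x ∈ Set.Icc α β := ⟨hαx1.trans hx.1.le, hx.2.trans hx2β⟩
        simp only [hF, norm_mul, Complex.norm_exp_ofReal_mul_I, mul_one]
        exact hCb x hx')
    refine this.trans ?_
    rw [abs_of_nonneg (by linarith)]
    exact mul_le_mul_of_nonneg_left hx12 hCb0
  have hsplit : ∫ x in α..β, F x = (∫ x in α..x1, F x) + (∫ x in x1..x2, F x) + ∫ x in x2..β, F x := by
    rw [intervalIntegral.integral_add_adjacent_intervals (hintegr _ _ le_rfl hαx1 (hx10.trans hx0.2))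
      (hintegr _ _ hαx1 (hx10.trans hx02) hx2β),
      intervalIntegral.integral_add_adjacent_intervals (hintegr _ _ le_rfl (hαx1.trans (hx10.trans hx02)) hx2β)
      (hintegr _ _ (hx0.1.trans hx02) hx2β le_rfl)]
  rw [hsplit]
  calc _ ≤ ‖∫ x in α..x1, F x‖ + ‖∫ x in x1..x2, F x‖ + ‖∫ x in x2..β, F x‖ :=
        (norm_add_le _ _).trans (add_le_add (norm_add_le _ _) le_rfl)
    _ ≤ _ := by linarith

/-- The phase `log ((u + 1) / u)`. -/
noncomputable def phi (u : ℝ) : ℝ := Real.log (u + 1) - Real.log u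

/-- Continuously differentiable amplitudes supported on `[U, 4U]`. -/
structure IsAmp (U : ℝ) (b b' : ℝ → ℝ) : Prop where
  deriv : ∀ x, HasDerivAt b (b' x) x
  cont : Continuous b'
  supp : ∀ x, x ∉ Set.Icc U (4 * U) → b x = 0
  bound : ∀ x, |b x| ≤ 1
  bound' : ∀ x, |b' x| ≤ 1 / U

lemma hasDerivAt_phi {u : ℝ} (hu : 0 < u) : HasDerivAt phi (-1 / (u * (u + 1))) u := by
  have h1 : HasDerivAt (fun u : ℝ => Real.log (u + 1)) (1 / (u + 1)) u :=
    ((hasDerivAt_id u).add_const 1).log (by simp; linarith)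
  have h2 := h1.sub (Real.hasDerivAt_log hu.ne')
  refine h2.congr_deriv ?_
  have : u + 1 ≠ 0 := by linarith
  field_simp
  ring

section corr
variable {U j t s : ℝ} {b b' : ℝ → ℝ}

lemma corr_deriv_f (hU : 1 ≤ U) (hj : 0 ≤ j) {x : ℝ} (hx : x ∈ Set.Icc U (4 * U - j)) :
    HasDerivAt (fun x => t * phi x - s * phi (x + j))
      ((-t + s * (x * (x + 1) / ((x + j) * (x + j + 1)))) / (x * (x + 1))) x := by
  have hx0 : 0 < x := by linarith [hx.1]
  have h1 := (hasDerivAt_phi hx0).const_mul t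
  have h2 := ((hasDerivAt_phi (u := x + j) (by linarith)).comp_add_const x j).const_mul s
  refine (h1.sub h2).congr_deriv ?_
  have : x + 1 ≠ 0 := by linarith
  have : x + j ≠ 0 := by linarith
  have : x + j + 1 ≠ 0 := by linarith
  field_simp
  ring

lemma corr_deriv_q (hU : 1 ≤ U) (hj : 0 ≤ j) {x : ℝ} (hx : x ∈ Set.Icc U (4 * U - j)) :
    HasDerivAt (fun x => -t + s * (x * (x + 1) / ((x + j) * (x + j + 1))))
      (s * (j * (2 * x * (x + j) + x + (x + j) + 1) / ((x + j) * (x + j + 1)) ^ 2)) x := by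
  have hx0 : 0 < x := by linarith [hx.1]
  have h1 : HasDerivAt (fun x : ℝ => x * (x + 1)) (1 * (x + 1) + x * 1) x :=
    (hasDerivAt_id x).mul ((hasDerivAt_id x).add_const 1)
  have h2 : HasDerivAt (fun x : ℝ => (x + j) * (x + j + 1)) (1 * (x + j + 1) + (x + j) * 1) x :=
    ((hasDerivAt_id x).add_const j).mul (((hasDerivAt_id x).add_const j).add_const 1)
  have hne : (x + j) * (x + j + 1) ≠ 0 := by
    have : 0 < x + j := by linarith
    positivity
  have h3 := ((h1.div h2 hne).const_mul s).const_add (-t)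
  refine h3.congr_deriv ?_
  congr 2
  ring

lemma corr_deriv_c (hb : IsAmp U b b') {x : ℝ} :
    HasDerivAt (fun x => ((b x * b (x + j) * (x * (x + 1)) : ℝ) : ℂ))
      (((b' x * b (x + j) + b x * b' (x + j)) * (x * (x + 1)) + b x * b (x + j) * (2 * x + 1) : ℝ) : ℂ)
      x := by
  apply HasDerivAt.ofReal_comp
  have h1 : HasDerivAt (fun x : ℝ => x * (x + 1)) (1 * (x + 1) + x * 1) x :=
    (hasDerivAt_id x).mul ((hasDerivAt_id x).add_const 1)
  have h2 := ((hb.deriv x).mul ((hb.deriv (x + j)).comp_add_const x j)).mul h1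
  refine h2.congr_deriv ?_
  simp only [Pi.mul_apply]
  ring

lemma corr_c_bound (hb : IsAmp U b b') (hU : 1 ≤ U) (hj : 0 ≤ j) {x : ℝ}
    (hx : x ∈ Set.Icc U (4 * U - j)) :
    ‖((b x * b (x + j) * (x * (x + 1)) : ℝ) : ℂ)‖ ≤ 20 * U ^ 2 := by
  have hx0 : 0 < x := by linarith [hx.1]
  rw [Complex.norm_real, Real.norm_eq_abs, abs_mul, abs_mul, abs_of_nonneg (by positivity : 0 ≤ x * (x + 1))]
  have h1 : |b x| * |b (x + j)| ≤ 1 := mul_le_one₀ (hb.bound _) (abs_nonneg _) (hb.bound _)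
  have h2 : x * (x + 1) ≤ 20 * U ^ 2 := by nlinarith [hx.1, hx.2]
  calc _ ≤ 1 * (x * (x + 1)) := by gcongr
    _ ≤ _ := by linarith

lemma corr_c'_bound (hb : IsAmp U b b') (hU : 1 ≤ U) (hj : 0 ≤ j) {x : ℝ}
    (hx : x ∈ Set.Icc U (4 * U - j)) :
    ‖(((b' x * b (x + j) + b x * b' (x + j)) * (x * (x + 1)) + b x * b (x + j) * (2 * x + 1) : ℝ) : ℂ)‖
      ≤ 49 * U := by
  have hx0 : 0 < x := by linarith [hx.1]
  have hU0 : 0 < U := by linarith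
  have h1 : |b x * b (x + j)| ≤ 1 := by
    rw [abs_mul]; exact mul_le_one₀ (hb.bound _) (abs_nonneg _) (hb.bound _)
  have h2 : x * (x + 1) ≤ 20 * U ^ 2 := by nlinarith [hx.1, hx.2]
  have h3 : |b' x * b (x + j)| ≤ 1 / U := by
    rw [abs_mul]
    calc _ ≤ 1 / U * 1 := mul_le_mul (hb.bound' _) (hb.bound _) (abs_nonneg _) (by positivity)
      _ = _ := mul_one _
  have h4 : |b x * b' (x + j)| ≤ 1 / U := by
    rw [abs_mul]
    calc _ ≤ 1 * (1 / U) := mul_le_mul (hb.bound _) (hb.bound' _) (abs_nonneg _) (by positivity)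
      _ = _ := one_mul _
  rw [Complex.norm_real, Real.norm_eq_abs]
  calc _ ≤ |(b' x * b (x + j) + b x * b' (x + j)) * (x * (x + 1))| + |b x * b (x + j) * (2 * x + 1)| :=
        abs_add_le _ _
    _ = |b' x * b (x + j) + b x * b' (x + j)| * (x * (x + 1)) + |b x * b (x + j)| * (2 * x + 1) := by
        rw [abs_mul, abs_mul (b x * b (x + j)), abs_of_nonneg (by positivity : 0 ≤ x * (x + 1)),
          abs_of_nonneg (by positivity : 0 ≤ 2 * x + 1)]
    _ ≤ (1 / U + 1 / U) * (20 * U ^ 2) + 1 * (9 * U) := by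
        gcongr
        · exact (abs_add_le _ _).trans (add_le_add h3 h4)
        · linarith [hx.2]
    _ = 49 * U := by field_simp; ring

lemma corr_integrand {x : ℝ} (hx : 0 < x) :
    ((b x * b (x + j) : ℝ) : ℂ) = ((b x * b (x + j) * (x * (x + 1)) : ℝ) : ℂ) / ((x * (x + 1) : ℝ) : ℂ) := by
  rw [← Complex.ofReal_div]
  congr 1
  field_simp

lemma corr_q'_cont (hU : 1 ≤ U) (hj : 0 ≤ j) : ContinuousOn
    (fun x => s * (j * (2 * x * (x + j) + x + (x + j) + 1) / ((x + j) * (x + j + 1)) ^ 2))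
    (Set.Icc U (4 * U - j)) := by
  refine continuousOn_const.mul (ContinuousOn.div (by fun_prop) (by fun_prop) ?_)
  intro x hx
  have : 0 < x + j := by linarith [hx.1]
  positivity

lemma corr_first (hb : IsAmp U b b') (hU : 1 ≤ U) (hj : 0 ≤ j) (hj3 : j ≤ 3 * U) (hs : 0 ≤ s) {η : ℝ}
    (hη : 0 < η)
    (hq : ∀ x ∈ Set.Icc U (4 * U - j), η ≤ |-t + s * (x * (x + 1) / ((x + j) * (x + j + 1)))|) :
    ‖∫ x in U..(4 * U - j), ((b x * b (x + j) : ℝ) : ℂ) *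
      Complex.exp (((t * phi x - s * phi (x + j) : ℝ) : ℂ) * Complex.I)‖ ≤ 227 * U ^ 2 / η := by
  have hle : U ≤ 4 * U - j := by linarith
  have hbc' := hb.cont
  have hbc : Continuous b := continuous_iff_continuousAt.2 fun x => (hb.deriv x).continuousAt
  have key := osc_first_aux (f := fun x => t * phi x - s * phi (x + j)) hle hη
    (fun x hx => corr_deriv_f (t := t) (s := s) hU hj hx)
    (fun x hx => corr_deriv_q hU hj hx) (fun x _ => corr_deriv_c (j := j) hb)
    (corr_q'_cont hU hj) (by fun_prop) (by fun_prop)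
    (fun x hx => by have : 0 < x := by linarith [hx.1]
                    positivity)
    (fun x hx => by have : 0 < x := by linarith [hx.1]
                    positivity) hq
    (fun x hx => corr_c_bound hb hU hj hx) (fun x hx => corr_c'_bound hb hU hj hx)
  refine le_trans (le_of_eq ?_) (key.trans ?_)
  · congr 1
    apply intervalIntegral.integral_congr
    intro x hx
    rw [Set.uIcc_of_le hle] at hx
    simp only
    rw [corr_integrand (by linarith [hx.1])]
  · gcongr
    nlinarith

lemma corr_second (hb : IsAmp U b b') (hU : 1 ≤ U) (hj : 0 ≤ j) (hj3 : j ≤ 3 * U) {T : ℝ}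
    (hTs : T ≤ s) {η : ℝ} (hη : 0 < η) (hTj : 0 < T * j) :
    ‖∫ x in U..(4 * U - j), ((b x * b (x + j) : ℝ) : ℂ) *
      Complex.exp (((t * phi x - s * phi (x + j) : ℝ) : ℂ) * Complex.I)‖
      ≤ 2 * (227 * U ^ 2 / η) + 1 * (2 * η / (T * j / (50 * U ^ 2))) := by
  have hle : U ≤ 4 * U - j := by linarith
  have hbc' := hb.cont
  have hbc : Continuous b := continuous_iff_continuousAt.2 fun x => (hb.deriv x).continuousAt
  have key := osc_second_aux (f := fun x => t * phi x - s * phi (x + j)) hle hη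
    (lam := T * j / (50 * U ^ 2)) (Cb := 1) (by positivity)
    (fun x hx => corr_deriv_f (t := t) (s := s) hU hj hx)
    (fun x hx => corr_deriv_q hU hj hx) (fun x _ => corr_deriv_c (j := j) hb)
    (corr_q'_cont hU hj) (by fun_prop) (by fun_prop)
    (fun x hx => by have : 0 < x := by linarith [hx.1]
                    positivity)
    (fun x hx => by
      have hx1 := hx.1
      have hu : x + j ≤ 4 * U := by linarith [hx.2]
      have hu0 : 0 < x + j := by linarith
      have hx0 : 0 < x := by linarith
      have h1 : T * j * (1 / (50 * U ^ 2)) ≤ s * j *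
          ((2 * x * (x + j) + x + (x + j) + 1) / ((x + j) * (x + j + 1)) ^ 2) := by
        apply mul_le_mul
        · gcongr
        · rw [div_le_div_iff₀ (by positivity) (by positivity)]
          have e1 : (x + j + 1) ^ 2 ≤ 25 * U ^ 2 := by
            have : x + j + 1 ≤ 5 * U := by linarith
            nlinarith
          have e2 : (x + j) ≤ 4 * x := by linarith
          calc 1 * ((x + j) * (x + j + 1)) ^ 2 = (x + j) * (x + j) * (x + j + 1) ^ 2 := by ring
            _ ≤ (x + j) * (4 * x) * (25 * U ^ 2) := by gcongr
            _ = (2 * x * (x + j)) * (50 * U ^ 2) := by ring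
            _ ≤ _ := by gcongr; linarith
        · positivity
        · have : 0 ≤ j * T := by linarith
          nlinarith
      calc _ = T * j * (1 / (50 * U ^ 2)) := by ring
        _ ≤ _ := h1
        _ = _ := by ring)
    (fun x hx => corr_c_bound hb hU hj hx) (fun x hx => corr_c'_bound hb hU hj hx)
    (fun x hx => by
      rw [← corr_integrand (by linarith [hx.1]), Complex.norm_real, Real.norm_eq_abs, abs_mul]
      exact mul_le_one₀ (hb.bound _) (abs_nonneg _) (hb.bound _))
  refine le_trans (le_of_eq ?_) (key.trans ?_)
  · congr 1
    apply intervalIntegral.integral_congr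
    intro x hx
    rw [Set.uIcc_of_le hle] at hx
    simp only
    rw [corr_integrand (by linarith [hx.1])]
  · gcongr
    nlinarith

/-- Correlation of two oscillating amplitudes at a nonzero shift. -/
lemma corr_shift_bound (hb : IsAmp U b b') (hU : 1 ≤ U) (hj : 0 < j) (hj3 : j ≤ 3 * U) {T : ℝ}
    (hT : 0 < T) (hTs : T ≤ s) :
    ‖∫ x in U..(4 * U - j), ((b x * b (x + j) : ℝ) : ℂ) *
      Complex.exp (((t * phi x - s * phi (x + j) : ℝ) : ℂ) * Complex.I)‖
      ≤ 2000 * (U ^ 3 + U ^ 2 * √(U * |t - s|)) / (T * j) := by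
  have hTj : 0 < T * j := by positivity
  have hU0 : 0 < U := by linarith
  have hsq := Real.sqrt_nonneg (U * |t - s|)
  by_cases h : |t - s| ≤ T * j / (8 * U)
  · have := corr_first (t := t) (s := s) hb hU hj.le hj3 (by linarith) (η := T * j / (8 * U))
      (by positivity) (fun x hx => by
        have hx1 := hx.1
        have hu : x + j ≤ 4 * U := by linarith [hx.2]
        have hu0 : 0 < x + j := by linarith
        have e1 : j / (4 * U) ≤ 1 - x * (x + 1) / ((x + j) * (x + j + 1)) := by
          have : 1 - x * (x + 1) / ((x + j) * (x + j + 1))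
              = j / (x + j) + j * x / ((x + j) * (x + j + 1)) := by
            field_simp; ring
          rw [this]
          have h2 : 0 ≤ j * x / ((x + j) * (x + j + 1)) := by
            have : 0 < x := by linarith
            positivity
          have h3 : j / (4 * U) ≤ j / (x + j) := by gcongr
          linarith
        have e2 : T * (j / (4 * U)) ≤ s * (1 - x * (x + 1) / ((x + j) * (x + j + 1))) := by
          apply mul_le_mul hTs e1 (by positivity) (by linarith)
        have e3 : T * j / (8 * U) = T * (j / (4 * U)) / 2 := by field_simp; ring
        have e4 := abs_le.1 h
        rw [le_abs]; right
        linarith [e4.1])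
    refine this.trans ?_
    rw [div_div_eq_mul_div, div_le_div_iff_of_pos_right hTj]
    have : 0 ≤ U ^ 2 * √(U * |t - s|) := by positivity
    nlinarith [pow_pos hU0 3]
  · push Not at h
    have := corr_second (t := t) hb hU hj.le hj3 hTs (η := √(T * j)) (by positivity) hTj
    refine this.trans ?_
    have e0 : √(T * j) ^ 2 = T * j := Real.sq_sqrt hTj.le
    have hs0 : 0 < √(T * j) := by positivity
    have e1 : 2 * (227 * U ^ 2 / √(T * j)) + 1 * (2 * √(T * j) / (T * j / (50 * U ^ 2)))
        = 554 * U ^ 2 * √(T * j) / (T * j) := by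
      have : 2 * (227 * U ^ 2 / √(T * j)) = 454 * U ^ 2 * √(T * j) / (T * j) := by
        rw [← mul_div_assoc, div_eq_div_iff hs0.ne' hTj.ne']
        linear_combination (-454 * U ^ 2) * e0
      rw [this]; field_simp; ring
    rw [e1, div_le_div_iff_of_pos_right hTj]
    have e2 : √(T * j) ≤ 3 * √(U * |t - s|) := by
      rw [show (3:ℝ) = √9 by rw [show (9:ℝ) = 3 ^ 2 by norm_num, Real.sqrt_sq (by norm_num)],
        ← Real.sqrt_mul (by norm_num)]
      apply Real.sqrt_le_sqrt
      rw [div_lt_iff₀ (by positivity)] at h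
      nlinarith [abs_nonneg (t - s)]
    have : 554 * U ^ 2 * √(T * j) ≤ 554 * U ^ 2 * (3 * √(U * |t - s|)) := by gcongr
    have h5 : 0 ≤ U ^ 2 * √(U * |t - s|) := by positivity
    have := pow_pos hU0 3
    linarith

/-- Correlation of two oscillating amplitudes at shift zero. -/
lemma corr_zero_bound (hb : IsAmp U b b') (hU : 1 ≤ U) (hs : 0 ≤ s) (hts : t ≠ s) :
    ‖∫ x in U..(4 * U - 0), ((b x * b (x + 0) : ℝ) : ℂ) *
      Complex.exp (((t * phi x - s * phi (x + 0) : ℝ) : ℂ) * Complex.I)‖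
      ≤ 227 * U ^ 2 / |t - s| := by
  refine corr_first hb hU le_rfl (by linarith) hs (abs_pos.2 (sub_ne_zero.2 hts)) fun x hx => ?_
  have : 0 < x := by linarith [hx.1]
  rw [add_zero, div_self (by positivity), mul_one, abs_sub_comm]
  apply le_of_eq
  congr 1
  ring

lemma corr_trivial_bound (hb : IsAmp U b b') (hU : 1 ≤ U) :
    ‖∫ x in U..(4 * U - 0), ((b x * b (x + 0) : ℝ) : ℂ) *
      Complex.exp (((t * phi x - s * phi (x + 0) : ℝ) : ℂ) * Complex.I)‖ ≤ 3 * U := by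
  refine (intervalIntegral.norm_integral_le_of_norm_le_const (C := 1) fun x _ => ?_).trans ?_
  · rw [norm_mul, Complex.norm_exp_ofReal_mul_I, mul_one, Complex.norm_real, Real.norm_eq_abs, abs_mul]
    exact mul_le_one₀ (hb.bound _) (abs_nonneg _) (hb.bound _)
  · rw [abs_of_nonneg (by linarith)]; linarith

end corr

section parseval
variable {A : ℝ → ℂ} {N : ℕ}

lemma integral_eq_interval_of_supp {F : ℝ → ℂ} (h0 : ∀ x ≤ 0, F x = 0) (hN : ∀ x, (N : ℝ) ≤ x → F x = 0) :
    ∫ x, F x = ∫ x in (0:ℝ)..N, F x := by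
  symm
  apply intervalIntegral.integral_eq_integral_of_support_subset
  intro x hx
  simp only [Function.mem_support, ne_eq] at hx
  constructor
  · by_contra h; exact hx (h0 x (not_lt.1 h))
  · by_contra h; exact hx (hN x (not_le.1 h).le)

lemma integral_eq_sum_unit {F : ℝ → ℂ} (hF : Continuous F) (h0 : ∀ x ≤ 0, F x = 0)
    (hN : ∀ x, (N : ℝ) ≤ x → F x = 0) :
    ∫ x, F x = ∑ n ∈ Finset.range N, ∫ x in (0:ℝ)..1, F (x + n) := by
  rw [integral_eq_interval_of_supp h0 hN]
  have := intervalIntegral.sum_integral_adjacent_intervals (f := F) (μ := volume) (n := N)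
    (a := fun k : ℕ => (k : ℝ)) (fun k _ => hF.intervalIntegrable _ _)
  simp only [Nat.cast_zero] at this
  rw [← this]
  refine Finset.sum_congr rfl fun n _ => ?_
  rw [intervalIntegral.integral_comp_add_right]
  simp [add_comm]

lemma fourierCoeffOn_periodization (hA : Continuous A) (h0 : ∀ x ≤ 0, A x = 0)
    (hN : ∀ x, (N : ℝ) ≤ x → A x = 0) (m : ℤ) :
    fourierCoeffOn (zero_lt_one (α := ℝ)) (fun x => ∑ n ∈ Finset.range N, A (x + n)) m = 𝓕 A m := by
  rw [fourierCoeffOn_eq_integral, Real.fourier_real_eq_integral_exp_smul,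
    integral_eq_sum_unit (N := N) (by fun_prop) (by intro x hx; simp [h0 x hx])
      (by intro x hx; simp [hN x hx])]
  simp only [sub_zero, div_one, one_smul, smul_eq_mul]
  rw [← intervalIntegral.integral_finsetSum]
  · refine intervalIntegral.integral_congr fun x _ => ?_
    simp only [Finset.mul_sum]
    refine Finset.sum_congr rfl fun n _ => ?_
    congr 1
    rw [fourier_coe_apply]
    rw [Complex.exp_eq_exp_iff_exists_int]
    refine ⟨m * n, ?_⟩
    push_cast
    ring
  · intro n _
    apply Continuous.intervalIntegrable
    fun_prop

lemma hasSum_sq_fourier (hA : Continuous A) (h0 : ∀ x ≤ 0, A x = 0)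
    (hN : ∀ x, (N : ℝ) ≤ x → A x = 0) :
    HasSum (fun m : ℤ => ‖𝓕 A m‖ ^ 2)
      (∫ x in (0:ℝ)..1, ‖∑ n ∈ Finset.range N, A (x + n)‖ ^ 2) := by
  have hc : Continuous (fun x : ℝ => ∑ n ∈ Finset.range N, A (x + n)) := by fun_prop
  have := hasSum_sq_fourierCoeffOn (zero_lt_one (α := ℝ))
    (f := fun x => ∑ n ∈ Finset.range N, A (x + n)) (by
      obtain ⟨C, hC⟩ := (isCompact_Icc (a := (0:ℝ)) (b := 1)).exists_bound_of_continuousOn hc.continuousOn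
      refine MemLp.of_bound hc.aestronglyMeasurable C ?_
      filter_upwards [ae_restrict_mem measurableSet_Ioc] with x hx using hC x ⟨hx.1.le, hx.2⟩)
  simpa [fourierCoeffOn_periodization hA h0 hN] using this

/-- Autocorrelation. -/
noncomputable def corr (A : ℝ → ℂ) (j : ℤ) : ℂ := ∫ x : ℝ, A x * conj (A (x + j))

lemma corr_neg (j : ℤ) : corr A (-j) = conj (corr A j) := by
  unfold corr
  rw [← integral_conj, ← integral_add_right_eq_self _ (j : ℝ)]
  refine integral_congr_ae (Filter.Eventually.of_forall fun x => ?_)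
  simp [mul_comm]

lemma integral_periodization_sq (hA : Continuous A) (h0 : ∀ x ≤ 0, A x = 0)
    (hN : ∀ x, (N : ℝ) ≤ x → A x = 0) :
    ((∫ x in (0:ℝ)..1, ‖∑ n ∈ Finset.range N, A (x + n)‖ ^ 2 : ℝ) : ℂ)
      = ∑ j ∈ Finset.Ioo (-N : ℤ) N, corr A j := by
  have e1 : ∀ j : ℤ, corr A j = ∑ n ∈ Finset.range N, ∫ x in (0:ℝ)..1, A (x + n) * conj (A (x + n + j)) := by
    intro j
    exact integral_eq_sum_unit (F := fun x => A x * conj (A (x + j)))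
      (hA.mul (Complex.continuous_conj.comp (by fun_prop)))
      (by intro x hx; simp [h0 x hx]) (by intro x hx; simp [hN x hx])
  simp_rw [e1]
  rw [Finset.sum_comm, ← intervalIntegral.integral_ofReal]
  have e2 : ∀ x : ℝ, ((‖∑ n ∈ Finset.range N, A (x + n)‖ ^ 2 : ℝ) : ℂ)
      = ∑ n ∈ Finset.range N, ∑ k ∈ Finset.range N, A (x + n) * conj (A (x + k)) := by
    intro x
    push_cast
    rw [← Complex.mul_conj', map_sum, Finset.sum_mul_sum]
  simp_rw [e2]
  have hcj : ∀ n k : ℕ, Continuous fun x : ℝ => A (x + n) * conj (A (x + k)) := fun n k =>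
    (by fun_prop : Continuous fun x : ℝ => A (x + n)).mul (Complex.continuous_conj.comp (by fun_prop))
  rw [intervalIntegral.integral_finsetSum
    (fun n _ => (continuous_finsetSum _ fun k _ => hcj n k).intervalIntegrable _ _)]
  refine Finset.sum_congr rfl fun n hn => ?_
  rw [intervalIntegral.integral_finsetSum (fun k _ => (hcj n k).intervalIntegrable _ _)]
  rw [Finset.mem_range] at hn
  have e3 : ∑ k ∈ Finset.range N, ∫ x in (0:ℝ)..1, A (x + n) * conj (A (x + k))
      = ∑ j ∈ (Finset.range N).image (fun k : ℕ => (k : ℤ) - n),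
        ∫ x in (0:ℝ)..1, A (x + n) * conj (A (x + n + j)) := by
    rw [Finset.sum_image (by intro a _ b _ h; simp at h; exact h)]
    refine Finset.sum_congr rfl fun k _ => ?_
    refine intervalIntegral.integral_congr fun x _ => ?_
    congr 3
    push_cast
    ring
  rw [e3]
  apply Finset.sum_subset
  · intro j hj
    simp only [Finset.mem_image, Finset.mem_range] at hj
    obtain ⟨k, hk, rfl⟩ := hj
    simp only [Finset.mem_Ioo]
    omega
  · intro j hj hj'
    simp only [Finset.mem_image, Finset.mem_range, not_exists, not_and, Finset.mem_Ioo] at hj hj'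
    rw [intervalIntegral.integral_congr (g := fun _ => (0:ℂ))]
    · simp
    intro x hx
    rw [Set.uIcc_of_le zero_le_one] at hx
    simp only
    rcases lt_or_ge ((n : ℤ) + j) 0 with h | h
    · rw [h0 (x + n + j), map_zero, mul_zero]
      have : (n : ℝ) + j ≤ -1 := by exact_mod_cast (by omega : (n : ℤ) + j ≤ -1)
      linarith [hx.2]
    · have h5 : (N : ℤ) ≤ n + j := by
        by_contra h6
        exact hj' ((n : ℤ) + j).toNat (by omega) (by omega)
      have : (N : ℝ) ≤ n + j := by exact_mod_cast h5
      rw [hN (x + n + j), map_zero, mul_zero]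
      linarith [hx.1]

lemma sum_sq_fourier_le_corr (hA : Continuous A) (h0 : ∀ x ≤ 0, A x = 0)
    (hN : ∀ x, (N : ℝ) ≤ x → A x = 0) :
    ∫ x in (0:ℝ)..1, ‖∑ n ∈ Finset.range N, A (x + n)‖ ^ 2
      ≤ ‖corr A 0‖ + 2 * ∑ j ∈ Finset.Icc 1 N, ‖corr A (j : ℕ)‖ := by
  have h := integral_periodization_sq hA h0 hN
  have h1 : ∫ x in (0:ℝ)..1, ‖∑ n ∈ Finset.range N, A (x + n)‖ ^ 2
      ≤ ∑ j ∈ Finset.Ioo (-N : ℤ) N, ‖corr A j‖ := by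
    refine le_trans (le_abs_self _) ?_
    rw [← Real.norm_eq_abs, ← Complex.norm_real, h]
    exact norm_sum_le _ _
  refine h1.trans ?_
  have hsub : Finset.Ioo (-N : ℤ) N ⊆ {0} ∪ (((Finset.Icc 1 N).image (fun n : ℕ => (n : ℤ))) ∪
      ((Finset.Icc 1 N).image (fun n : ℕ => -(n : ℤ)))) := by
    intro j hj
    simp only [Finset.mem_Ioo, Finset.mem_union, Finset.mem_singleton, Finset.mem_image,
      Finset.mem_Icc] at hj ⊢
    rcases lt_trichotomy j 0 with h | h | h
    · right; right; exact ⟨(-j).toNat, by omega, by omega⟩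
    · left; exact h
    · right; left; exact ⟨j.toNat, by omega, by omega⟩
  refine (Finset.sum_le_sum_of_subset_of_nonneg hsub fun _ _ _ => norm_nonneg _).trans ?_
  have hu : ∀ (s t : Finset ℤ), ∑ j ∈ s ∪ t, ‖corr A j‖ ≤ ∑ j ∈ s, ‖corr A j‖ + ∑ j ∈ t, ‖corr A j‖ := by
    intro s t
    rw [← Finset.sum_union_inter]
    linarith [Finset.sum_nonneg (s := s ∩ t) fun j _ => norm_nonneg (corr A j)]
  refine (hu _ _).trans ?_
  refine (add_le_add le_rfl (hu _ _)).trans ?_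
  rw [Finset.sum_image (by intro a _ b _ h; simpa using h),
    Finset.sum_image (by intro a _ b _ h; simpa using h), Finset.sum_singleton]
  simp only [corr_neg, RCLike.norm_conj]
  linarith

lemma integral_periodization_sq_le (hA : Continuous A) {M : ℝ} (hM : ∀ x, ‖A x‖ ≤ M) :
    ∫ x in (0:ℝ)..1, ‖∑ n ∈ Finset.range N, A (x + n)‖ ^ 2 ≤ (N * M) ^ 2 := by
  have : ∫ x in (0:ℝ)..1, ‖∑ n ∈ Finset.range N, A (x + n)‖ ^ 2 ≤ ∫ x in (0:ℝ)..1, (N * M) ^ 2 := by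
    apply intervalIntegral.integral_mono_on zero_le_one
    · exact Continuous.intervalIntegrable (by fun_prop) _ _
    · exact intervalIntegrable_const
    · intro x _
      gcongr
      refine (norm_sum_le _ _).trans ((Finset.sum_le_sum fun n _ => hM _).trans ?_)
      simp
  simpa using this

end parseval

/-- The oscillating amplitude `b(x) e^{itφ(x)}`. -/
noncomputable def oscAmp (b : ℝ → ℝ) (t x : ℝ) : ℂ :=
  (b x : ℂ) * Complex.exp (((t * phi x : ℝ) : ℂ) * Complex.I)

/-- A linear combination of oscillating amplitudes. -/
noncomputable def oscSum (S : Finset ℤ) (c : ℤ → ℂ) (t : ℤ → ℝ) (b : ℝ → ℝ) (x : ℝ) : ℂ :=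
  ∑ r ∈ S, c r * oscAmp b (t r) x

section
variable {U : ℝ} {b b' : ℝ → ℝ}

lemma IsAmp.deriv_supp (hb : IsAmp U b b') {x : ℝ} (hx : x < U) : b' x = 0 := by
  have h1 : HasDerivAt b 0 x := by
    refine (hasDerivAt_const x (0:ℝ)).congr_of_eventuallyEq ?_
    filter_upwards [Iio_mem_nhds hx] with y hy
    exact hb.supp y fun h => absurd h.1 (not_le.2 hy)
  exact (hb.deriv x).unique h1

lemma IsAmp.deriv_supp' (hb : IsAmp U b b') {x : ℝ} (hx : 4 * U < x) : b' x = 0 := by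
  have h1 : HasDerivAt b 0 x := by
    refine (hasDerivAt_const x (0:ℝ)).congr_of_eventuallyEq ?_
    filter_upwards [Ioi_mem_nhds hx] with y hy
    exact hb.supp y fun h => absurd h.2 (not_le.2 hy)
  exact (hb.deriv x).unique h1

lemma hasDerivAt_oscAmp (hb : IsAmp U b b') (hU : 0 < U) (t x : ℝ) :
    HasDerivAt (oscAmp b t) (oscAmp b' t x + (-Complex.I * t) * oscAmp (fun x => b x / (x * (x + 1))) t x) x := by
  rcases lt_or_ge x U with hx | hx
  · have h1 : HasDerivAt (oscAmp b t) 0 x := by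
      refine (hasDerivAt_const x (0:ℂ)).congr_of_eventuallyEq ?_
      filter_upwards [Iio_mem_nhds hx] with y hy
      simp [oscAmp, hb.supp y fun h => absurd h.1 (not_le.2 hy)]
    refine h1.congr_deriv ?_
    simp [oscAmp, hb.deriv_supp hx, hb.supp x fun h => absurd h.1 (not_le.2 hx)]
  · have hx0 : 0 < x := by linarith
    have h2 := ((((hasDerivAt_phi hx0).const_mul t).ofReal_comp).mul_const Complex.I).cexp
    refine ((hb.deriv x).ofReal_comp.mul h2).congr_deriv ?_
    simp only [oscAmp]
    push_cast
    ring

lemma continuous_oscAmp (hb : IsAmp U b b') (hU : 0 < U) (t : ℝ) : Continuous (oscAmp b t) :=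
  continuous_iff_continuousAt.2 fun x => (hasDerivAt_oscAmp hb hU t x).continuousAt

lemma norm_oscAmp (t x : ℝ) : ‖oscAmp b t x‖ = |b x| := by
  rw [oscAmp, norm_mul, Complex.norm_exp_ofReal_mul_I, mul_one, Complex.norm_real, Real.norm_eq_abs]

lemma oscAmp_eq_zero {t x : ℝ} (h : b x = 0) : oscAmp b t x = 0 := by simp [oscAmp, h]

lemma continuous_oscSum (hb : IsAmp U b b') (hU : 0 < U) (S : Finset ℤ) (c : ℤ → ℂ) (t : ℤ → ℝ) :
    Continuous (oscSum S c t b) := by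
  unfold oscSum
  exact continuous_finsetSum _ fun r _ => continuous_const.mul (continuous_oscAmp hb hU _)

lemma oscSum_eq_zero {S : Finset ℤ} {c : ℤ → ℂ} {t : ℤ → ℝ} {x : ℝ} (h : b x = 0) :
    oscSum S c t b x = 0 := by
  unfold oscSum
  exact Finset.sum_eq_zero fun r _ => by rw [oscAmp_eq_zero h, mul_zero]

/-- Pair correlation. -/
noncomputable def pairCorr (b : ℝ → ℝ) (t s : ℝ) (j : ℝ) : ℂ :=
  ∫ x : ℝ, oscAmp b t x * conj (oscAmp b s (x + j))

lemma oscAmp_mul_conj (t s x y : ℝ) : oscAmp b t x * conj (oscAmp b s y)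
    = ((b x * b y : ℝ) : ℂ) * Complex.exp (((t * phi x - s * phi y : ℝ) : ℂ) * Complex.I) := by
  simp only [oscAmp, map_mul, Complex.conj_ofReal, ← Complex.exp_conj, Complex.conj_I]
  rw [show (b x : ℂ) * Complex.exp (((t * phi x : ℝ) : ℂ) * Complex.I) *
    ((b y : ℂ) * Complex.exp (((s * phi y : ℝ) : ℂ) * -Complex.I))
    = (b x : ℂ) * (b y : ℂ) * (Complex.exp (((t * phi x : ℝ) : ℂ) * Complex.I) *
      Complex.exp (((s * phi y : ℝ) : ℂ) * -Complex.I)) by ring, ← Complex.exp_add]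
  push_cast
  congr 2
  ring

lemma pairCorr_eq (hb : IsAmp U b b') {j : ℝ} (hj3 : j ≤ 3 * U) (t s : ℝ) :
    pairCorr b t s j = ∫ x in U..(4 * U - j), ((b x * b (x + j) : ℝ) : ℂ) *
      Complex.exp (((t * phi x - s * phi (x + j) : ℝ) : ℂ) * Complex.I) := by
  unfold pairCorr
  simp_rw [oscAmp_mul_conj]
  rw [intervalIntegral.integral_of_le (by linarith), ← integral_Icc_eq_integral_Ioc]
  symm
  apply setIntegral_eq_integral_of_forall_compl_eq_zero
  intro x hx
  have : b x * b (x + j) = 0 := by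
    by_contra h
    rw [mul_eq_zero, not_or] at h
    apply hx
    have h1 : x ∈ Set.Icc U (4 * U) := by by_contra h'; exact h.1 (hb.supp _ h')
    have h2 : x + j ∈ Set.Icc U (4 * U) := by by_contra h'; exact h.2 (hb.supp _ h')
    exact ⟨h1.1, by linarith [h2.2]⟩
  rw [this]; simp

lemma pairCorr_eq_zero (hb : IsAmp U b b') {j : ℝ} (hj3 : 3 * U < j) (t s : ℝ) :
    pairCorr b t s j = 0 := by
  unfold pairCorr
  simp_rw [oscAmp_mul_conj]
  rw [← integral_zero ℝ ℂ (μ := volume)]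
  refine integral_congr_ae (Filter.Eventually.of_forall fun x => ?_)
  have : b x * b (x + j) = 0 := by
    by_contra h
    rw [mul_eq_zero, not_or] at h
    have h1 : x ∈ Set.Icc U (4 * U) := by by_contra h'; exact h.1 (hb.supp _ h')
    have h2 : x + j ∈ Set.Icc U (4 * U) := by by_contra h'; exact h.2 (hb.supp _ h')
    linarith [h1.1, h2.2]
  simp [this]

lemma norm_pairCorr_shift (hb : IsAmp U b b') (hU : 1 ≤ U) {j T t s : ℝ} (hj : 0 < j)
    (hT : 0 < T) (hTs : T ≤ s) :
    ‖pairCorr b t s j‖ ≤ 2000 * (U ^ 3 + U ^ 2 * √(U * |t - s|)) / (T * j) := by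
  have hU0 : 0 < U := by linarith
  rcases le_or_gt j (3 * U) with h | h
  · rw [pairCorr_eq hb h]
    exact corr_shift_bound hb hU hj h hT hTs
  · rw [pairCorr_eq_zero hb h, norm_zero]
    positivity

lemma norm_pairCorr_zero (hb : IsAmp U b b') (hU : 1 ≤ U) {t s : ℝ} (hs : 0 ≤ s) (hts : t ≠ s) :
    ‖pairCorr b t s 0‖ ≤ 227 * U ^ 2 / |t - s| := by
  rw [pairCorr_eq hb (by linarith)]
  exact corr_zero_bound hb hU hs hts

lemma norm_pairCorr_diag (hb : IsAmp U b b') (hU : 1 ≤ U) {t s : ℝ} :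
    ‖pairCorr b t s 0‖ ≤ 3 * U := by
  rw [pairCorr_eq hb (by linarith)]
  exact corr_trivial_bound hb hU

lemma norm_corr_oscSum_le (hb : IsAmp U b b') (hU : 0 < U) (S : Finset ℤ) {c : ℤ → ℂ}
    (hc : ∀ r ∈ S, ‖c r‖ ≤ 1) (t : ℤ → ℝ) (j : ℤ) :
    ‖corr (oscSum S c t b) j‖ ≤ ∑ r ∈ S, ∑ s ∈ S, ‖pairCorr b (t r) (t s) j‖ := by
  have hintegr : ∀ r s : ℤ, Integrable fun x : ℝ => oscAmp b (t r) x * conj (oscAmp b (t s) (x + j)) := by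
    intro r s
    refine Continuous.integrable_of_hasCompactSupport ?_ ?_
    · have := continuous_oscAmp hb hU (t s)
      exact (continuous_oscAmp hb hU _).mul (Complex.continuous_conj.comp (by fun_prop))
    · refine HasCompactSupport.of_support_subset_isCompact (isCompact_Icc (a := U) (b := 4 * U)) ?_
      intro x hx
      by_contra h
      exact hx (by simp [oscAmp_eq_zero (hb.supp x h)])
  have e : corr (oscSum S c t b) j
      = ∑ r ∈ S, ∑ s ∈ S, c r * conj (c s) * pairCorr b (t r) (t s) j := by
    have h1 : ∀ r s : ℤ, c r * conj (c s) * pairCorr b (t r) (t s) j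
        = ∫ x : ℝ, c r * conj (c s) * (oscAmp b (t r) x * conj (oscAmp b (t s) (x + j))) :=
      fun r s => (integral_const_mul _ _).symm
    simp_rw [h1]
    have h2 : ∀ r : ℤ, ∑ s ∈ S, ∫ x : ℝ, c r * conj (c s) * (oscAmp b (t r) x * conj (oscAmp b (t s) (x + j)))
        = ∫ x : ℝ, ∑ s ∈ S, c r * conj (c s) * (oscAmp b (t r) x * conj (oscAmp b (t s) (x + j))) :=
      fun r => (integral_finsetSum _ fun s _ => (hintegr r s).const_mul _).symm
    simp_rw [h2]
    rw [← integral_finsetSum _ fun r _ => integrable_finsetSum _ fun s _ => (hintegr r s).const_mul _]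
    unfold corr
    refine integral_congr_ae (Filter.Eventually.of_forall fun x => ?_)
    simp only [oscSum, map_sum, map_mul]
    rw [Finset.sum_mul_sum]
    refine Finset.sum_congr rfl fun r _ => Finset.sum_congr rfl fun s _ => ?_
    ring
  rw [e]
  refine (norm_sum_le _ _).trans (Finset.sum_le_sum fun r hr => ?_)
  refine (norm_sum_le _ _).trans (Finset.sum_le_sum fun s hs => ?_)
  rw [norm_mul, norm_mul, RCLike.norm_conj]
  have : ‖c r‖ * ‖c s‖ ≤ 1 := mul_le_one₀ (hc r hr) (norm_nonneg _) (hc s hs)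
  calc _ ≤ 1 * ‖pairCorr b (t r) (t s) j‖ := by gcongr
    _ = _ := one_mul _

/-- The mean-square bound for oscillatory sums. -/
noncomputable def meanBound (R U T T0 G L : ℝ) : ℝ :=
  3 * R * U + 227 * R * U ^ 2 * L / G + 4000 * R ^ 2 * (U ^ 3 + U ^ 2 * √(U * T0)) * L / T

lemma meanSq_oscSum_le (hb : IsAmp U b b') (hU : 1 ≤ U) (S : Finset ℤ) {c : ℤ → ℂ}
    (hc : ∀ r ∈ S, ‖c r‖ ≤ 1) {t : ℤ → ℝ} {T T0 G L : ℝ} (hT : 0 < T) (ht : ∀ r ∈ S, T ≤ t r)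
    (hT0 : ∀ r ∈ S, ∀ s ∈ S, |t r - t s| ≤ T0) (hinj : ∀ r ∈ S, ∀ s ∈ S, r ≠ s → t r ≠ t s)
    (hL : ∀ r ∈ S, ∑ s ∈ S.erase r, 1 / |t r - t s| ≤ L / G)
    {N : ℕ} (hN : 4 * U < N) (hLN : ∑ j ∈ Finset.Icc 1 N, 1 / (j : ℝ) ≤ L) :
    ∫ x in (0:ℝ)..1, ‖∑ n ∈ Finset.range N, oscSum S c t b (x + n)‖ ^ 2
      ≤ meanBound S.card U T T0 G L := by
  have hU0 : 0 < U := by linarith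
  have hA := continuous_oscSum hb hU0 S c t
  refine (sum_sq_fourier_le_corr hA (fun x hx => oscSum_eq_zero (hb.supp x fun h => by linarith [h.1]))
    (fun x hx => oscSum_eq_zero (hb.supp x fun h => by linarith [h.2]))).trans ?_
  have h0 : ‖corr (oscSum S c t b) 0‖ ≤ 3 * S.card * U + 227 * S.card * U ^ 2 * L / G := by
    refine (norm_corr_oscSum_le hb hU0 S hc t 0).trans ?_
    calc _ ≤ ∑ r ∈ S, (3 * U + 227 * U ^ 2 * (L / G)) := by
          refine Finset.sum_le_sum fun r hr => ?_
          rw [← Finset.add_sum_erase S _ hr]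
          refine add_le_add (by simpa using norm_pairCorr_diag hb hU) ?_
          calc _ ≤ ∑ s ∈ S.erase r, 227 * U ^ 2 * (1 / |t r - t s|) := by
                refine Finset.sum_le_sum fun s hs => ?_
                have hs' := Finset.mem_of_mem_erase hs
                have := norm_pairCorr_zero hb hU (by linarith [ht s hs'])
                  (hinj r hr s hs' (Finset.ne_of_mem_erase hs).symm)
                simpa [div_eq_mul_inv] using this
            _ ≤ _ := by
                rw [← Finset.mul_sum]
                exact mul_le_mul_of_nonneg_left (hL r hr) (by positivity)
      _ = _ := by rw [Finset.sum_const, nsmul_eq_mul]; ring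
  have h1 : ∑ j ∈ Finset.Icc 1 N, ‖corr (oscSum S c t b) (j : ℕ)‖
      ≤ 2000 * (S.card : ℝ) ^ 2 * (U ^ 3 + U ^ 2 * √(U * T0)) * L / T := by
    calc _ ≤ ∑ j ∈ Finset.Icc 1 N,
          2000 * (S.card : ℝ) ^ 2 * (U ^ 3 + U ^ 2 * √(U * T0)) / T * (1 / (j : ℝ)) := by
          refine Finset.sum_le_sum fun j hj => ?_
          have hj0 : (0:ℝ) < j := by
            have := (Finset.mem_Icc.1 hj).1
            exact_mod_cast this
          refine (norm_corr_oscSum_le hb hU0 S hc t j).trans ?_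
          calc _ ≤ ∑ r ∈ S, ∑ s ∈ S, 2000 * (U ^ 3 + U ^ 2 * √(U * T0)) / (T * j) := by
                refine Finset.sum_le_sum fun r hr => Finset.sum_le_sum fun s hs => ?_
                have := norm_pairCorr_shift (t := t r) hb hU hj0 hT (ht s hs)
                refine le_trans this ?_
                have h5 := hT0 r hr s hs
                have h6 : √(U * |t r - t s|) ≤ √(U * T0) := Real.sqrt_le_sqrt (by gcongr)
                gcongr
            _ = _ := by
                simp only [Finset.sum_const, nsmul_eq_mul]
                field_simp
      _ ≤ _ := by
          rw [← Finset.mul_sum]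
          calc _ ≤ 2000 * (S.card : ℝ) ^ 2 * (U ^ 3 + U ^ 2 * √(U * T0)) / T * L := by
                gcongr
            _ = _ := by ring
  unfold meanBound
  have e : 4000 * (S.card : ℝ) ^ 2 * (U ^ 3 + U ^ 2 * √(U * T0)) * L / T
    = 2 * (2000 * (S.card : ℝ) ^ 2 * (U ^ 3 + U ^ 2 * √(U * T0)) * L / T) := by ring
  rw [e]
  linarith

end

/-- The divisor bound `d(n) ≪ n^δ`. -/
lemma exists_card_divisors_le {δ : ℝ} (hδ : 0 < δ) :
    ∃ C : ℝ, 1 ≤ C ∧ ∀ n : ℕ, n ≠ 0 → (n.divisors.card : ℝ) ≤ C * (n : ℝ) ^ δ := by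
  have hl : 0 < Real.log 2 := Real.log_pos (by norm_num)
  set C0 : ℝ := 1 + 1 / (δ * Real.log 2) with hC0
  have hC1 : 1 ≤ C0 := by
    have : 0 < 1 / (δ * Real.log 2) := by positivity
    linarith
  set B : ℕ := ⌈(2:ℝ) ^ (1 / δ)⌉₊ with hB
  refine ⟨C0 ^ B, one_le_pow₀ hC1, fun n hn => ?_⟩
  have hlocal : ∀ p : ℕ, p.Prime → ∀ e : ℕ,
      ((e + 1 : ℕ) : ℝ) ≤ (if p < B then C0 else 1) * ((p : ℝ) ^ e) ^ δ := by
    intro p hp e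
    have hp0 : (0:ℝ) < p := by exact_mod_cast hp.pos
    have hp2 : (2:ℝ) ≤ p := by exact_mod_cast hp.two_le
    split_ifs with h
    · have h1 : ((2:ℝ) ^ e) ^ δ ≤ ((p:ℝ) ^ e) ^ δ := by gcongr
      have h2 : 1 + e * δ * Real.log 2 ≤ ((2:ℝ) ^ e) ^ δ := by
        rw [← Real.rpow_natCast, ← Real.rpow_mul (by norm_num), Real.rpow_def_of_pos (by norm_num)]
        have := Real.add_one_le_exp (Real.log 2 * (e * δ))
        linarith
      have h3 : ((e + 1 : ℕ) : ℝ) ≤ C0 * (1 + e * δ * Real.log 2) := by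
        have e1 : C0 * (1 + e * δ * Real.log 2) = 1 + 1 / (δ * Real.log 2) + e * δ * Real.log 2 + e := by
          rw [hC0]; field_simp; ring
        rw [e1]
        push_cast
        have : 0 ≤ 1 / (δ * Real.log 2) := by positivity
        have : 0 ≤ e * δ * Real.log 2 := by positivity
        linarith
      calc _ ≤ C0 * (1 + e * δ * Real.log 2) := h3
        _ ≤ _ := by gcongr; exact h2.trans h1
    · have hpB : (2:ℝ) ^ (1 / δ) ≤ p := (Nat.le_ceil _).trans (by exact_mod_cast not_lt.1 h)
      have h1 : (2:ℝ) ≤ (p:ℝ) ^ δ := by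
        calc (2:ℝ) = ((2:ℝ) ^ (1 / δ)) ^ δ := by
              rw [← Real.rpow_mul (by norm_num), one_div_mul_cancel hδ.ne', Real.rpow_one]
          _ ≤ _ := by gcongr
      have h2 : ((p:ℝ) ^ e) ^ δ = ((p:ℝ) ^ δ) ^ e := by
        rw [← Real.rpow_natCast, ← Real.rpow_mul hp0.le, mul_comm, Real.rpow_mul hp0.le, Real.rpow_natCast]
      rw [one_mul, h2]
      calc ((e + 1 : ℕ) : ℝ) ≤ (2:ℝ) ^ e := by exact_mod_cast Nat.lt_two_pow_self
        _ ≤ _ := by gcongr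
  rw [Nat.card_divisors hn]
  conv_rhs => rw [← Nat.prod_factorization_pow_eq_self hn]
  rw [Nat.prod_factorization_eq_prod_primeFactors]
  push_cast
  rw [← Real.finsetProd_rpow _ _ (fun p _ => by positivity)]
  have h1 : ∏ p ∈ n.primeFactors, ((n.factorization p : ℝ) + 1)
      ≤ ∏ p ∈ n.primeFactors, ((if p < B then C0 else 1) * ((p : ℝ) ^ n.factorization p) ^ δ) := by
    refine Finset.prod_le_prod (fun p _ => by positivity) fun p hp => ?_
    have := hlocal p (Nat.prime_of_mem_primeFactors hp) (n.factorization p)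
    exact_mod_cast this
  refine h1.trans ?_
  rw [Finset.prod_mul_distrib]
  gcongr
  rw [Finset.prod_ite, Finset.prod_const_one, mul_one, Finset.prod_const]
  apply pow_le_pow_right₀ hC1
  calc _ ≤ (Finset.range B).card := Finset.card_le_card fun p hp => by
        simp only [Finset.mem_filter] at hp; simpa using hp.2
    _ = B := Finset.card_range B

lemma sum_hyperbola_le {g : ℕ → ℝ} (hg : ∀ m, 0 ≤ g m) (Y N : ℕ) :
    ∑ h ∈ Finset.Icc 1 Y, ∑ k ∈ Finset.Icc 1 N, g (h * k)
      ≤ ∑ m ∈ Finset.Icc 1 (Y * N), (m.divisors.card : ℝ) * g m := by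
  rw [← Finset.sum_product', ← Finset.sum_fiberwise_of_maps_to (t := Finset.Icc 1 (Y * N))
    (g := fun x : ℕ × ℕ => x.1 * x.2)]
  · refine Finset.sum_le_sum fun m hm => ?_
    rw [Finset.sum_congr rfl (g := fun _ => g m) (fun x hx => by rw [(Finset.mem_filter.1 hx).2]),
      Finset.sum_const, nsmul_eq_mul]
    refine mul_le_mul_of_nonneg_right ?_ (hg m)
    norm_cast
    refine Finset.card_le_card_of_injOn Prod.fst ?_ ?_
    · intro x hx
      simp only [Finset.coe_filter, Set.mem_ofPred_eq, Finset.mem_product, Finset.mem_Icc] at hx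
      simp only [Finset.mem_Icc] at hm
      simp only [Finset.mem_coe, Nat.mem_divisors]
      exact ⟨⟨x.2, hx.2.symm⟩, by omega⟩
    · intro x hx y hy hxy
      simp only [Finset.coe_filter, Set.mem_ofPred_eq, Finset.mem_product, Finset.mem_Icc] at hx hy
      refine Prod.ext hxy ?_
      have h1 := hx.2.trans hy.2.symm
      rw [hxy] at h1
      exact Nat.eq_of_mul_eq_mul_left (by omega) h1
  · intro x hx
    simp only [Finset.mem_product, Finset.mem_Icc] at hx ⊢
    exact ⟨Nat.one_le_iff_ne_zero.2 (Nat.mul_ne_zero (by omega) (by omega)), Nat.mul_le_mul hx.1.2 hx.2.2⟩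

lemma exists_sum_hyperbola_le {δ : ℝ} (hδ : 0 < δ) (hδ1 : δ ≤ 1 / 3) :
    ∃ C : ℝ, 1 ≤ C ∧ ∀ (K : ℝ), 1 ≤ K → ∀ (W : ℝ) (g : ℕ → ℝ), (∀ m, 0 ≤ g m) →
      (∀ M : ℕ, ∑ m ∈ Finset.Icc 1 M, (1 + (m:ℝ) ^ 2 / K ^ 2) * g m ^ 2 ≤ W) → ∀ Y N : ℕ,
      ∑ h ∈ Finset.Icc 1 Y, ∑ k ∈ Finset.Icc 1 N, g (h * k) ≤ C * K ^ ((1 + 3 * δ) / 2) * √W := by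
  obtain ⟨C, hC, hd⟩ := exists_card_divisors_le hδ
  have hsum : Summable fun m : ℕ => (1:ℝ) / (m:ℝ) ^ (1 + δ) := Real.summable_one_div_nat_rpow.2 (by linarith)
  set Z := ∑' m : ℕ, (1:ℝ) / (m:ℝ) ^ (1 + δ) with hZ
  have hZ1 : 1 ≤ Z := by
    have := hsum.le_tsum 1 (fun m _ => by positivity)
    rw [hZ]
    refine le_trans (by simp) this
  refine ⟨C * √Z, one_le_mul_of_one_le_of_one_le hC (Real.one_le_sqrt.2 hZ1), ?_⟩
  intro K hK W g hg hW Y N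
  have hK0 : 0 < K := by linarith
  refine (sum_hyperbola_le hg Y N).trans ?_
  have h1 : ∑ m ∈ Finset.Icc 1 (Y * N), (m.divisors.card : ℝ) * g m
      ≤ C * ∑ m ∈ Finset.Icc 1 (Y * N), (m:ℝ) ^ (-(1 + δ) / 2) * ((m:ℝ) ^ ((1 + 3 * δ) / 2) * g m) := by
    rw [Finset.mul_sum]
    refine Finset.sum_le_sum fun m hm => ?_
    have hm1 := (Finset.mem_Icc.1 hm).1
    have hm0 : (0:ℝ) < m := by exact_mod_cast hm1
    have e : (m:ℝ) ^ (-(1 + δ) / 2) * ((m:ℝ) ^ ((1 + 3 * δ) / 2) * g m) = (m:ℝ) ^ δ * g m := by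
      rw [← mul_assoc, ← Real.rpow_add hm0]; congr 2; ring
    rw [e, ← mul_assoc]
    exact mul_le_mul_of_nonneg_right (hd m (by omega)) (hg m)
  refine h1.trans ?_
  rw [mul_assoc, mul_assoc]
  refine mul_le_mul_of_nonneg_left ?_ (by linarith)
  refine (Real.sum_mul_le_sqrt_mul_sqrt _ _ _).trans ?_
  have hA : ∑ m ∈ Finset.Icc 1 (Y * N), ((m:ℝ) ^ (-(1 + δ) / 2)) ^ 2 ≤ Z := by
    refine le_trans (Finset.sum_le_sum fun m hm => ?_) (hsum.sum_le_tsum (Finset.Icc 1 (Y * N)) fun m _ => by positivity)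
    have hm1 := (Finset.mem_Icc.1 hm).1
    have hm0 : (0:ℝ) < m := by exact_mod_cast hm1
    rw [← Real.rpow_natCast, ← Real.rpow_mul hm0.le, one_div, ← Real.rpow_neg hm0.le]
    apply le_of_eq; congr 1; push_cast; ring
  have hB : ∑ m ∈ Finset.Icc 1 (Y * N), ((m:ℝ) ^ ((1 + 3 * δ) / 2) * g m) ^ 2 ≤ K ^ (1 + 3 * δ) * W := by
    refine le_trans ?_ (mul_le_mul_of_nonneg_left (hW (Y * N)) (by positivity))
    rw [Finset.mul_sum]
    refine Finset.sum_le_sum fun m hm => ?_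
    have hm1 := (Finset.mem_Icc.1 hm).1
    have hm0 : (0:ℝ) < m := by exact_mod_cast hm1
    rw [mul_pow, ← mul_assoc]
    refine mul_le_mul_of_nonneg_right ?_ (sq_nonneg _)
    rw [← Real.rpow_natCast, ← Real.rpow_mul hm0.le]
    have e : (1 + 3 * δ) / 2 * ((2:ℕ):ℝ) = 1 + 3 * δ := by push_cast; ring
    rw [e]
    rcases le_total (m:ℝ) K with h | h
    · calc (m:ℝ) ^ (1 + 3 * δ) ≤ K ^ (1 + 3 * δ) * 1 := by rw [mul_one]; gcongr
        _ ≤ _ := by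
          gcongr
          have : 0 ≤ (m:ℝ) ^ 2 / K ^ 2 := by positivity
          linarith
    · have h1 : (m:ℝ) = K * (m / K) := by field_simp
      have h2 : 1 ≤ (m:ℝ) / K := by rwa [one_le_div hK0]
      calc (m:ℝ) ^ (1 + 3 * δ) = K ^ (1 + 3 * δ) * ((m:ℝ) / K) ^ (1 + 3 * δ) := by
            rw [← Real.mul_rpow hK0.le (by positivity), ← h1]
        _ ≤ K ^ (1 + 3 * δ) * ((m:ℝ) / K) ^ ((2:ℕ):ℝ) := by
            gcongr
            push_cast; linarith
        _ = K ^ (1 + 3 * δ) * ((m:ℝ) ^ 2 / K ^ 2) := by rw [Real.rpow_natCast, div_pow]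
        _ ≤ _ := by gcongr; linarith
  have hK2 : √(K ^ (1 + 3 * δ)) = K ^ ((1 + 3 * δ) / 2) := by
    rw [Real.sqrt_eq_rpow, ← Real.rpow_mul hK0.le]; congr 1; ring
  calc _ ≤ √Z * √(K ^ (1 + 3 * δ) * W) := by gcongr
    _ = _ := by rw [Real.sqrt_mul (by positivity), hK2]

section
variable {U : ℝ} {b b' : ℝ → ℝ}

/-- Dividing an amplitude by `3 x (x + 1) / U ^ 2` gives an amplitude. -/
lemma IsAmp.div_p (hb : IsAmp U b b') (hU : 1 ≤ U) :
    IsAmp U (fun x => U ^ 2 / 3 * (b x / (x * (x + 1))))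
      (fun x => U ^ 2 / 3 * (b' x / (x * (x + 1)) - b x * (2 * x + 1) / (x * (x + 1)) ^ 2)) := by
  have hU0 : 0 < U := by linarith
  have hbc : Continuous b := continuous_iff_continuousAt.2 fun x => (hb.deriv x).continuousAt
  have hbz : ∀ x, x < U → b x = 0 := fun x hx => hb.supp x fun h => absurd h.1 (not_le.2 hx)
  have hp : ∀ x, U ≤ x → U ^ 2 ≤ x * (x + 1) := fun x hx => by nlinarith
  constructor
  · intro x
    rcases lt_or_ge x U with hx | hx
    · have h1 : HasDerivAt (fun x => U ^ 2 / 3 * (b x / (x * (x + 1)))) 0 x := by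
        refine (hasDerivAt_const x (0:ℝ)).congr_of_eventuallyEq ?_
        filter_upwards [Iio_mem_nhds hx] with y hy
        simp [hbz y hy]
      refine h1.congr_deriv ?_
      simp [hb.deriv_supp hx, hbz x hx]
    · have hx0 : 0 < x := by linarith
      have h1 : HasDerivAt (fun x : ℝ => x * (x + 1)) (1 * (x + 1) + x * 1) x :=
        (hasDerivAt_id x).mul ((hasDerivAt_id x).add_const 1)
      refine (((hb.deriv x).div h1 (by positivity)).const_mul (U ^ 2 / 3)).congr_deriv ?_
      field_simp
      ring
  · rw [continuous_iff_continuousAt]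
    intro x
    rcases lt_or_ge x U with hx | hx
    · have : (fun x => U ^ 2 / 3 * (b' x / (x * (x + 1)) - b x * (2 * x + 1) / (x * (x + 1)) ^ 2))
          =ᶠ[nhds x] fun _ => 0 := by
        filter_upwards [Iio_mem_nhds hx] with y hy
        simp [hbz y hy, hb.deriv_supp hy]
      exact (continuousAt_congr this).2 continuousAt_const
    · have hx0 : 0 < x := by linarith
      have h1 := hb.cont.continuousAt (x := x)
      have h2 := hbc.continuousAt (x := x)
      refine continuousAt_const.mul (ContinuousAt.sub (h1.div (by fun_prop) (by positivity))
        ((h2.mul (by fun_prop)).div (by fun_prop) (by positivity)))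
  · intro x hx
    simp [hb.supp x hx]
  · intro x
    rcases lt_or_ge x U with hx | hx
    · simp [hbz x hx]
    · have hx0 : 0 < x := by linarith
      rw [abs_mul, abs_of_nonneg (by positivity : 0 ≤ U ^ 2 / 3), abs_div,
        abs_of_pos (by positivity : 0 < x * (x + 1)), ← mul_div_assoc, div_le_one (by positivity)]
      calc U ^ 2 / 3 * |b x| ≤ U ^ 2 / 3 * 1 := by gcongr; exact hb.bound x
        _ ≤ _ := by linarith [hp x hx, sq_nonneg U]
  · intro x
    rcases lt_or_ge x U with hx | hx
    · simp [hbz x hx, hb.deriv_supp hx]; linarith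
    · have hx0 : 0 < x := by linarith
      have h1 : |b' x / (x * (x + 1))| ≤ 1 / U / U ^ 2 := by
        rw [abs_div, abs_of_pos (by positivity : 0 < x * (x + 1))]
        exact div_le_div₀ (by positivity) (hb.bound' x) (by positivity) (hp x hx)
      have h2 : |b x * (2 * x + 1) / (x * (x + 1)) ^ 2| ≤ 2 / U / U ^ 2 := by
        rw [abs_div, abs_mul, abs_of_pos (by positivity : 0 < (x * (x + 1)) ^ 2),
          abs_of_pos (by positivity : 0 < 2 * x + 1)]
        calc |b x| * (2 * x + 1) / (x * (x + 1)) ^ 2 ≤ 1 * (2 * (x + 1)) / (x * (x + 1)) ^ 2 := by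
              gcongr
              · exact hb.bound x
              · linarith
          _ = 2 / x / (x * (x + 1)) := by field_simp
          _ ≤ _ := by
            have := hp x hx
            gcongr
      rw [abs_mul, abs_of_nonneg (by positivity : 0 ≤ U ^ 2 / 3)]
      calc _ ≤ U ^ 2 / 3 * (1 / U / U ^ 2 + 2 / U / U ^ 2) := by
            gcongr
            exact (abs_sub _ _).trans (add_le_add h1 h2)
        _ = _ := by field_simp; ring

lemma continuous_oscAmp_deriv (hb : IsAmp U b b') (hU : 0 < U) (t : ℝ) : Continuous (oscAmp b' t) := by
  rw [continuous_iff_continuousAt]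
  intro x
  rcases lt_or_ge x U with hx | hx
  · have : oscAmp b' t =ᶠ[nhds x] fun _ => 0 := by
      filter_upwards [Iio_mem_nhds hx] with y hy
      simp [oscAmp, hb.deriv_supp hy]
    exact (continuousAt_congr this).2 continuousAt_const
  · have hx0 : 0 < x := by linarith
    have h1 := hb.cont.continuousAt (x := x)
    have h2 := (hasDerivAt_phi hx0).continuousAt
    unfold oscAmp
    fun_prop

variable {S : Finset ℤ} {c : ℤ → ℂ} {t : ℤ → ℝ}

lemma hasDerivAt_oscSum (hb : IsAmp U b b') (hU : 0 < U) {T : ℝ} (hT : 0 < T) (x : ℝ) :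
    HasDerivAt (oscSum S c t b) (oscSum S c t b' x + (12 * T / U ^ 2 : ℝ) *
      oscSum S (fun r => c r * (-Complex.I * (t r / (4 * T) : ℝ))) t
        (fun x => U ^ 2 / 3 * (b x / (x * (x + 1)))) x) x := by
  have h1 : HasDerivAt (oscSum S c t b) (∑ r ∈ S, c r * (oscAmp b' (t r) x +
      (-Complex.I * t r) * oscAmp (fun x => b x / (x * (x + 1))) (t r) x)) x := by
    unfold oscSum
    exact HasDerivAt.fun_sum fun r _ => (hasDerivAt_oscAmp hb hU (t r) x).const_mul (c r)
  refine h1.congr_deriv ?_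
  unfold oscSum
  rw [Finset.mul_sum, ← Finset.sum_add_distrib]
  refine Finset.sum_congr rfl fun r _ => ?_
  have hTc : (T : ℂ) ≠ 0 := by exact_mod_cast hT.ne'
  have hUc : (U : ℂ) ≠ 0 := by exact_mod_cast hU.ne'
  simp only [oscAmp]
  push_cast
  rw [mul_add]
  congr 1
  field_simp
  ring

end

/-- Data for a well-spaced family of frequencies in a window. -/
structure IsFreq (S : Finset ℤ) (t : ℤ → ℝ) (T T0 G L : ℝ) : Prop where
  pos : 1 ≤ T
  lower : ∀ r ∈ S, T ≤ t r
  upper : ∀ r ∈ S, t r ≤ 4 * T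
  window : ∀ r ∈ S, ∀ s ∈ S, |t r - t s| ≤ T0
  inj : ∀ r ∈ S, ∀ s ∈ S, r ≠ s → t r ≠ t s
  spaced : ∀ r ∈ S, ∑ s ∈ S.erase r, 1 / |t r - t s| ≤ L / G

section
variable {U : ℝ} {b b' : ℝ → ℝ} {S : Finset ℤ} {t : ℤ → ℝ} {T T0 G L : ℝ}

lemma oscSum_hasCompactSupport (hb : ∀ x, x ∉ Set.Icc U (4 * U) → b x = 0) (c : ℤ → ℂ) :
    HasCompactSupport (oscSum S c t b) := by
  refine HasCompactSupport.of_support_subset_isCompact (isCompact_Icc (a := U) (b := 4 * U)) ?_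
  intro x hx
  by_contra h
  exact hx (oscSum_eq_zero (hb x h))

lemma exists_deriv_supp (hb : IsAmp U b b') : ∀ x, x ∉ Set.Icc U (4 * U) → b' x = 0 := by
  intro x hx
  rcases lt_or_ge x U with h | h
  · exact hb.deriv_supp h
  · exact hb.deriv_supp' (by by_contra h'; exact hx ⟨h, not_lt.1 h'⟩)

/-- Weighted mean square of the Fourier coefficients at integers. -/
lemma weighted_meanSq (hb : IsAmp U b b') (hU : 1 ≤ U) (hS : IsFreq S t T T0 G L)
    {N : ℕ} (hN : 4 * U < N) (hN6 : N ≤ 6 * U) (hLN : ∑ j ∈ Finset.Icc 1 N, 1 / (j : ℝ) ≤ L)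
    {K : ℝ} (hK : 1 ≤ K) (hKT : T / U ^ 2 ≤ K) (F : Finset ℤ) :
    ∑ m ∈ F, (1 + (m:ℝ) ^ 2 / K ^ 2) * ‖𝓕 (oscSum S 1 t b) m‖ ^ 2
      ≤ 9 * meanBound S.card U T T0 G L + 2 * (S.card : ℝ) ^ 2 / K ^ 2 := by
  have hU0 : 0 < U := by linarith
  have hT : 0 < T := by linarith [hS.pos]
  have hK0 : 0 < K := by linarith
  set Q := meanBound S.card U T T0 G L with hQ
  set A := oscSum S 1 t b with hA
  set c2 : ℤ → ℂ := fun r => (1 : ℤ → ℂ) r * (-Complex.I * (t r / (4 * T) : ℝ)) with hc2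
  set b2 : ℝ → ℝ := fun x => U ^ 2 / 3 * (b x / (x * (x + 1))) with hb2
  have hb2A := hb.div_p hU
  have hAc : Continuous A := continuous_oscSum hb hU0 S 1 t
  have hder := fun x => hasDerivAt_oscSum (S := S) (c := 1) (t := t) hb hU0 hT x
  have hzero : ∀ {a : ℝ → ℝ} (ha : ∀ x, x ∉ Set.Icc U (4 * U) → a x = 0) (c : ℤ → ℂ),
      (∀ x ≤ 0, oscSum S c t a x = 0) ∧ (∀ x, (N:ℝ) ≤ x → oscSum S c t a x = 0) := by
    intro a ha c
    exact ⟨fun x hx => oscSum_eq_zero (ha x fun h => by linarith [h.1]),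
      fun x hx => oscSum_eq_zero (ha x fun h => by linarith [h.2])⟩
  have hP1c : Continuous (oscSum S 1 t b') := by
    unfold oscSum
    exact continuous_finsetSum _ fun r _ => continuous_const.mul (continuous_oscAmp_deriv hb hU0 _)
  have hP2c : Continuous (oscSum S c2 t b2) := continuous_oscSum hb2A hU0 S c2 t
  set A' : ℝ → ℂ := fun x => oscSum S 1 t b' x + (12 * T / U ^ 2 : ℝ) * oscSum S c2 t b2 x with hA'
  have hA'c : Continuous A' := hP1c.add (continuous_const.mul hP2c)
  have hdA : deriv A = A' := funext fun x => (hder x).deriv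
  have z1 := hzero (exists_deriv_supp hb) 1
  have z2 : (∀ x ≤ 0, oscSum S c2 t b2 x = 0) ∧ (∀ x, (N:ℝ) ≤ x → oscSum S c2 t b2 x = 0) :=
    hzero hb2A.supp c2
  have sumA := hasSum_sq_fourier hAc (hzero hb.supp 1).1 (hzero hb.supp 1).2
  have sumA' := hasSum_sq_fourier (N := N) hA'c (fun x hx => by simp [hA', z1.1 x hx, z2.1 x hx])
    (fun x hx => by simp [hA', z1.2 x hx, z2.2 x hx])
  have hA'cs : HasCompactSupport A' := by
    rw [← hdA]; exact (oscSum_hasCompactSupport hb.supp 1).deriv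
  have hfd := Real.fourier_deriv (f := A)
    (hAc.integrable_of_hasCompactSupport (oscSum_hasCompactSupport hb.supp 1))
    (fun x => (hder x).differentiableAt)
    (by rw [hdA]; exact hA'c.integrable_of_hasCompactSupport hA'cs)
  rw [hdA] at hfd
  have hm : ∀ m : ℤ, (m:ℝ) ^ 2 * ‖𝓕 A m‖ ^ 2 ≤ ‖𝓕 A' m‖ ^ 2 / 36 := by
    intro m
    rw [hfd]
    simp only [norm_smul, norm_mul, Complex.norm_I, Complex.norm_real, mul_one, Real.norm_eq_abs,
      Complex.norm_ofNat, abs_of_pos Real.pi_pos, mul_pow, sq_abs]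
    have h2 : (36:ℝ) ≤ 2 ^ 2 * π ^ 2 := by nlinarith [Real.pi_gt_three]
    have h3 : 0 ≤ (m:ℝ) ^ 2 * ‖𝓕 A m‖ ^ 2 := by positivity
    rw [le_div_iff₀ (by norm_num)]
    nlinarith
  have hmA : ∫ x in (0:ℝ)..1, ‖∑ n ∈ Finset.range N, A (x + n)‖ ^ 2 ≤ Q :=
    meanSq_oscSum_le hb hU S (by simp) hT hS.lower hS.window hS.inj hS.spaced hN hLN
  have hmP2 : ∫ x in (0:ℝ)..1, ‖∑ n ∈ Finset.range N, oscSum S c2 t b2 (x + n)‖ ^ 2 ≤ Q := by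
    refine meanSq_oscSum_le hb2A hU S (fun r hr => ?_) hT hS.lower hS.window hS.inj hS.spaced hN hLN
    simp only [hc2, Pi.one_apply, one_mul, norm_mul, norm_neg, Complex.norm_I, Complex.norm_real,
      Real.norm_eq_abs]
    have := hS.lower r hr
    rw [abs_of_nonneg (div_nonneg (by linarith) (by positivity)), div_le_one (by positivity)]
    exact hS.upper r hr
  have hmP1 : ∫ x in (0:ℝ)..1, ‖∑ n ∈ Finset.range N, oscSum S 1 t b' (x + n)‖ ^ 2
      ≤ 36 * (S.card : ℝ) ^ 2 := by
    refine (integral_periodization_sq_le hP1c (M := S.card / U) fun x => ?_).trans ?_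
    · unfold oscSum
      refine (norm_sum_le _ _).trans ((Finset.sum_le_sum fun r _ => ?_).trans_eq
        (b := ∑ r ∈ S, 1 / U) ?_)
      · rw [norm_mul, norm_oscAmp]; simpa using hb.bound' x
      · simp [div_eq_mul_inv]
    · have : (N:ℝ) * (S.card / U) ≤ 6 * S.card := by
        rw [← mul_div_assoc, div_le_iff₀ hU0]
        nlinarith [Nat.cast_nonneg (α := ℝ) S.card]
      calc _ ≤ (6 * (S.card:ℝ)) ^ 2 := by gcongr
        _ = _ := by ring
  have hmA' : ∫ x in (0:ℝ)..1, ‖∑ n ∈ Finset.range N, A' (x + n)‖ ^ 2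
      ≤ 72 * (S.card : ℝ) ^ 2 + 288 * K ^ 2 * Q := by
    have hc1 : Continuous fun x : ℝ => ‖∑ n ∈ Finset.range N, oscSum S 1 t b' (x + n)‖ ^ 2 := by fun_prop
    have hc2' : Continuous fun x : ℝ => ‖∑ n ∈ Finset.range N, oscSum S c2 t b2 (x + n)‖ ^ 2 := by fun_prop
    calc _ ≤ ∫ x in (0:ℝ)..1, (2 * ‖∑ n ∈ Finset.range N, oscSum S 1 t b' (x + n)‖ ^ 2 +
            2 * (12 * K) ^ 2 * ‖∑ n ∈ Finset.range N, oscSum S c2 t b2 (x + n)‖ ^ 2) := by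
          apply intervalIntegral.integral_mono_on zero_le_one
          · exact Continuous.intervalIntegrable (by fun_prop) _ _
          · exact Continuous.intervalIntegrable ((hc1.const_mul _).add (hc2'.const_mul _)) _ _
          · intro x _
            simp only [hA']
            rw [Finset.sum_add_distrib, ← Finset.mul_sum]
            set u := ‖∑ n ∈ Finset.range N, oscSum S 1 t b' (x + n)‖ with hu
            set v := ‖∑ n ∈ Finset.range N, oscSum S c2 t b2 (x + n)‖ with hv
            have h1 : ‖∑ n ∈ Finset.range N, oscSum S 1 t b' (x + n) + ((12 * T / U ^ 2 : ℝ) : ℂ) *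
                ∑ n ∈ Finset.range N, oscSum S c2 t b2 (x + n)‖ ≤ u + 12 * K * v := by
              refine (norm_add_le _ _).trans ?_
              rw [norm_mul, Complex.norm_real, Real.norm_eq_abs, abs_of_pos (by positivity)]
              have : 12 * T / U ^ 2 ≤ 12 * K := by rw [mul_div_assoc]; linarith
              have hv0 : 0 ≤ v := norm_nonneg _
              gcongr
            calc _ ≤ (u + 12 * K * v) ^ 2 := by gcongr
              _ ≤ _ := by nlinarith [sq_nonneg (u - 12 * K * v)]
      _ = 2 * (∫ x in (0:ℝ)..1, ‖∑ n ∈ Finset.range N, oscSum S 1 t b' (x + n)‖ ^ 2) +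
            2 * (12 * K) ^ 2 * (∫ x in (0:ℝ)..1, ‖∑ n ∈ Finset.range N, oscSum S c2 t b2 (x + n)‖ ^ 2) := by
          rw [intervalIntegral.integral_add ((hc1.const_mul _).intervalIntegrable _ _)
            ((hc2'.const_mul _).intervalIntegrable _ _), intervalIntegral.integral_const_mul,
            intervalIntegral.integral_const_mul]
      _ ≤ 2 * (36 * (S.card : ℝ) ^ 2) + 2 * (12 * K) ^ 2 * Q := by gcongr
      _ = _ := by ring
  have hF1 : ∑ m ∈ F, ‖𝓕 A m‖ ^ 2 ≤ Q := (sum_le_hasSum F (fun _ _ => by positivity) sumA).trans hmA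
  have hF2 : ∑ m ∈ F, ‖𝓕 A' m‖ ^ 2 ≤ 72 * (S.card : ℝ) ^ 2 + 288 * K ^ 2 * Q :=
    (sum_le_hasSum F (fun _ _ => by positivity) sumA').trans hmA'
  calc _ ≤ ∑ m ∈ F, (‖𝓕 A m‖ ^ 2 + ‖𝓕 A' m‖ ^ 2 / 36 / K ^ 2) := by
        refine Finset.sum_le_sum fun m _ => ?_
        have := hm m
        have e : (1 + (m:ℝ) ^ 2 / K ^ 2) * ‖𝓕 A m‖ ^ 2
          = ‖𝓕 A m‖ ^ 2 + (m:ℝ) ^ 2 * ‖𝓕 A m‖ ^ 2 / K ^ 2 := by ring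
        rw [e]
        gcongr
    _ = ∑ m ∈ F, ‖𝓕 A m‖ ^ 2 + (∑ m ∈ F, ‖𝓕 A' m‖ ^ 2) / 36 / K ^ 2 := by
        rw [Finset.sum_add_distrib, Finset.sum_div, Finset.sum_div]
    _ ≤ Q + (72 * (S.card : ℝ) ^ 2 + 288 * K ^ 2 * Q) / 36 / K ^ 2 := by gcongr
    _ = _ := by field_simp; ring

end

lemma fourier_comp_div (A : ℝ → ℂ) {h : ℝ} (hh : 0 < h) (w : ℝ) :
    𝓕 (fun x => A (x / h)) w = h * 𝓕 A (h * w) := by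
  rw [Real.fourier_real_eq_integral_exp_smul, Real.fourier_real_eq_integral_exp_smul]
  have := Measure.integral_comp_div (fun x => Complex.exp (↑(-2 * π * x * (h * w)) * Complex.I) • A x) h
  rw [abs_of_pos hh] at this
  rw [← Complex.real_smul, ← this]
  congr 1
  ext x
  congr 3
  field_simp

lemma sum_eq_tsum_fourier {A : ℝ → ℂ} {N M h : ℕ} (hA : Continuous A) (h0 : ∀ x ≤ 0, A x = 0)
    (hN : ∀ x, (N : ℝ) ≤ x → A x = 0) (hh : 1 ≤ h) (hM : N * h ≤ M)
    (hs : Summable fun k : ℤ => 𝓕 A ((h : ℝ) * k)) :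
    (1 / h : ℂ) * ∑ n ∈ Finset.Icc 1 M, A (n / h) = ∑' k : ℤ, 𝓕 A ((h : ℝ) * k) := by
  have hh0 : (0:ℝ) < h := by exact_mod_cast hh
  have hhc : (h:ℂ) ≠ 0 := by exact_mod_cast hh0.ne'
  let f : C(ℝ, ℂ) := ⟨fun x => A (x / h), by fun_prop⟩
  have hff : ∀ k : ℤ, 𝓕 (f : ℝ → ℂ) k = h * 𝓕 A ((h : ℝ) * k) := fun k => by
    simpa [f] using fourier_comp_div A hh0 k
  have hfz : ∀ x : ℝ, (x ≤ 0 ∨ (M : ℝ) ≤ x) → f x = 0 := by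
    rintro x (hx | hx)
    · exact h0 _ (div_nonpos_of_nonpos_of_nonneg hx hh0.le)
    · refine hN _ ?_
      rw [le_div_iff₀ hh0]
      exact le_trans (by exact_mod_cast hM) hx
  have key := Real.tsum_eq_tsum_fourier (f := f) (fun K => by
      obtain ⟨R, hR⟩ := K.isCompact.isBounded.subset_closedBall 0
      obtain ⟨P, hP⟩ := exists_nat_ge R
      refine summable_of_hasFiniteSupport ((Finset.Icc (-(P:ℤ)) (M + P)).finite_toSet.subset ?_)
      intro n hn
      by_contra hn'
      apply hn
      rw [norm_eq_zero]
      ext x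
      have hx := hR x.2
      rw [mem_closedBall_zero_iff, Real.norm_eq_abs, abs_le] at hx
      simp only [ContinuousMap.restrict_apply, ContinuousMap.comp_apply, ContinuousMap.coe_addRight,
        ContinuousMap.zero_apply]
      apply hfz
      rw [Finset.mem_coe, Finset.mem_Icc, not_and_or, not_le, not_le] at hn'
      rcases hn' with h' | h'
      · left
        have : (n:ℝ) < -(P:ℝ) := by exact_mod_cast h'
        linarith [hx.2]
      · right
        have : (M:ℝ) + P < (n:ℝ) := by exact_mod_cast h'
        linarith [hx.1])
    (by simp_rw [hff]; exact hs.mul_left _) 0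
  simp only [zero_add, hff] at key
  have e1 : ∑' n : ℤ, f n = ∑ n ∈ Finset.Icc 1 M, A (n / h) := by
    rw [tsum_eq_sum (s := (Finset.Icc 1 M).map Nat.castEmbedding)]
    · rw [Finset.sum_map]
      refine Finset.sum_congr rfl fun n _ => ?_
      simp [f]
    · intro n hn
      apply hfz
      by_contra! hc
      apply hn
      rw [Finset.mem_map]
      have h1 : 0 < n := by exact_mod_cast hc.1
      have h2 : n < M := by exact_mod_cast hc.2
      refine ⟨n.toNat, ?_, ?_⟩
      · rw [Finset.mem_Icc]; omega
      · simp; omega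
  rw [← e1, key]
  simp only [QuotientAddGroup.mk_zero, fourier_eval_zero, mul_one]
  rw [tsum_mul_left, ← mul_assoc]
  field_simp

lemma sum_int_le_sum_nat {f : ℤ → ℝ} (hf : ∀ k, 0 ≤ f k) (F : Finset ℤ) :
    ∃ N : ℕ, ∑ k ∈ F, f k ≤ f 0 + ∑ k ∈ Finset.Icc 1 N, (f k + f (-(k:ℤ))) := by
  set N := F.sup Int.natAbs with hN
  refine ⟨N, ?_⟩
  have hsub : F ⊆ ({0} ∪ (Finset.Icc 1 N).image (fun k : ℕ => (k:ℤ))) ∪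
      (Finset.Icc 1 N).image (fun k : ℕ => -(k:ℤ)) := by
    intro k hk
    have h1 : k.natAbs ≤ N := Finset.le_sup (f := Int.natAbs) hk
    simp only [Finset.mem_union, Finset.mem_singleton, Finset.mem_image, Finset.mem_Icc]
    rcases lt_trichotomy k 0 with h | h | h
    · exact Or.inr ⟨k.natAbs, by omega, by omega⟩
    · exact Or.inl (Or.inl h)
    · exact Or.inl (Or.inr ⟨k.natAbs, by omega, by omega⟩)
  have hu : ∀ A B : Finset ℤ, ∑ k ∈ A ∪ B, f k ≤ ∑ k ∈ A, f k + ∑ k ∈ B, f k := fun A B => by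
    rw [← Finset.sum_union_inter]
    linarith [Finset.sum_nonneg fun k (_ : k ∈ A ∩ B) => hf k]
  calc _ ≤ _ := Finset.sum_le_sum_of_subset_of_nonneg hsub fun k _ _ => hf k
    _ ≤ _ := (hu _ _).trans (add_le_add (hu _ _) le_rfl)
    _ = _ := by
      rw [Finset.sum_image (by intro a _ b _ h; simpa using h),
        Finset.sum_image (by intro a _ b _ h; simpa using h), Finset.sum_singleton,
        Finset.sum_add_distrib, add_assoc]

section
variable {U : ℝ} {b b' : ℝ → ℝ} {S : Finset ℤ} {t : ℤ → ℝ} {T T0 G L : ℝ}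

lemma norm_integral_oscAmp_le (hb : IsAmp U b b') (hU : 1 ≤ U) (hT : 0 < T) {t : ℝ} (ht : T ≤ t) :
    ‖∫ x, oscAmp b t x‖ ≤ 167 * U ^ 2 / T := by
  have hle : U ≤ 4 * U := by linarith
  have hU0 : 0 < U := by linarith
  have hbc' := hb.cont
  have hbc : Continuous b := continuous_iff_continuousAt.2 fun x => (hb.deriv x).continuousAt
  have hintegr : ∫ x, oscAmp b t x = ∫ x in U..(4 * U), oscAmp b t x := by
    rw [intervalIntegral.integral_of_le hle, ← integral_Icc_eq_integral_Ioc]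
    symm
    apply setIntegral_eq_integral_of_forall_compl_eq_zero
    intro x hx
    exact oscAmp_eq_zero (hb.supp x hx)
  have key := osc_first_aux (f := fun x => t * phi x) (q := fun _ => -t) (q' := fun _ => 0)
    (p := fun x => x * (x + 1)) (c := fun x => ((b x * (x * (x + 1)) : ℝ) : ℂ))
    (c' := fun x => ((b' x * (x * (x + 1)) + b x * (2 * x + 1) : ℝ) : ℂ))
    (Cc := 20 * U ^ 2) (C' := 29 * U) hle hT
    (fun x hx => by
      have hx0 : 0 < x := by linarith [hx.1]
      exact ((hasDerivAt_phi hx0).const_mul t).congr_deriv (by ring))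
    (fun x _ => hasDerivAt_const x _)
    (fun x _ => by
      have h1 : HasDerivAt (fun x : ℝ => x * (x + 1)) (1 * (x + 1) + x * 1) x :=
        (hasDerivAt_id x).mul ((hasDerivAt_id x).add_const 1)
      exact (((hb.deriv x).mul h1).congr_deriv (by ring)).ofReal_comp)
    (by fun_prop) (by fun_prop) (by fun_prop)
    (fun x hx => by have : 0 < x := by linarith [hx.1]
                    positivity)
    (fun x _ => le_rfl)
    (fun x _ => by rw [abs_neg, abs_of_pos (by linarith)]; exact ht)
    (fun x hx => by
      have hx0 : 0 < x := by linarith [hx.1]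
      rw [Complex.norm_real, Real.norm_eq_abs, abs_mul, abs_of_pos (by positivity : 0 < x * (x + 1))]
      have h1 : x * (x + 1) ≤ 20 * U ^ 2 := by nlinarith [hx.1, hx.2]
      calc _ ≤ 1 * (x * (x + 1)) := by gcongr; exact hb.bound x
        _ ≤ _ := by linarith)
    (fun x hx => by
      have hx0 : 0 < x := by linarith [hx.1]
      rw [Complex.norm_real, Real.norm_eq_abs]
      refine (abs_add_le _ _).trans ?_
      rw [abs_mul (b' x), abs_mul (b x), abs_of_pos (by positivity : 0 < x * (x + 1)),
        abs_of_pos (by positivity : 0 < 2 * x + 1)]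
      have h1 : x * (x + 1) ≤ 20 * U ^ 2 := by nlinarith [hx.1, hx.2]
      calc _ ≤ 1 / U * (20 * U ^ 2) + 1 * (9 * U) := by
            gcongr
            · exact hb.bound' x
            · exact hb.bound x
            · linarith [hx.2]
        _ = _ := by field_simp; ring)
  rw [hintegr]
  refine le_trans (le_of_eq ?_) (key.trans (le_of_eq ?_))
  · congr 1
    apply intervalIntegral.integral_congr
    intro x hx
    rw [Set.uIcc_of_le hle] at hx
    have hx0 : 0 < x := by linarith [hx.1]
    have : (x:ℂ) * (x + 1) ≠ 0 := by exact_mod_cast (by positivity : x * (x + 1) ≠ 0)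
    simp only [oscAmp]
    push_cast
    rw [mul_div_cancel_right₀ _ this]
  · ring

lemma norm_fourier_oscSum_zero_le (hb : IsAmp U b b') (hU : 1 ≤ U) (hT : 0 < T)
    (ht : ∀ r ∈ S, T ≤ t r) : ‖𝓕 (oscSum S 1 t b) 0‖ ≤ 167 * S.card * U ^ 2 / T := by
  have hU0 : 0 < U := by linarith
  have hcs : ∀ s : ℝ, HasCompactSupport (oscAmp b s) := fun s =>
    HasCompactSupport.of_support_subset_isCompact (isCompact_Icc (a := U) (b := 4 * U)) (by
      intro x hx
      by_contra h
      exact hx (oscAmp_eq_zero (hb.supp x h)))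
  have e : 𝓕 (oscSum S 1 t b) 0 = ∑ r ∈ S, ∫ x, oscAmp b (t r) x := by
    rw [Real.fourier_real_eq_integral_exp_smul, ← integral_finsetSum]
    · simp [oscSum]
    · exact fun r _ => (continuous_oscAmp hb hU0 _).integrable_of_hasCompactSupport (hcs _)
  rw [e]
  refine (norm_sum_le _ _).trans ((Finset.sum_le_sum fun r hr =>
    norm_integral_oscAmp_le hb hU hT (ht r hr)).trans_eq ?_)
  rw [Finset.sum_const, nsmul_eq_mul]
  ring

/-- The bound for complete sums over scaled lattices, on average over the frequencies. -/
lemma exists_norm_sum_oscSum_le {δ : ℝ} (hδ : 0 < δ) (hδ1 : δ ≤ 1 / 3) :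
    ∃ C : ℝ, 1 ≤ C ∧ ∀ {U : ℝ} {b b' : ℝ → ℝ} {S : Finset ℤ} {t : ℤ → ℝ} {T T0 G L : ℝ},
      IsAmp U b b' → 1 ≤ U → IsFreq S t T T0 G L → ∀ {N : ℕ}, 4 * U < N → N ≤ 6 * U →
      ∑ j ∈ Finset.Icc 1 N, 1 / (j : ℝ) ≤ L → ∀ {K : ℝ}, 1 ≤ K → T / U ^ 2 ≤ K →
      ∀ (Y : ℕ) (M : ℕ → ℕ), (∀ h ∈ Finset.Icc 1 Y, N * h ≤ M h) →
      ‖∑ h ∈ Finset.Icc 1 Y, (1 / h : ℂ) * ∑ n ∈ Finset.Icc 1 (M h), oscSum S 1 t b (n / h)‖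
        ≤ Y * (167 * S.card * U ^ 2 / T) + C * K ^ ((1 + 3 * δ) / 2) *
          √(2 * (9 * meanBound S.card U T T0 G L + 2 * (S.card : ℝ) ^ 2 / K ^ 2)) := by
  obtain ⟨C, hC, hyp⟩ := exists_sum_hyperbola_le hδ hδ1
  refine ⟨C, hC, ?_⟩
  intro U b b' S t T T0 G L hb hU hS N hN hN6 hLN K hK hKT Y M hM
  have hU0 : 0 < U := by linarith
  set A := oscSum S 1 t b with hA
  set W := 9 * meanBound S.card U T T0 G L + 2 * (S.card : ℝ) ^ 2 / K ^ 2 with hW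
  have hAc : Continuous A := continuous_oscSum hb hU0 S 1 t
  have hA0 : ∀ x ≤ 0, A x = 0 := fun x hx => oscSum_eq_zero (hb.supp x fun h => by linarith [h.1])
  have hAN : ∀ x, (N:ℝ) ≤ x → A x = 0 := fun x hx =>
    oscSum_eq_zero (hb.supp x fun h => by linarith [h.2])
  set g : ℕ → ℝ := fun m => ‖𝓕 A (m:ℝ)‖ + ‖𝓕 A (-(m:ℝ))‖ with hg
  set B := C * K ^ ((1 + 3 * δ) / 2) * √(2 * W) with hB
  have hgW : ∀ M : ℕ, ∑ m ∈ Finset.Icc 1 M, (1 + (m:ℝ) ^ 2 / K ^ 2) * g m ^ 2 ≤ 2 * W := by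
    intro M
    have hw := weighted_meanSq hb hU hS hN hN6 hLN hK hKT
      ((Finset.Icc 1 M).image (fun k : ℕ => (k:ℤ)) ∪ (Finset.Icc 1 M).image (fun k : ℕ => -(k:ℤ)))
    rw [Finset.sum_union, Finset.sum_image (by intro a _ b _ h; simpa using h),
      Finset.sum_image (by intro a _ b _ h; simpa using h), ← Finset.sum_add_distrib] at hw
    · refine le_trans ?_ (mul_le_mul_of_nonneg_left hw zero_le_two)
      rw [Finset.mul_sum]
      refine Finset.sum_le_sum fun m _ => ?_
      push_cast
      rw [neg_sq, ← mul_add, mul_left_comm]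
      gcongr
      simp only [hg]
      nlinarith [sq_nonneg (‖𝓕 A (m:ℝ)‖ - ‖𝓕 A (-(m:ℝ))‖)]
    · rw [Finset.disjoint_left]
      intro a ha ha'
      simp only [Finset.mem_image, Finset.mem_Icc] at ha ha'
      obtain ⟨k, hk, rfl⟩ := ha
      obtain ⟨l, hl, h⟩ := ha'
      omega
  have hyp1 := hyp K hK (2 * W) g (fun m => by positivity) hgW
  have hbd : ∀ H : Finset ℕ, (∃ Z, H ⊆ Finset.Icc 1 Z) → ∀ F : Finset ℤ,
      ∑ k ∈ F, ∑ h ∈ H, ‖𝓕 A ((h:ℝ) * k)‖ ≤ H.card * ‖𝓕 A 0‖ + B := by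
    rintro H ⟨Z, hZ⟩ F
    obtain ⟨P, hP⟩ := sum_int_le_sum_nat (f := fun k => ∑ h ∈ H, ‖𝓕 A ((h:ℝ) * k)‖)
      (fun k => by positivity) F
    refine hP.trans ?_
    simp only [Int.cast_zero, mul_zero, Finset.sum_const, nsmul_eq_mul]
    gcongr
    calc _ = ∑ h ∈ H, ∑ k ∈ Finset.Icc 1 P, g (h * k) := by
          rw [Finset.sum_comm]
          refine Finset.sum_congr rfl fun k _ => ?_
          rw [← Finset.sum_add_distrib]
          refine Finset.sum_congr rfl fun h _ => ?_
          simp only [hg]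
          push_cast
          rw [mul_neg]
      _ ≤ ∑ h ∈ Finset.Icc 1 Z, ∑ k ∈ Finset.Icc 1 P, g (h * k) :=
          Finset.sum_le_sum_of_subset_of_nonneg hZ fun h _ _ => by positivity
      _ ≤ _ := hyp1 Z P
  have hsum : ∀ h ∈ Finset.Icc 1 Y, Summable fun k : ℤ => ‖𝓕 A ((h:ℝ) * k)‖ := by
    intro h hh
    have := hbd {h} ⟨Y, by simpa using hh⟩
    simp only [Finset.sum_singleton] at this
    exact summable_of_sum_le (fun k => norm_nonneg _) this
  have hT : 0 < T := by linarith [hS.pos]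
  calc _ = ‖∑ h ∈ Finset.Icc 1 Y, ∑' k : ℤ, 𝓕 A ((h:ℝ) * k)‖ := by
        congr 1
        refine Finset.sum_congr rfl fun h hh => ?_
        exact sum_eq_tsum_fourier hAc hA0 hAN (Finset.mem_Icc.1 hh).1 (hM h hh) (hsum h hh).of_norm
    _ ≤ ∑ h ∈ Finset.Icc 1 Y, ∑' k : ℤ, ‖𝓕 A ((h:ℝ) * k)‖ :=
        (norm_sum_le _ _).trans (Finset.sum_le_sum fun h hh => norm_tsum_le_tsum_norm (hsum h hh))
    _ = ∑' k : ℤ, ∑ h ∈ Finset.Icc 1 Y, ‖𝓕 A ((h:ℝ) * k)‖ := (Summable.tsum_finsetSum hsum).symm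
    _ ≤ Y * ‖𝓕 A 0‖ + B := by
        refine Real.tsum_le_of_sum_le (fun k => by positivity) fun F => ?_
        simpa using hbd (Finset.Icc 1 Y) ⟨Y, subset_rfl⟩ F
    _ ≤ _ := by
        gcongr
        exact norm_fourier_oscSum_zero_le hb hU hT hS.lower

end

/-- A smooth step from `0` (for `z ≤ 1`) to `1` (for `z ≥ 2`). -/
noncomputable def cutoff (z : ℝ) : ℝ := Real.smoothTransition (z - 1)

lemma cutoff_eq_zero {z : ℝ} (hz : z ≤ 1) : cutoff z = 0 :=
  Real.smoothTransition.zero_of_nonpos (by linarith)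

lemma cutoff_eq_one {z : ℝ} (hz : 2 ≤ z) : cutoff z = 1 :=
  Real.smoothTransition.one_of_one_le (by linarith)

lemma cutoff_nonneg (z : ℝ) : 0 ≤ cutoff z := Real.smoothTransition.nonneg _

lemma cutoff_le_one (z : ℝ) : cutoff z ≤ 1 := Real.smoothTransition.le_one _

lemma contDiff_cutoff : ContDiff ℝ 1 cutoff :=
  Real.smoothTransition.contDiff.comp (contDiff_id.sub contDiff_const)

lemma exists_abs_deriv_cutoff_le : ∃ C : ℝ, 1 ≤ C ∧ ∀ z, |deriv cutoff z| ≤ C := by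
  have hc : Continuous (deriv cutoff) := contDiff_cutoff.continuous_deriv le_rfl
  obtain ⟨C, hC⟩ := (isCompact_Icc (a := (1:ℝ)) (b := 2)).exists_bound_of_continuousOn hc.continuousOn
  refine ⟨max C 1, le_max_right _ _, fun z => ?_⟩
  by_cases hz : z ∈ Set.Icc (1:ℝ) 2
  · exact (hC z hz).trans (le_max_left _ _)
  · have h0 : deriv cutoff z = 0 := by
      rcases lt_or_ge z 1 with h | h
      · have : cutoff =ᶠ[nhds z] fun _ => 0 := by
          filter_upwards [Iio_mem_nhds h] with y hy using cutoff_eq_zero (le_of_lt hy)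
        rw [this.deriv_eq, deriv_const]
      · have h2 : 2 < z := by by_contra h'; exact hz ⟨h, not_lt.1 h'⟩
        have : cutoff =ᶠ[nhds z] fun _ => 1 := by
          filter_upwards [Ioi_mem_nhds h2] with y hy using cutoff_eq_one (le_of_lt hy)
        rw [this.deriv_eq, deriv_const]
    rw [h0, abs_zero]
    exact zero_le_one.trans (le_max_right _ _)

/-- A smooth bump supported in `[1, 4]`, whose dyadic dilates sum to a cutoff. -/
noncomputable def bump (z : ℝ) : ℝ := cutoff z - cutoff (z / 2)

lemma bump_eq_zero {z : ℝ} (hz : z ∉ Set.Icc (1:ℝ) 4) : bump z = 0 := by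
  unfold bump
  rcases lt_or_ge z 1 with h | h
  · rw [cutoff_eq_zero h.le, cutoff_eq_zero (by linarith), sub_zero]
  · have h2 : 4 < z := by by_contra h'; exact hz ⟨h, not_lt.1 h'⟩
    rw [cutoff_eq_one (by linarith), cutoff_eq_one (by linarith), sub_self]

lemma abs_bump_le (z : ℝ) : |bump z| ≤ 1 := by
  unfold bump
  rw [abs_le]
  constructor <;> linarith [cutoff_nonneg z, cutoff_le_one z, cutoff_nonneg (z / 2), cutoff_le_one (z / 2)]

lemma contDiff_bump : ContDiff ℝ 1 bump :=
  contDiff_cutoff.sub (contDiff_cutoff.comp (contDiff_id.div_const 2))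

lemma exists_abs_deriv_bump_le : ∃ C : ℝ, 1 ≤ C ∧ ∀ z, |deriv bump z| ≤ C := by
  obtain ⟨C, hC, h⟩ := exists_abs_deriv_cutoff_le
  refine ⟨2 * C, by linarith, fun z => ?_⟩
  have hd : Differentiable ℝ cutoff := contDiff_cutoff.differentiable one_ne_zero
  have h2 : HasDerivAt (fun z => cutoff (z / 2)) (deriv cutoff (z / 2) * (1 / 2)) z :=
    HasDerivAt.comp (h₂ := cutoff) z (hd (z / 2)).hasDerivAt ((hasDerivAt_id' z).div_const 2)
  have h1 : HasDerivAt bump (deriv cutoff z - deriv cutoff (z / 2) * (1 / 2)) z :=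
    (hd z).hasDerivAt.sub h2
  rw [h1.deriv]
  refine (abs_sub _ _).trans ?_
  rw [abs_mul, abs_of_pos (by norm_num : (0:ℝ) < 1 / 2)]
  linarith [h z, h (z / 2)]

lemma sum_bump (z : ℝ) (k : ℕ) (hz : z ≤ 2 ^ k) :
    ∑ i ∈ Finset.range k, bump (z / 2 ^ i) = cutoff z := by
  have : ∀ k : ℕ, ∑ i ∈ Finset.range k, bump (z / 2 ^ i) = cutoff z - cutoff (z / 2 ^ k) := by
    intro k
    induction k with
    | zero => simp
    | succ k ih =>
      rw [Finset.sum_range_succ, ih, bump, pow_succ, ← div_div]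
      ring
  rw [this, cutoff_eq_zero (z := z / 2 ^ k), sub_zero]
  rw [div_le_one (by positivity)]
  exact hz

/-- The off-diagonal amplitude `(u (u + 1)) ^ (-1/2) * exp (-G² φ(u)² / 2)`. -/
noncomputable def gaussAmp (G u : ℝ) : ℝ := (√(u * (u + 1)))⁻¹ * rexp (-(G * phi u) ^ 2 / 2)

section
variable {u : ℝ}

lemma one_div_add_one_le_phi (hu : 0 < u) : 1 / (u + 1) ≤ phi u := by
  have h := Real.add_one_le_exp (log u - log (u + 1))
  rw [Real.exp_sub, Real.exp_log hu, Real.exp_log (by linarith)] at h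
  unfold phi
  have : u / (u + 1) = 1 - 1 / (u + 1) := by field_simp; ring
  linarith

lemma phi_pos (hu : 0 < u) : 0 < phi u := lt_of_lt_of_le (by positivity) (one_div_add_one_le_phi hu)

lemma gaussAmp_nonneg (G u : ℝ) : 0 ≤ gaussAmp G u := by unfold gaussAmp; positivity

lemma inv_sqrt_mul_le (hu : 0 < u) : (√(u * (u + 1)))⁻¹ ≤ 1 / u := by
  rw [one_div]
  apply inv_anti₀ hu
  exact Real.le_sqrt_of_sq_le (by nlinarith)

lemma gaussAmp_le (G : ℝ) (hu : 0 < u) : gaussAmp G u ≤ 1 / u := by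
  unfold gaussAmp
  calc _ ≤ (1 / u) * 1 := by
        gcongr
        · exact inv_sqrt_mul_le hu
        · rw [Real.exp_le_one_iff]; nlinarith [sq_nonneg (G * phi u)]
    _ = _ := mul_one _

lemma hasDerivAt_gaussAmp (G : ℝ) (hu : 0 < u) :
    HasDerivAt (gaussAmp G) (gaussAmp G u * (-((2 * u + 1) / (2 * (u * (u + 1)))) +
      G ^ 2 * phi u / (u * (u + 1)))) u := by
  have hp : 0 < u * (u + 1) := by positivity
  have h1 : HasDerivAt (fun x : ℝ => x * (x + 1)) (1 * (u + 1) + u * 1) u :=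
    (hasDerivAt_id u).mul ((hasDerivAt_id u).add_const 1)
  have h2 := (h1.sqrt hp.ne').fun_inv (Real.sqrt_pos.2 hp).ne'
  have h3 := ((((hasDerivAt_phi hu).const_mul G).fun_pow 2).fun_neg.div_const 2).exp
  refine (h2.mul h3).congr_deriv ?_
  have hs : √(u * (u + 1)) ^ 2 = u * (u + 1) := Real.sq_sqrt hp.le
  have hs0 : √(u * (u + 1)) ≠ 0 := (Real.sqrt_pos.2 hp).ne'
  unfold gaussAmp
  rw [hs]
  field_simp
  ring

lemma abs_deriv_gaussAmp_le (G : ℝ) (hu : 0 < u) :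
    |gaussAmp G u * (-((2 * u + 1) / (2 * (u * (u + 1)))) + G ^ 2 * phi u / (u * (u + 1)))|
      ≤ 2 / u ^ 2 := by
  have hphi := phi_pos hu
  have h1 : (2 * u + 1) / (2 * (u * (u + 1))) ≤ 1 / u := by
    rw [div_le_div_iff₀ (by positivity) hu]; nlinarith
  have h2 : G ^ 2 * phi u / (u * (u + 1)) ≤ (G * phi u) ^ 2 / u := by
    have := one_div_add_one_le_phi hu
    calc G ^ 2 * phi u / (u * (u + 1)) = G ^ 2 * phi u * (1 / (u + 1)) / u := by field_simp
      _ ≤ G ^ 2 * phi u * phi u / u := by gcongr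
      _ = _ := by ring
  have h3 : (G * phi u) ^ 2 * rexp (-(G * phi u) ^ 2 / 2) ≤ 1 := by
    set v := (G * phi u) ^ 2 with hv
    have hv0 : 0 ≤ v := by positivity
    have h := Real.add_one_le_exp (v / 4)
    have h' : v ≤ rexp (v / 2) := by
      have : rexp (v / 2) = rexp (v / 4) ^ 2 := by rw [← Real.exp_nat_mul]; congr 1; push_cast; ring
      rw [this]
      nlinarith [sq_nonneg (v / 4 - 1)]
    have e : -(G * phi u) ^ 2 / 2 = -(v / 2) := by rw [hv]; ring
    rw [e, Real.exp_neg, ← div_eq_mul_inv, div_le_one (Real.exp_pos _)]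
    exact h'
  have hgn := gaussAmp_nonneg G u
  rw [abs_mul, abs_of_nonneg hgn]
  calc _ ≤ gaussAmp G u * (1 / u + (G * phi u) ^ 2 / u) := by
        gcongr
        refine (abs_add_le _ _).trans ?_
        rw [abs_neg, abs_of_nonneg (by positivity), abs_of_nonneg (by positivity)]
        linarith
    _ = gaussAmp G u * (1 / u) + (√(u * (u + 1)))⁻¹ *
          ((G * phi u) ^ 2 * rexp (-(G * phi u) ^ 2 / 2)) / u := by unfold gaussAmp; ring
    _ ≤ 1 / u * (1 / u) + 1 / u * 1 / u := by
        have := gaussAmp_le G hu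
        have := inv_sqrt_mul_le hu
        gcongr
    _ = _ := by ring

end

/-- The localized amplitude is, up to normalization, an amplitude at scale `U`. -/
lemma exists_isAmp_gaussAmp : ∃ C : ℝ, 1 ≤ C ∧ ∀ G U : ℝ, 1 ≤ U →
    ∃ b', IsAmp U (fun u => U / C * (gaussAmp G u * bump (u / U))) b' := by
  obtain ⟨C, hC, hbd⟩ := exists_abs_deriv_bump_le
  refine ⟨2 + C, by linarith, fun G U hU => ?_⟩
  have hU0 : 0 < U := by linarith
  set d : ℝ → ℝ := fun u => gaussAmp G u * (-((2 * u + 1) / (2 * (u * (u + 1)))) +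
      G ^ 2 * phi u / (u * (u + 1))) with hd
  have hz : ∀ u, u < U → bump (u / U) = 0 := fun u hu => bump_eq_zero fun h => by
    have := h.1; rw [le_div_iff₀ hU0] at this; linarith
  have hbdiff : Differentiable ℝ bump := contDiff_bump.differentiable one_ne_zero
  have hz' : ∀ u, u < U → deriv bump (u / U) = 0 := fun u hu => by
    have : bump =ᶠ[nhds (u / U)] fun _ => 0 := by
      have : u / U < 1 := by rwa [div_lt_one hU0]
      filter_upwards [Iio_mem_nhds this] with y hy
      exact bump_eq_zero fun h => absurd h.1 (not_le.2 hy)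
    rw [this.deriv_eq, deriv_const]
  have hbcd : Continuous (deriv bump) := contDiff_bump.continuous_deriv le_rfl
  refine ⟨fun u => U / (2 + C) * (d u * bump (u / U) + gaussAmp G u * (deriv bump (u / U) * (1 / U))),
    ?_, ?_, ?_, ?_, ?_⟩
  · intro u
    rcases lt_or_ge u U with hu | hu
    · have h1 : HasDerivAt (fun u => U / (2 + C) * (gaussAmp G u * bump (u / U))) 0 u := by
        refine (hasDerivAt_const u (0:ℝ)).congr_of_eventuallyEq ?_
        filter_upwards [Iio_mem_nhds hu] with y hy
        simp [hz y hy]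
      refine h1.congr_deriv ?_
      simp [hz u hu, hz' u hu]
    · have hu0 : 0 < u := by linarith
      have h1 : HasDerivAt (fun u => bump (u / U)) (deriv bump (u / U) * (1 / U)) u :=
        HasDerivAt.comp (h₂ := bump) u (hbdiff (u / U)).hasDerivAt ((hasDerivAt_id' u).div_const U)
      exact ((hasDerivAt_gaussAmp G hu0).mul h1).const_mul _
  · rw [continuous_iff_continuousAt]
    intro u
    rcases lt_or_ge u U with hu | hu
    · have : (fun u => U / (2 + C) * (d u * bump (u / U) + gaussAmp G u * (deriv bump (u / U) * (1 / U))))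
          =ᶠ[nhds u] fun _ => 0 := by
        filter_upwards [Iio_mem_nhds hu] with y hy
        simp [hz y hy, hz' y hy]
      exact (continuousAt_congr this).2 continuousAt_const
    · have hu0 : 0 < u := by linarith
      have hp : u * (u + 1) ≠ 0 := by positivity
      have h1 := (hasDerivAt_gaussAmp G hu0).continuousAt
      have h2 := (hasDerivAt_phi hu0).continuousAt
      have h3 : ContinuousAt d u := by
        refine h1.mul (ContinuousAt.add (ContinuousAt.neg ?_) ?_)
        · exact ContinuousAt.div (by fun_prop) (by fun_prop) (by positivity)
        · exact ContinuousAt.div (by fun_prop) (by fun_prop) (by positivity)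
      have h4 : ContinuousAt (fun u => bump (u / U)) u :=
        (hbdiff.continuous.comp (by fun_prop : Continuous fun u => u / U)).continuousAt
      have h5 : ContinuousAt (fun u => deriv bump (u / U)) u :=
        (hbcd.comp (by fun_prop : Continuous fun u => u / U)).continuousAt
      exact continuousAt_const.mul ((h3.mul h4).add (h1.mul (h5.mul continuousAt_const)))
  · intro u hu
    rw [bump_eq_zero, mul_zero, mul_zero]
    intro h
    apply hu
    have h1 := h.1
    have h2 := h.2
    rw [le_div_iff₀ hU0] at h1
    rw [div_le_iff₀ hU0] at h2
    exact ⟨by linarith, h2⟩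
  · intro u
    rcases lt_or_ge u U with hu | hu
    · simp [hz u hu]
    · have hu0 : 0 < u := by linarith
      rw [abs_mul, abs_mul, abs_of_nonneg (by positivity : 0 ≤ U / (2 + C)),
        abs_of_nonneg (gaussAmp_nonneg G u)]
      have h1 : gaussAmp G u ≤ 1 / U := (gaussAmp_le G hu0).trans (by gcongr)
      calc _ ≤ U / (2 + C) * (1 / U * 1) := by gcongr; exact abs_bump_le _
        _ = 1 / (2 + C) := by field_simp
        _ ≤ 1 := by rw [div_le_one (by positivity)]; linarith
  · intro u
    rcases lt_or_ge u U with hu | hu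
    · simp [hz u hu, hz' u hu]; linarith
    · have hu0 : 0 < u := by linarith
      rw [abs_mul, abs_of_nonneg (by positivity : 0 ≤ U / (2 + C))]
      have h1 : gaussAmp G u ≤ 1 / U := (gaussAmp_le G hu0).trans (by gcongr)
      have h2 : |d u| ≤ 2 / U ^ 2 := (abs_deriv_gaussAmp_le G hu0).trans (by gcongr)
      have h3 : |d u * bump (u / U) + gaussAmp G u * (deriv bump (u / U) * (1 / U))|
          ≤ 2 / U ^ 2 * 1 + 1 / U * (C * (1 / U)) := by
        refine (abs_add_le _ _).trans ?_
        rw [abs_mul (d u), abs_mul (gaussAmp G u) (deriv bump _ * _), abs_mul (deriv bump _),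
         
          abs_of_nonneg (gaussAmp_nonneg G u), abs_of_pos (by positivity : 0 < 1 / U)]
        gcongr
        · exact abs_bump_le _
        · exact hbd _
      calc _ ≤ U / (2 + C) * (2 / U ^ 2 * 1 + 1 / U * (C * (1 / U))) := by gcongr
        _ = _ := by field_simp

lemma le_norm_exp_I_mul_sub_one {θ : ℝ} (h0 : 0 ≤ θ) (hpi : θ ≤ π) :
    2 / π * θ ≤ ‖Complex.exp (Complex.I * θ) - 1‖ := by
  rw [Complex.norm_exp_I_mul_ofReal_sub_one, Real.norm_eq_abs]
  have := Real.mul_le_sin (x := θ / 2) (by linarith) (by linarith)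
  refine le_trans ?_ (le_abs_self _)
  calc _ = 2 * (2 / π * (θ / 2)) := by ring
    _ ≤ _ := by linarith

/-- The Kusmin–Landau inequality for an exponential sum with decreasing phase increments. -/
lemma kusmin_landau {f : ℕ → ℝ} {m : ℕ} {η : ℝ} (hη : 0 < η)
    (hle : ∀ n < m, η ≤ f (n + 1) - f n) (hpi : ∀ n < m, f (n + 1) - f n ≤ π)
    (hanti : ∀ n, n + 1 < m → f (n + 2) - f (n + 1) ≤ f (n + 1) - f n) :
    ‖∑ n ∈ Finset.range m, Complex.exp (Complex.I * f n)‖ ≤ 6 / η := by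
  set z : ℕ → ℂ := fun n => Complex.exp (Complex.I * f n) with hz
  set θ : ℕ → ℝ := fun n => f (n + 1) - f n with hθ
  set w : ℕ → ℂ := fun n => (Complex.exp (Complex.I * θ n) - 1)⁻¹ with hw
  have hz1 : ∀ n, ‖z n‖ = 1 := fun n => by
    simp only [hz]; rw [mul_comm]; exact Complex.norm_exp_ofReal_mul_I _
  have hpos : ∀ n < m, 0 < θ n := fun n hn => hη.trans_le (hle n hn)
  have hlow : ∀ n < m, 2 / π * θ n ≤ ‖Complex.exp (Complex.I * θ n) - 1‖ := fun n hn =>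
    le_norm_exp_I_mul_sub_one (hpos n hn).le (hpi n hn)
  have hlow0 : ∀ n < m, 0 < 2 / π * θ n := fun n hn => by
    have := hpos n hn; positivity
  have hne : ∀ n < m, Complex.exp (Complex.I * θ n) - 1 ≠ 0 := fun n hn => by
    rw [← norm_pos_iff]; exact (hlow0 n hn).trans_le (hlow n hn)
  have hstep : ∀ n < m, z n = w n * (z (n + 1) - z n) := fun n hn => by
    have e : z (n + 1) = z n * Complex.exp (Complex.I * θ n) := by
      simp only [hz, hθ]; rw [← Complex.exp_add]; congr 1; push_cast; ring
    have := hne n hn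
    rw [e, hw]
    field_simp
  have hwn : ∀ n < m, ‖w n‖ ≤ π / 2 / θ n := fun n hn => by
    have h := hpos n hn
    simp only [hw]
    rw [norm_inv]
    refine (inv_anti₀ (hlow0 n hn) (hlow n hn)).trans_eq ?_
    field_simp
  have hwd : ∀ n, n + 1 < m → ‖w n - w (n + 1)‖ ≤ π ^ 2 / 4 * (1 / θ (n + 1) - 1 / θ n) := by
    intro n hn
    have hn' : n < m := by omega
    have h1 := hpos n hn'
    have h2 := hpos _ hn
    simp only [hw]
    rw [inv_sub_inv (hne n hn') (hne _ hn), norm_div, norm_mul]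
    have e : ‖Complex.exp (Complex.I * θ (n + 1)) - 1 - (Complex.exp (Complex.I * θ n) - 1)‖
        ≤ θ n - θ (n + 1) := by
      have : Complex.exp (Complex.I * θ (n + 1)) - 1 - (Complex.exp (Complex.I * θ n) - 1)
        = -(Complex.exp (θ (n + 1) * Complex.I) *
            (Complex.exp (Complex.I * (θ n - θ (n + 1) : ℝ)) - 1)) := by
        rw [mul_sub, ← Complex.exp_add]
        have e1 : (θ (n + 1) : ℂ) * Complex.I + Complex.I * (θ n - θ (n + 1) : ℝ) = Complex.I * θ n := by
          push_cast; ring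
        rw [e1, mul_comm (θ (n + 1) : ℂ)]
        ring
      rw [this, norm_neg, norm_mul, Complex.norm_exp_ofReal_mul_I, one_mul]
      refine Real.norm_exp_I_mul_ofReal_sub_one_le.trans_eq ?_
      rw [Real.norm_eq_abs, abs_of_nonneg]
      have := hanti n hn
      simp only [hθ]
      linarith
    calc _ ≤ (θ n - θ (n + 1)) / ((2 / π * θ n) * (2 / π * θ (n + 1))) := by
          have := hlow n hn'
          have := hlow _ hn
          have := hlow0 n hn'
          have := hlow0 _ hn
          have := (norm_nonneg _).trans e
          gcongr
      _ = _ := by field_simp; ring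
  have hind : ∀ k, k < m → ‖∑ n ∈ Finset.range (k + 1), z n - w k * z (k + 1)‖ ≤ π ^ 2 / 4 / θ k := by
    intro k
    induction k with
    | zero =>
      intro hk
      have h := hpos 0 hk
      have e : ∑ n ∈ Finset.range (0 + 1), z n - w 0 * z (0 + 1) = -(w 0 * z 0) := by
        rw [Finset.sum_range_one]
        conv_lhs => enter [1]; rw [hstep 0 hk]
        ring
      rw [e, norm_neg, norm_mul, hz1, mul_one]
      exact (hwn 0 hk).trans (div_le_div_of_nonneg_right (by nlinarith [Real.pi_gt_three]) h.le)
    | succ k ih =>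
      intro hk
      have e : ∑ n ∈ Finset.range (k + 1 + 1), z n - w (k + 1) * z (k + 1 + 1)
          = (∑ n ∈ Finset.range (k + 1), z n - w k * z (k + 1)) + (w k - w (k + 1)) * z (k + 1) := by
        rw [Finset.sum_range_succ]
        conv_lhs => enter [1, 2]; rw [hstep (k + 1) hk]
        ring
      rw [e]
      refine (norm_add_le _ _).trans ?_
      rw [norm_mul, hz1, mul_one]
      have h1 := ih (by omega)
      have h2 := hwd k hk
      calc _ ≤ π ^ 2 / 4 / θ k + π ^ 2 / 4 * (1 / θ (k + 1) - 1 / θ k) := add_le_add h1 h2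
        _ = _ := by ring
  rcases Nat.eq_zero_or_pos m with rfl | hm
  · simp; positivity
  obtain ⟨k, rfl⟩ : ∃ k, m = k + 1 := ⟨m - 1, by omega⟩
  have h := hpos k (by omega)
  have h1 := hind k (by omega)
  have h2 := hwn k (by omega)
  have h3 := hle k (by omega)
  calc ‖∑ n ∈ Finset.range (k + 1), z n‖
      = ‖(∑ n ∈ Finset.range (k + 1), z n - w k * z (k + 1)) + w k * z (k + 1)‖ := by ring_nf
    _ ≤ π ^ 2 / 4 / θ k + π / 2 / θ k := by
        refine (norm_add_le _ _).trans (add_le_add h1 ?_)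
        rwa [norm_mul, hz1, mul_one]
    _ = (π ^ 2 / 4 + π / 2) / θ k := by ring
    _ ≤ 6 / η := by
        gcongr
        nlinarith [Real.pi_lt_d2, Real.pi_pos]

/-- Partial summation: bounds on partial sums transfer to weighted sums. -/
lemma norm_sum_mul_le {β : ℕ → ℝ} {z : ℕ → ℂ} {B : ℕ → ℝ} {m : ℕ}
    (hB : ∀ k ≤ m + 1, ‖∑ n ∈ Finset.range k, z n‖ ≤ B k) :
    ‖∑ n ∈ Finset.range (m + 1), (β n : ℂ) * z n‖
      ≤ |β m| * B (m + 1) + ∑ n ∈ Finset.range m, |β (n + 1) - β n| * B (n + 1) := by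
  have h := Finset.sum_range_by_parts (fun n => (β n : ℂ)) z (m + 1)
  simp only [smul_eq_mul, Nat.add_sub_cancel] at h
  rw [h]
  refine (norm_sub_le _ _).trans (add_le_add ?_ ?_)
  · rw [norm_mul, Complex.norm_real, Real.norm_eq_abs]
    gcongr
    exact hB _ le_rfl
  · refine (norm_sum_le _ _).trans (Finset.sum_le_sum fun n hn => ?_)
    rw [norm_mul, ← Complex.ofReal_sub, Complex.norm_real, Real.norm_eq_abs]
    gcongr
    exact hB _ (by have := Finset.mem_range.1 hn; omega)

lemma IsAmp.abs_sub_le {U : ℝ} {b b' : ℝ → ℝ} (hb : IsAmp U b b') (x y : ℝ) :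
    |b x - b y| ≤ 1 / U * |x - y| := by
  have := Convex.norm_image_sub_le_of_norm_hasDerivWithin_le (f := b) (f' := b') (s := Set.univ)
    (C := 1 / U) (fun x _ => (hb.deriv x).hasDerivWithinAt) (fun x _ => hb.bound' x) convex_univ
    (Set.mem_univ y) (Set.mem_univ x)
  simpa using this

lemma phi_div_sub {h n : ℝ} (hh : 0 < h) (hn : 0 < n) :
    phi (n / h) - phi ((n + 1) / h) = log (1 + h / (n * (n + h + 1))) := by
  have e1 : ∀ x : ℝ, 0 < x → phi (x / h) = log (x + h) - log x := by
    intro x hx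
    unfold phi
    have : x / h + 1 = (x + h) / h := by field_simp
    rw [this, log_div (by positivity) hh.ne', log_div hx.ne' hh.ne']
    ring
  rw [e1 n hn, e1 (n + 1) (by linarith)]
  have e2 : 1 + h / (n * (n + h + 1)) = (n + h) * (n + 1) / (n * (n + 1 + h)) := by
    field_simp; ring
  rw [e2, log_div (by positivity) (by positivity), log_mul (by positivity) (by positivity),
    log_mul (by positivity) (by positivity)]
  ring

/-- The bound for truncated lattice sums at the edge of the summation range. -/
lemma norm_edge_sum_le {U : ℝ} {b b' : ℝ → ℝ} (hb : IsAmp U b b') (hU : 1 ≤ U) {T t X : ℝ} (hT : 1 ≤ T)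
    (ht : T ≤ t) (ht4 : t ≤ 4 * T) (hX : 8 * T ≤ X) (hX9 : X ≤ 9 * T) {h : ℕ} (hh : 1 ≤ h)
    (hedge : X ≤ h * (4 * U + 1)) {M : ℕ} (hM : (M:ℝ) + h ≤ X) :
    ‖∑ n ∈ Finset.Icc 1 M, oscAmp b t (n / h)‖ ≤ 1620 * U := by
  have hU0 : 0 < U := by linarith
  have hh0 : (1:ℝ) ≤ h := by exact_mod_cast hh
  obtain ⟨a, ha⟩ : ∃ a, a = ⌈U * h⌉₊ := ⟨_, rfl⟩
  have ha1 : U * h ≤ a := ha ▸ Nat.le_ceil _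
  have ha2 : (a:ℝ) < U * h + 1 := ha ▸ Nat.ceil_lt_add_one (by positivity)
  have hapos : 1 ≤ a := by
    have : (0:ℝ) < a := by nlinarith
    exact_mod_cast this
  have hz : ∀ n : ℕ, n < a → oscAmp b t (n / h) = 0 := by
    intro n hn
    apply oscAmp_eq_zero
    apply hb.supp
    intro hmem
    have h1 := hmem.1
    rw [le_div_iff₀ (by linarith)] at h1
    have : a ≤ n := by rw [ha]; exact Nat.ceil_le.2 h1
    omega
  rcases lt_or_ge M a with hMa | hMa
  · rw [Finset.sum_eq_zero fun n hn => hz n (by have := Finset.mem_Icc.1 hn; omega), norm_zero]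
    positivity
  obtain ⟨m, rfl⟩ : ∃ m, M = a + m := ⟨M - a, by omega⟩
  have hsum : ∑ n ∈ Finset.Icc 1 (a + m), oscAmp b t (n / h)
      = ∑ n ∈ Finset.range (m + 1), oscAmp b t ((a + n : ℕ) / h) := by
    rw [← Finset.sum_subset (s₁ := Finset.Ico a (a + m + 1))]
    · rw [Finset.sum_Ico_eq_sum_range]
      congr 2; omega
    · intro n hn; rw [Finset.mem_Ico] at hn; rw [Finset.mem_Icc]; omega
    · intro n hn hn'
      rw [Finset.mem_Ico] at hn'; rw [Finset.mem_Icc] at hn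
      exact hz n (by omega)
  rw [hsum, ← Complex.norm_conj, map_sum]
  push_cast at hM
  set f : ℕ → ℝ := fun n => -(t * phi ((a + n : ℕ) / h)) with hf
  set β : ℕ → ℝ := fun n => b ((a + n : ℕ) / h) with hβ
  have hconj : ∀ n, conj (oscAmp b t ((a + n : ℕ) / h)) = (β n : ℂ) * Complex.exp (Complex.I * f n) := by
    intro n
    simp only [oscAmp, hβ, hf, map_mul, Complex.conj_ofReal, ← Complex.exp_conj, Complex.conj_I]
    congr 2
    push_cast
    ring
  simp_rw [hconj]
  have hfd : ∀ n, f (n + 1) - f n = t * log (1 + h / ((a + n) * (a + n + h + 1))) := by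
    intro n
    have := phi_div_sub (h := h) (n := a + n) (by linarith) (by positivity)
    simp only [hf]
    push_cast
    rw [← this]
    ring_nf
  have hβd : ∀ n, |β (n + 1) - β n| ≤ 1 / (U * h) := by
    intro n
    refine (hb.abs_sub_le _ _).trans_eq ?_
    push_cast
    rw [← sub_div, abs_of_nonneg (by apply div_nonneg <;> linarith)]
    field_simp
    ring
  have hKL : ∀ k ≤ m + 1, ‖∑ n ∈ Finset.range k, Complex.exp (Complex.I * f n)‖ ≤ 270 * U := by
    intro k hk
    have hT0 : 0 < T := by linarith
    have ht0 : 0 < t := by linarith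
    have := kusmin_landau (f := f) (m := k) (η := 1 / (45 * U)) (by positivity) ?_ ?_ ?_
    · refine this.trans_eq ?_
      field_simp; norm_num
    · intro n hn
      rw [hfd]
      have hn' : (n:ℝ) ≤ m := by exact_mod_cast (by omega : n ≤ m)
      set x : ℝ := a + n with hx
      have hx1 : 1 ≤ x := by
        have : (1:ℝ) ≤ a := by exact_mod_cast hapos
        have : (0:ℝ) ≤ n := by positivity
        linarith
      have hx2 : x + h ≤ X := by linarith
      have hx4 : x ≤ 4 * U * h := by linarith
      have hlog : h / ((x + 1) * (x + h)) ≤ log (1 + h / (x * (x + h + 1))) := by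
        have := Real.one_sub_inv_le_log_of_pos (x := 1 + h / (x * (x + h + 1))) (by positivity)
        refine le_trans (le_of_eq ?_) this
        have e : 1 + h / (x * (x + h + 1)) = (x + h) * (x + 1) / (x * (x + h + 1)) := by
          field_simp; ring
        rw [e, inv_div]
        field_simp
        ring
      calc 1 / (45 * U) ≤ T * (h / ((5 * U * h) * (9 * T))) := by
            apply le_of_eq; field_simp; norm_num
        _ ≤ t * (h / ((x + 1) * (x + h))) := by
            gcongr
            · nlinarith
            · linarith
        _ ≤ _ := by gcongr
    · intro n hn
      rw [hfd]
      have hn' : (0:ℝ) ≤ n := by positivity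
      set x : ℝ := a + n with hx
      have hx1 : U * h ≤ x := by linarith
      have hx0 : 0 < x := by nlinarith
      have h1 : log (1 + h / (x * (x + h + 1))) ≤ h / (x * (x + h + 1)) := by
        have := Real.log_le_sub_one_of_pos (x := 1 + h / (x * (x + h + 1))) (by positivity)
        linarith
      have h2 : h / (x * (x + h + 1)) ≤ h / ((U * h) * (U * h + h)) := by
        have : U * h + h ≤ x + h + 1 := by linarith
        gcongr
      have h3 : t ≤ h * (4 * U + 1) / 2 := by linarith
      calc _ ≤ t * (h / ((U * h) * (U * h + h))) := by gcongr; linarith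
        _ ≤ h * (4 * U + 1) / 2 * (h / ((U * h) * (U * h + h))) := by gcongr
        _ = (4 * U + 1) / (2 * U * (U + 1)) := by field_simp
        _ ≤ 3 := by rw [div_le_iff₀ (by positivity)]; nlinarith
        _ ≤ π := Real.pi_gt_three.le
    · intro n hn
      have ha0 : (0:ℝ) < a := by exact_mod_cast hapos
      rw [hfd (n + 1), hfd n]
      push_cast
      have hn' : (0:ℝ) ≤ n := by positivity
      gcongr <;> linarith
  refine (norm_sum_mul_le (B := fun _ => 270 * U) hKL).trans ?_
  have hm : (m:ℝ) ≤ 4 * U * h := by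
    have : (0:ℝ) ≤ a := by positivity
    linarith
  calc _ ≤ 1 * (270 * U) + ∑ n ∈ Finset.range m, 1 / (U * h) * (270 * U) := by
        gcongr
        · exact hb.bound _
        · exact hβd _
    _ = 270 * U + m * (1 / (U * h)) * (270 * U) := by
        rw [Finset.sum_const, Finset.card_range, nsmul_eq_mul]; ring
    _ ≤ 270 * U + (4 * U * h) * (1 / (U * h)) * (270 * U) := by gcongr
    _ = 270 * U + 4 * (270 * U) := by field_simp
    _ ≤ _ := by linarith

section zeta

/-- The difference between `n ^ (-s)` and `∫ x in n..(n+1), x ^ (-s)`. -/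
noncomputable def zetaTerm (n : ℕ) (s : ℂ) : ℂ :=
  (n : ℂ) ^ (-s) - (((n : ℂ) + 1) ^ (1 - s) / (1 - s) - (n : ℂ) ^ (1 - s) / (1 - s))

lemma norm_zetaTerm_le {n : ℕ} (hn : 1 ≤ n) {s : ℂ} (hs : 0 < s.re) (hs1 : s ≠ 1) :
    ‖zetaTerm n s‖ ≤ ‖s‖ * (n : ℝ) ^ (-s.re - 1) := by
  have hn0 : (0:ℝ) < n := by exact_mod_cast hn
  have hs0 : s ≠ 0 := by rintro rfl; simp at hs
  have h1 : ∀ x ∈ Set.Icc (n:ℝ) (n + 1), ‖(n:ℂ) ^ (-s) - (x:ℂ) ^ (-s)‖ ≤ ‖s‖ * (n : ℝ) ^ (-s.re - 1) := by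
    intro x hx
    have hx1 := hx.1
    have := Convex.norm_image_sub_le_of_norm_hasDerivWithin_le
      (f := fun y : ℝ => (y:ℂ) ^ (-s - 1 + 1) / (-s - 1 + 1)) (f' := fun y : ℝ => (y:ℂ) ^ (-s - 1))
      (s := Set.Icc (n:ℝ) (n + 1)) (C := (n : ℝ) ^ (-s.re - 1))
      (fun y hy => (hasDerivAt_ofReal_cpow_const' (by linarith [hy.1])
        (by intro h; apply hs0; linear_combination -h)).hasDerivWithinAt)
      (fun y hy => by
        have hy0 : 0 < y := by linarith [hy.1]
        rw [Complex.norm_cpow_eq_rpow_re_of_pos hy0]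
        simp only [Complex.sub_re, Complex.neg_re, Complex.one_re]
        exact Real.rpow_le_rpow_of_nonpos hn0 hy.1 (by linarith))
      (convex_Icc _ _) (Set.left_mem_Icc.2 (by linarith)) hx
    simp only [sub_add_cancel] at this
    rw [← sub_div, norm_div, norm_neg, div_le_iff₀ (norm_pos_iff.2 hs0)] at this
    rw [norm_sub_rev]
    refine this.trans ?_
    rw [Real.norm_eq_abs, abs_of_nonneg (by linarith), mul_comm ‖s‖]
    have h2 : x - n ≤ 1 := by linarith [hx.2]
    have h3 : 0 ≤ (n : ℝ) ^ (-s.re - 1) := by positivity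
    gcongr
    nlinarith
  have h2 := Convex.norm_image_sub_le_of_norm_hasDerivWithin_le
      (f := fun y : ℝ => (y:ℂ) * (n:ℂ) ^ (-s) - (y:ℂ) ^ (-s + 1) / (-s + 1))
      (f' := fun y : ℝ => (n:ℂ) ^ (-s) - (y:ℂ) ^ (-s))
      (s := Set.Icc (n:ℝ) (n + 1)) (C := ‖s‖ * (n : ℝ) ^ (-s.re - 1))
      (fun y hy => by
        have e1 : HasDerivAt (fun y : ℝ => (y:ℂ) * (n:ℂ) ^ (-s)) (1 * (n:ℂ) ^ (-s)) y :=
          (hasDerivAt_id y).ofReal_comp.mul_const _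
        rw [one_mul] at e1
        exact (e1.sub (hasDerivAt_ofReal_cpow_const' (by linarith [hy.1])
          (by intro h; apply hs1; linear_combination -h))).hasDerivWithinAt)
      h1 (convex_Icc _ _) (Set.left_mem_Icc.2 (by linarith)) (Set.right_mem_Icc.2 (by linarith))
  refine le_trans (le_of_eq ?_) (h2.trans_eq ?_)
  · congr 1
    unfold zetaTerm
    rw [show -s + 1 = 1 - s by ring]
    push_cast
    ring
  · simp

lemma sum_range_zetaTerm (N : ℕ) (s : ℂ) :
    ∑ n ∈ Finset.range N, zetaTerm (n + 1) s = ∑ n ∈ Finset.range N, ((n + 1 : ℕ) : ℂ) ^ (-s)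
      - (((N : ℂ) + 1) ^ (1 - s) / (1 - s) - 1 / (1 - s)) := by
  induction N with
  | zero => simp
  | succ N ih =>
    rw [Finset.sum_range_succ, ih, Finset.sum_range_succ, zetaTerm]
    push_cast
    ring

lemma summable_zetaTerm {s : ℂ} (hs : 0 < s.re) (hs1 : s ≠ 1) :
    Summable fun n : ℕ => zetaTerm (n + 1) s := by
  have h : Summable fun n : ℕ => ‖s‖ * ((n + 1 : ℕ) : ℝ) ^ (-s.re - 1) := by
    refine Summable.mul_left _ ?_
    exact (summable_nat_add_iff (f := fun n : ℕ => (n:ℝ) ^ (-s.re - 1)) 1).2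
      (Real.summable_nat_rpow.2 (by linarith))
  exact Summable.of_norm_bounded h fun n => norm_zetaTerm_le (by omega) hs hs1

lemma tsum_zetaTerm_of_one_lt {s : ℂ} (hs : 1 < s.re) :
    ∑' n : ℕ, zetaTerm (n + 1) s = riemannZeta s + 1 / (1 - s) := by
  have hs1 : s ≠ 1 := by rintro rfl; simp at hs
  have h1 := (summable_zetaTerm (by linarith) hs1).hasSum.tendsto_sum_nat
  have h2 : Summable fun n : ℕ => ((n + 1 : ℕ) : ℂ) ^ (-s) := by
    have := (summable_nat_add_iff (f := fun n : ℕ => 1 / (n:ℂ) ^ s) 1).2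
      (Complex.summable_one_div_nat_cpow.2 hs)
    refine this.congr fun n => ?_
    rw [Complex.cpow_neg, one_div]
  have h3 := h2.hasSum.tendsto_sum_nat
  have h4 : ∑' n : ℕ, ((n + 1 : ℕ) : ℂ) ^ (-s) = riemannZeta s := by
    rw [zeta_eq_tsum_one_div_nat_add_one_cpow hs]
    refine tsum_congr fun n => ?_
    rw [Complex.cpow_neg, one_div]
    push_cast
    rfl
  have h5 : Filter.Tendsto (fun N : ℕ => ((N : ℂ) + 1) ^ (1 - s) / (1 - s)) Filter.atTop (nhds 0) := by
    rw [← zero_div (1 - s)]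
    refine Filter.Tendsto.div_const ?_ _
    rw [tendsto_zero_iff_norm_tendsto_zero]
    have : ∀ N : ℕ, ‖((N : ℂ) + 1) ^ (1 - s)‖ = ((N:ℝ) + 1) ^ (-(s.re - 1)) := by
      intro N
      have e : (N : ℂ) + 1 = (((N:ℝ) + 1 : ℝ) : ℂ) := by push_cast; rfl
      rw [e, Complex.norm_cpow_eq_rpow_re_of_pos (by positivity)]
      congr 1
      simp
    simp_rw [this]
    exact (tendsto_rpow_neg_atTop (by linarith)).comp
      (Filter.tendsto_atTop_add_const_right _ _ tendsto_natCast_atTop_atTop)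
  refine tendsto_nhds_unique h1 ?_
  simp_rw [sum_range_zetaTerm]
  rw [h4] at h3
  have := h3.sub (h5.sub (tendsto_const_nhds (x := 1 / (1 - s))))
  simpa using this

lemma zeta_eq_tsum_zetaTerm {s : ℂ} (hs : 0 < s.re) (him : 0 < s.im) :
    riemannZeta s = ∑' n : ℕ, zetaTerm (n + 1) s - 1 / (1 - s) := by
  set D : Set ℂ := {z : ℂ | 0 < z.re} ∩ {z : ℂ | 0 < z.im} with hD
  have hDo : IsOpen D := (isOpen_lt continuous_const Complex.continuous_re).inter
    (isOpen_lt continuous_const Complex.continuous_im)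
  have hDc : Convex ℝ D := (convex_halfSpace_re_gt 0).inter (convex_halfSpace_im_gt 0)
  have hne : ∀ z ∈ D, z ≠ 1 := by rintro z ⟨_, h⟩ rfl; simp at h
  have hne' : ∀ z ∈ D, 1 - z ≠ 0 := fun z hz h => hne z hz (by linear_combination -h)
  have hterm : ∀ n : ℕ, DifferentiableOn ℂ (zetaTerm (n + 1)) D := by
    intro n z hz
    have h1 : ((n + 1 : ℕ) : ℂ) ≠ 0 := by exact_mod_cast (Nat.succ_ne_zero n)
    have h2 : ((n + 1 : ℕ) : ℂ) + 1 ≠ 0 := by exact_mod_cast (Nat.succ_ne_zero (n + 1))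
    have := hne' z hz
    unfold zetaTerm
    refine DifferentiableAt.differentiableWithinAt ?_
    refine DifferentiableAt.sub ?_ (DifferentiableAt.sub ?_ ?_)
    · exact DifferentiableAt.const_cpow (by fun_prop) (Or.inl h1)
    · exact DifferentiableAt.div (DifferentiableAt.const_cpow (by fun_prop) (Or.inl h2)) (by fun_prop) this
    · exact DifferentiableAt.div (DifferentiableAt.const_cpow (by fun_prop) (Or.inl h1)) (by fun_prop) this
  have hF : DifferentiableOn ℂ (fun z => ∑' n : ℕ, zetaTerm (n + 1) z) D := by
    intro z hz
    set V : Set ℂ := D ∩ ({w : ℂ | z.re / 2 < w.re} ∩ Metric.ball 0 (‖z‖ + 1)) with hV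
    have hVo : IsOpen V := hDo.inter ((isOpen_lt continuous_const Complex.continuous_re).inter
      Metric.isOpen_ball)
    have hz0 : 0 < z.re := hz.1
    have hzV : z ∈ V := ⟨hz, by simp; linarith, by simp⟩
    have hu : Summable fun n : ℕ => (‖z‖ + 1) * ((n + 1 : ℕ) : ℝ) ^ (-(z.re / 2) - 1) := by
      refine Summable.mul_left _ ?_
      exact (summable_nat_add_iff (f := fun n : ℕ => (n:ℝ) ^ (-(z.re / 2) - 1)) 1).2
        (Real.summable_nat_rpow.2 (by linarith))
    have := Complex.differentiableOn_tsum_of_summable_norm hu (fun n => (hterm n).mono (by exact Set.inter_subset_left))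
      hVo (fun n w hw => by
        refine (norm_zetaTerm_le (by omega) hw.1.1 (hne w hw.1)).trans ?_
        have h1 : ‖w‖ ≤ ‖z‖ + 1 := by
          have := hw.2.2
          rw [mem_ball_zero_iff] at this
          exact this.le
        have h2 : z.re / 2 < w.re := hw.2.1
        gcongr
        · exact_mod_cast (by omega : 1 ≤ n + 1))
    exact ((this z hzV).differentiableAt (hVo.mem_nhds hzV)).differentiableWithinAt
  have hG : DifferentiableOn ℂ (fun z => ∑' n : ℕ, zetaTerm (n + 1) z - 1 / (1 - z)) D := by
    refine hF.sub (DifferentiableOn.div (by fun_prop) (by fun_prop) hne')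
  have hZ : DifferentiableOn ℂ riemannZeta D := fun z hz =>
    (differentiableAt_riemannZeta (hne z hz)).differentiableWithinAt
  have h2D : (2 + Complex.I : ℂ) ∈ D := by constructor <;> simp
  have key := (hZ.analyticOnNhd hDo).eqOn_of_preconnected_of_eventuallyEq (hG.analyticOnNhd hDo)
    hDc.isPreconnected h2D (by
      have : {z : ℂ | 1 < z.re} ∈ nhds (2 + Complex.I : ℂ) :=
        (isOpen_lt continuous_const Complex.continuous_re).mem_nhds (by simp)
      filter_upwards [this] with z hz
      rw [tsum_zetaTerm_of_one_lt hz]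
      ring)
  exact key ⟨hs, him⟩

lemma sum_range_rpow_le {M : ℕ} (hM : 1 ≤ M) (N : ℕ) :
    ∑ n ∈ Finset.range N, ((n + M + 1 : ℕ) : ℝ) ^ (-(3/2) : ℝ) ≤ 2 * (√M)⁻¹ - 2 * (√(M + N))⁻¹ := by
  have hM0 : (1:ℝ) ≤ M := by exact_mod_cast hM
  induction N with
  | zero => simp
  | succ N ih =>
    rw [Finset.sum_range_succ]
    set x : ℝ := M + N with hx
    have hx1 : 1 ≤ x := by have : (0:ℝ) ≤ N := by positivity
                           linarith
    have e1 : ((N + M + 1 : ℕ) : ℝ) = x + 1 := by push_cast; ring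
    have e2 : (M:ℝ) + ((N + 1 : ℕ) : ℝ) = x + 1 := by push_cast; ring
    rw [e1, e2]
    have e3 : (x + 1) ^ (-(3/2) : ℝ) = (√(x + 1))⁻¹ * (x + 1)⁻¹ := by
      rw [show (-(3/2) : ℝ) = -(1/2) + -1 by norm_num, Real.rpow_add (by linarith), Real.rpow_neg_one,
        Real.rpow_neg (by linarith), ← Real.sqrt_eq_rpow]
    have key : (√(x + 1))⁻¹ * (x + 1)⁻¹ ≤ 2 * (√x)⁻¹ - 2 * (√(x + 1))⁻¹ := by
      have hs1 : 0 < √x := Real.sqrt_pos.2 (by linarith)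
      have hs2 : 0 < √(x + 1) := Real.sqrt_pos.2 (by linarith)
      have hle : √x ≤ √(x + 1) := Real.sqrt_le_sqrt (by linarith)
      have q1 : √x ^ 2 = x := Real.sq_sqrt (by linarith)
      have q2 : √(x + 1) ^ 2 = x + 1 := Real.sq_sqrt (by linarith)
      set a := √x
      set c := √(x + 1)
      rw [← q2]
      have : 2 * a⁻¹ - 2 * c⁻¹ = 2 * (c - a) / (a * c) := by field_simp
      rw [this, le_div_iff₀ (by positivity)]
      have h3 : c⁻¹ * (c ^ 2)⁻¹ * (a * c) = a / c ^ 2 := by field_simp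
      rw [h3, div_le_iff₀ (by positivity)]
      have h4 : (c - a) * (c + a) = 1 := by ring_nf; linarith
      have h5 : 0 ≤ c - a := by linarith
      nlinarith [mul_nonneg h5 hs1.le, mul_nonneg h5 hs2.le, mul_nonneg (mul_nonneg h5 hs1.le) hs2.le]
    rw [e3]
    linarith

end zeta

/-- The Dirichlet polynomial approximating `ζ(1/2 + it)`. -/
noncomputable def dirPoly (X : ℕ) (t : ℝ) : ℂ :=
  ∑ n ∈ Finset.Ico 1 X, (((√n)⁻¹ : ℝ) : ℂ) * Complex.exp (-((t * log n : ℝ) : ℂ) * Complex.I)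

lemma cpow_half_eq {n : ℕ} (hn : 1 ≤ n) (t : ℝ) :
    (n : ℂ) ^ (-(1 / 2 + t * Complex.I)) =
      (((√n)⁻¹ : ℝ) : ℂ) * Complex.exp (-((t * log n : ℝ) : ℂ) * Complex.I) := by
  have hn0 : (n:ℂ) ≠ 0 := by exact_mod_cast (by omega : n ≠ 0)
  have hn1 : (0:ℝ) < n := by exact_mod_cast hn
  rw [neg_add, Complex.cpow_add _ _ hn0]
  congr 1
  · rw [Complex.cpow_neg, Complex.ofReal_inv]
    congr 1
    rw [Real.sqrt_eq_rpow, Complex.ofReal_cpow hn1.le]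
    push_cast
    rfl
  · rw [Complex.cpow_def_of_ne_zero hn0, ← Complex.natCast_log]
    congr 1
    push_cast
    ring

lemma norm_sum_tail_le {T t : ℝ} (hT : 1 ≤ T) (ht : T ≤ t) (ht4 : t ≤ 4 * T) {X m : ℕ} (hX : 8 * T ≤ X) :
    ‖∑ n ∈ Finset.Ico X (X + m + 1), (((√n)⁻¹ : ℝ) : ℂ) * Complex.exp (-((t * log n : ℝ) : ℂ) * Complex.I)‖
      ≤ 24 * √((X : ℝ) + m) / t := by
  have hX0 : (8:ℝ) ≤ X := by linarith
  have ht0 : 0 < t := by linarith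
  rw [Finset.sum_Ico_eq_sum_range, show X + m + 1 - X = m + 1 by omega, ← Complex.norm_conj, map_sum]
  set f : ℕ → ℝ := fun n => t * log ((X + n : ℕ) : ℝ) with hf
  set β : ℕ → ℝ := fun n => (√((X + n : ℕ) : ℝ))⁻¹ with hβ
  have hconj : ∀ n, conj ((((√((X + n : ℕ) : ℝ))⁻¹ : ℝ) : ℂ) *
      Complex.exp (-((t * log ((X + n : ℕ) : ℝ) : ℝ) : ℂ) * Complex.I))
      = (β n : ℂ) * Complex.exp (Complex.I * f n) := by
    intro n
    simp only [hβ, hf, map_mul, Complex.conj_ofReal, ← Complex.exp_conj, Complex.conj_I, map_neg]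
    congr 2
    ring
  simp_rw [hconj]
  have hfd : ∀ n, f (n + 1) - f n = t * log (1 + 1 / ((X:ℝ) + n)) := by
    intro n
    simp only [hf]
    have hXp : 0 < X := by exact_mod_cast (by linarith : (0:ℝ) < X)
    rw [← mul_sub, ← log_div (by positivity) (by positivity)]
    congr 2
    push_cast
    field_simp
    ring
  have hKL : ∀ k ≤ m + 1, ‖∑ n ∈ Finset.range k, Complex.exp (Complex.I * f n)‖ ≤ 6 * (X + k) / t := by
    intro k hk
    have := kusmin_landau (f := f) (m := k) (η := t / (X + k)) (by positivity) ?_ ?_ ?_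
    · refine this.trans_eq ?_
      field_simp
    · intro n hn
      rw [hfd]
      have hn' : (n:ℝ) + 1 ≤ k := by exact_mod_cast hn
      have h1 := Real.one_sub_inv_le_log_of_pos (x := 1 + 1 / ((X:ℝ) + n)) (by positivity)
      have h2 : 1 - (1 + 1 / ((X:ℝ) + n))⁻¹ = 1 / (X + n + 1) := by field_simp; ring
      rw [h2] at h1
      calc t / (X + k) = t * (1 / (X + k)) := by ring
        _ ≤ t * (1 / (X + n + 1)) := by gcongr t * (1 / ?_); linarith
        _ ≤ _ := by gcongr
    · intro n hn
      rw [hfd]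
      have h1 := Real.log_le_sub_one_of_pos (x := 1 + 1 / ((X:ℝ) + n)) (by positivity)
      have hn' : (0:ℝ) ≤ n := by positivity
      have h2 : 1 / ((X:ℝ) + n) ≤ 1 / X := by gcongr; linarith
      calc _ ≤ t * (1 / X) := by gcongr; linarith
        _ ≤ 1 := by rw [mul_one_div, div_le_one (by positivity)]; linarith
        _ ≤ π := by linarith [Real.pi_gt_three]
    · intro n hn
      rw [hfd (n + 1), hfd n]
      push_cast
      gcongr
      linarith
  refine (norm_sum_mul_le (B := fun k => 6 * (X + k) / t) hKL).trans ?_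
  have hterm : ∀ n : ℕ, |β (n + 1) - β n| * (6 * (X + (n + 1 : ℕ)) / t)
      ≤ 12 / t * (√((X:ℝ) + (n + 1 : ℕ)) - √((X:ℝ) + n)) := by
    intro n
    simp only [hβ]
    have hx1 : (1:ℝ) ≤ X + n := by have : (0:ℝ) ≤ n := by positivity
                                   linarith
    push_cast
    rw [← add_assoc]
    set x : ℝ := X + n
    have hs1 : 1 ≤ √x := Real.one_le_sqrt.2 hx1
    have hle : √x ≤ √(x + 1) := Real.sqrt_le_sqrt (by linarith)
    have q1 : √x ^ 2 = x := Real.sq_sqrt (by linarith)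
    have q2 : √(x + 1) ^ 2 = x + 1 := Real.sq_sqrt (by linarith)
    set a := √x
    set c := √(x + 1)
    have hc : 0 < c := by linarith
    have hca : c ≤ 2 * a := by nlinarith
    have e : |c⁻¹ - a⁻¹| = (c - a) / (a * c) := by
      rw [abs_of_nonpos (by rw [sub_nonpos]; exact inv_anti₀ (by linarith) hle)]
      field_simp
      ring
    rw [e, ← q2]
    calc (c - a) / (a * c) * (6 * c ^ 2 / t) = 6 / t * (c - a) * (c / a) := by field_simp
      _ ≤ 6 / t * (c - a) * 2 := by
          have : c / a ≤ 2 := by rw [div_le_iff₀ (by linarith)]; linarith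
          have : 0 ≤ c - a := by linarith
          gcongr
      _ = _ := by ring
  have hsum := Finset.sum_le_sum fun n (_ : n ∈ Finset.range m) => hterm n
  rw [← Finset.mul_sum, Finset.sum_range_sub (fun n : ℕ => √((X:ℝ) + n))] at hsum
  have hlast : |β m| * (6 * (X + (m + 1 : ℕ)) / t) ≤ 12 / t * √((X:ℝ) + m) := by
    simp only [hβ]
    have hx1 : (1:ℝ) ≤ X + m := by have : (0:ℝ) ≤ m := by positivity
                                   linarith
    push_cast
    rw [← add_assoc]
    set x : ℝ := X + m
    have hs1 : 1 ≤ √x := Real.one_le_sqrt.2 hx1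
    have q1 : √x ^ 2 = x := Real.sq_sqrt (by linarith)
    rw [abs_of_pos (by positivity)]
    calc (√x)⁻¹ * (6 * (x + 1) / t) ≤ (√x)⁻¹ * (6 * (2 * x) / t) := by gcongr; linarith
      _ = (√x)⁻¹ * (12 * √x ^ 2 / t) := by rw [q1]; ring
      _ = _ := by field_simp
  have h0 : 0 ≤ 12 / t * √((X:ℝ) + (0:ℕ)) := by positivity
  calc _ ≤ 12 / t * √((X:ℝ) + m) + 12 / t * (√((X:ℝ) + m) - √((X:ℝ) + (0:ℕ))) := add_le_add hlast hsum
    _ ≤ 12 / t * √((X:ℝ) + m) + 12 / t * √((X:ℝ) + m) := by linarith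
    _ = _ := by ring

lemma norm_zeta_sub_dirPoly_le {T t : ℝ} (hT : 1 ≤ T) (ht : T ≤ t) (ht4 : t ≤ 4 * T) {X : ℕ}
    (hX : 8 * T ≤ X) (hX9 : X ≤ 9 * T) :
    ‖riemannZeta (1 / 2 + t * Complex.I) - dirPoly X t‖ ≤ 1000 := by
  have ht0 : 0 < t := by linarith
  set s : ℂ := 1 / 2 + t * Complex.I with hs
  have hre : s.re = 1 / 2 := by simp [hs]
  have him : s.im = t := by simp [hs]
  have hs1 : s ≠ 1 := by intro h; rw [h] at hre; norm_num at hre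
  have hX1 : 1 ≤ X := by
    have : (1:ℝ) ≤ X := by linarith
    exact_mod_cast this
  obtain ⟨m, hm⟩ : ∃ m, m = ⌈T⌉₊ := ⟨_, rfl⟩
  have hm1 : T ≤ m := hm ▸ Nat.le_ceil _
  have hm2 : (m:ℝ) < T + 1 := hm ▸ Nat.ceil_lt_add_one (by positivity)
  obtain ⟨M, hM⟩ : ∃ M, M = (9 * m) ^ 2 := ⟨_, rfl⟩
  have hMr : (M:ℝ) = (9 * m) ^ 2 := by rw [hM]; push_cast; ring
  have hsq : √(M:ℝ) = 9 * m := by rw [hMr, Real.sqrt_sq (by positivity)]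
  have hXM : X ≤ M := by
    have : (X:ℝ) ≤ M := by rw [hMr]; nlinarith
    exact_mod_cast this
  have hM1 : 1 ≤ M := hX1.trans hXM
  have hsumm := summable_zetaTerm (s := s) (by rw [hre]; norm_num) hs1
  have hz := zeta_eq_tsum_zetaTerm (s := s) (by rw [hre]; norm_num) (by rw [him]; exact ht0)
  rw [← hsumm.sum_add_tsum_nat_add M, sum_range_zetaTerm] at hz
  have hsn : ‖s‖ ≤ 5 * T := by
    calc ‖s‖ ≤ ‖(1 / 2 : ℂ)‖ + ‖(t:ℂ) * Complex.I‖ := norm_add_le _ _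
      _ = 1 / 2 + t := by simp [abs_of_pos ht0]
      _ ≤ _ := by linarith
  have htail : ‖∑' n : ℕ, zetaTerm (n + M + 1) s‖ ≤ 5 * T * (2 * (√M)⁻¹) := by
    have hsum' : Summable fun n : ℕ => ‖zetaTerm (n + M + 1) s‖ := by
      refine (((summable_nat_add_iff M).2 hsumm)).norm.congr fun n => rfl
    refine (norm_tsum_le_tsum_norm hsum').trans ?_
    refine Real.tsum_le_of_sum_range_le (fun n => norm_nonneg _) fun N => ?_
    calc _ ≤ ∑ n ∈ Finset.range N, 5 * T * ((n + M + 1 : ℕ) : ℝ) ^ (-(3/2) : ℝ) := by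
          refine Finset.sum_le_sum fun n _ => ?_
          refine (norm_zetaTerm_le (by omega) (by rw [hre]; norm_num) hs1).trans ?_
          rw [hre, show (-(1/2) - 1 : ℝ) = -(3/2) by norm_num]
          gcongr
      _ = 5 * T * ∑ n ∈ Finset.range N, ((n + M + 1 : ℕ) : ℝ) ^ (-(3/2) : ℝ) := by rw [Finset.mul_sum]
      _ ≤ _ := by
          gcongr
          have := sum_range_rpow_le hM1 N
          have h0 : (0:ℝ) ≤ 2 * (√(M + N))⁻¹ := by positivity
          linarith
  have hbdry : ‖((M : ℂ) + 1) ^ (1 - s) / (1 - s)‖ ≤ 2 * √M / t := by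
    have e : (M : ℂ) + 1 = (((M:ℝ) + 1 : ℝ) : ℂ) := by push_cast; rfl
    rw [norm_div, e, Complex.norm_cpow_eq_rpow_re_of_pos (by positivity)]
    have h1 : (1 - s).re = 1 / 2 := by rw [Complex.sub_re, hre]; norm_num
    rw [h1, ← Real.sqrt_eq_rpow]
    have hM1' : (1:ℝ) ≤ M := by exact_mod_cast hM1
    have h2 : √((M:ℝ) + 1) ≤ 2 * √M := by
      rw [Real.sqrt_le_left (by positivity), mul_pow, Real.sq_sqrt (by positivity)]
      linarith
    have h3 : t ≤ ‖1 - s‖ := by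
      have := Complex.abs_im_le_norm (1 - s)
      rw [Complex.sub_im, him] at this
      simpa [abs_of_pos ht0] using this
    gcongr
  have hsplit : ∑ n ∈ Finset.range M, ((n + 1 : ℕ) : ℂ) ^ (-s) = dirPoly X t +
      ∑ n ∈ Finset.Ico X (X + (M - X) + 1), (((√n)⁻¹ : ℝ) : ℂ) *
        Complex.exp (-((t * log n : ℝ) : ℂ) * Complex.I) := by
    rw [dirPoly, Finset.sum_Ico_consecutive _ hX1 (by omega), Finset.sum_Ico_eq_sum_range,
      show X + (M - X) + 1 - 1 = M by omega]
    refine Finset.sum_congr rfl fun n _ => ?_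
    rw [← cpow_half_eq (by omega), add_comm]
  have hmid := norm_sum_tail_le hT ht ht4 hX (m := M - X)
  rw [← Nat.cast_add, show X + (M - X) = M by omega] at hmid
  rw [hsplit, show X + (M - X) = M by omega] at hz
  set P := ∑ n ∈ Finset.Ico X (M + 1), (((√n)⁻¹ : ℝ) : ℂ) *
        Complex.exp (-((t * log n : ℝ) : ℂ) * Complex.I)
  have hfin : riemannZeta s - dirPoly X t = P - ((M : ℂ) + 1) ^ (1 - s) / (1 - s) +
      ∑' n : ℕ, zetaTerm (n + M + 1) s := by
    rw [hz]; ring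
  rw [hfin]
  refine (norm_add_le _ _).trans ((add_le_add ((norm_sub_le _ _).trans (add_le_add hmid hbdry)) htail).trans ?_)
  rw [hsq]
  have h1 : 24 * (9 * (m:ℝ)) / t ≤ 24 * 18 := by rw [div_le_iff₀ ht0]; nlinarith
  have h2 : 2 * (9 * (m:ℝ)) / t ≤ 2 * 18 := by rw [div_le_iff₀ ht0]; nlinarith
  have h3 : 5 * T * (2 * (9 * (m:ℝ))⁻¹) ≤ 10 := by
    rw [← mul_assoc, ← div_eq_mul_inv, div_le_iff₀ (by linarith)]; nlinarith
  linarith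

section gaussGrid

lemma summable_gauss {M : ℝ} (hM : 0 < M) (y : ℝ) :
    Summable fun j : ℤ => (rexp (-(j:ℝ) ^ 2 / (2 * M ^ 2)) : ℂ) * Complex.exp (-((j * y : ℝ) : ℂ) * Complex.I) := by
  have h := (summable_jacobiTheta₂_term_iff (-y / (2 * π) : ℂ) (Complex.I * ((1 / (2 * π * M ^ 2) : ℝ) : ℂ))).2
    (by simp only [Complex.mul_im, Complex.I_re, Complex.I_im, Complex.ofReal_re, Complex.ofReal_im]
        simp only [one_mul, zero_add, mul_zero]
        positivity)
  refine h.congr fun j => ?_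
  rw [jacobiTheta₂_term, Complex.ofReal_exp, ← Complex.exp_add]
  congr 1
  have hp : (π:ℂ) ≠ 0 := by exact_mod_cast Real.pi_ne_zero
  have hM' : (M:ℂ) ≠ 0 := by exact_mod_cast hM.ne'
  push_cast
  field_simp
  ring_nf
  simp only [Complex.I_sq]
  ring

lemma exists_hasSum_gauss : ∃ C : ℝ, 0 ≤ C ∧ ∀ M : ℝ, 1 ≤ M → ∀ y : ℝ, |y| ≤ π → ∃ r : ℝ, |r| ≤ C * rexp (-M ^ 2) ∧
    HasSum (fun j : ℤ => (rexp (-(j:ℝ) ^ 2 / (2 * M ^ 2)) : ℂ) * Complex.exp (-((j * y : ℝ) : ℂ) * Complex.I))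
      ((M * √(2 * π) * (rexp (-(M * y) ^ 2 / 2) + r) : ℝ) : ℂ) := by
  have hs : Summable fun ν : ℤ => 1 / (ν:ℝ) ^ 2 := Real.summable_one_div_int_pow.2 (by norm_num)
  refine ⟨∑' ν : ℤ, 1 / (ν:ℝ) ^ 2, tsum_nonneg fun ν => by positivity, fun M hM y hy => ?_⟩
  have hM0 : 0 < M := by linarith
  have hp : (π:ℂ) ≠ 0 := by exact_mod_cast Real.pi_ne_zero
  have hM' : (M:ℂ) ≠ 0 := by exact_mod_cast hM0.ne'
  set g : ℤ → ℝ := fun ν => rexp (-(M * (y + 2 * π * ν)) ^ 2 / 2) with hg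
  have hbd : ∀ ν : ℤ, ν ≠ 0 → g ν ≤ rexp (-M ^ 2) * (1 / (ν:ℝ) ^ 2) := by
    intro ν hν
    have hν1 : (1:ℝ) ≤ |(ν:ℝ)| := by exact_mod_cast Int.one_le_abs hν
    have h1 : π * |(ν:ℝ)| ≤ |y + 2 * π * ν| := by
      have := abs_sub_abs_le_abs_sub (2 * π * ν) (-y)
      rw [abs_mul, abs_of_pos (by positivity : (0:ℝ) < 2 * π), abs_neg] at this
      rw [show y + 2 * π * ν = 2 * π * ν - -y by ring]
      nlinarith [Real.pi_pos]
    have h2 : 9 * (ν:ℝ) ^ 2 ≤ (y + 2 * π * ν) ^ 2 := by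
      rw [← sq_abs (ν:ℝ), ← sq_abs (y + _)]
      have : 3 * |(ν:ℝ)| ≤ |y + 2 * π * ν| := by nlinarith [Real.pi_gt_three]
      nlinarith
    have h3 : (1:ℝ) ≤ (ν:ℝ) ^ 2 := by rw [← sq_abs]; nlinarith
    have h4 : 1 ≤ M ^ 2 := by nlinarith
    calc g ν ≤ rexp (-M ^ 2 + -(ν:ℝ) ^ 2) := by
          refine Real.exp_le_exp.2 ?_
          rw [mul_pow]
          nlinarith [mul_le_mul_of_nonneg_left h2 (by positivity : 0 ≤ M ^ 2), mul_nonneg (sub_nonneg.2 h3) (sub_nonneg.2 h4)]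
      _ = rexp (-M ^ 2) * (rexp ((ν:ℝ) ^ 2))⁻¹ := by rw [Real.exp_add, Real.exp_neg ((ν:ℝ) ^ 2)]
      _ ≤ _ := by
          rw [one_div]
          gcongr
          linarith [Real.add_one_le_exp ((ν:ℝ) ^ 2)]
  have hg' : Summable fun ν : ℤ => if ν = 0 then 0 else g ν := by
    refine Summable.of_nonneg_of_le (fun ν => ?_) (fun ν => ?_) (hs.mul_left (rexp (-M ^ 2)))
    · split_ifs
      · rfl
      · exact (Real.exp_pos _).le
    · split_ifs with h
      · positivity
      · exact hbd ν h
  have hgs : Summable g := by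
    refine (hg'.add (summable_of_hasFiniteSupport (f := fun ν : ℤ => if ν = 0 then g 0 else 0) ?_)).congr fun ν => ?_
    · exact (Set.finite_singleton (0:ℤ)).subset fun ν hν => by
        by_contra h
        exact hν (if_neg h)
    · split_ifs with h
      · rw [h]; simp
      · simp
  have hts : ∑' ν, g ν = rexp (-(M * y) ^ 2 / 2) + ∑' ν : ℤ, if ν = 0 then 0 else g ν := by
    rw [hgs.tsum_eq_add_tsum_ite 0]
    simp [hg]
  refine ⟨∑' ν : ℤ, if ν = 0 then 0 else g ν, ?_, ?_⟩
  · rw [abs_of_nonneg (tsum_nonneg fun ν => by split_ifs; exacts [le_rfl, (Real.exp_pos _).le]), mul_comm, ← tsum_mul_left]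
    refine hg'.tsum_le_tsum (fun ν => ?_) (hs.mul_left _)
    split_ifs with h
    · positivity
    · exact hbd ν h
  · have h := (summable_gauss hM0 y).hasSum
    convert h using 1
    rw [← hts]
    have key := Complex.tsum_exp_neg_quadratic (a := ((1 / (2 * π * M ^ 2) : ℝ) : ℂ))
      (by rw [Complex.ofReal_re]; positivity) (-(Complex.I * y / (2 * π)))
    have e1 : ∀ n : ℤ, Complex.exp (-π * ((1 / (2 * π * M ^ 2) : ℝ) : ℂ) * n ^ 2 + 2 * π * (-(Complex.I * y / (2 * π))) * n)
        = (rexp (-(n:ℝ) ^ 2 / (2 * M ^ 2)) : ℂ) * Complex.exp (-((n * y : ℝ) : ℂ) * Complex.I) := by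
      intro n
      rw [Complex.ofReal_exp, ← Complex.exp_add]
      congr 1
      push_cast
      field_simp
    have e2 : ∀ n : ℤ, Complex.exp (-π / ((1 / (2 * π * M ^ 2) : ℝ) : ℂ) * (n + Complex.I * (-(Complex.I * y / (2 * π)))) ^ 2)
        = (g n : ℂ) := by
      intro n
      simp only [hg]
      rw [Complex.ofReal_exp]
      congr 1
      have : Complex.I * (-(Complex.I * y / (2 * π))) = y / (2 * π) := by
        ring_nf
        rw [Complex.I_sq]
        ring
      rw [this]
      push_cast
      field_simp
      ring
    simp_rw [e1, e2] at key
    rw [key, ← Complex.ofReal_tsum, Complex.ofReal_mul]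
    congr 1
    rw [show (1 / 2 : ℂ) = ((1 / 2 : ℝ) : ℂ) by push_cast; rfl, ← Complex.ofReal_cpow (by positivity),
      ← Real.sqrt_eq_rpow, show (1:ℂ) = ((1:ℝ):ℂ) by push_cast; rfl, ← Complex.ofReal_div]
    congr 1
    rw [Real.sqrt_div zero_le_one, Real.sqrt_one, one_div_one_div, Real.sqrt_mul (by positivity) (M ^ 2),
      Real.sqrt_sq hM0.le, mul_comm]

lemma sum_Ico_Ico_symm {f : ℕ → ℕ → ℝ} (hf : ∀ m n, f m n = f n m) (X : ℕ) :
    ∑ m ∈ Finset.Ico 1 X, ∑ n ∈ Finset.Ico 1 X, f m n =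
      ∑ m ∈ Finset.Ico 1 X, f m m + 2 * ∑ n ∈ Finset.Ico 1 X, ∑ m ∈ Finset.Ico (n + 1) X, f m n := by
  have h1 : ∀ m ∈ Finset.Ico 1 X, ∑ n ∈ Finset.Ico 1 X, f m n =
      ∑ n ∈ Finset.Ico 1 m, f m n + (f m m + ∑ n ∈ Finset.Ico (m + 1) X, f m n) := by
    intro m hm
    rw [Finset.mem_Ico] at hm
    rw [← Finset.sum_eq_sum_Ico_succ_bot hm.2, Finset.sum_Ico_consecutive _ hm.1 hm.2.le]
  rw [Finset.sum_congr rfl h1, Finset.sum_add_distrib, Finset.sum_add_distrib,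
    Finset.sum_Ico_Ico_comm' 1 X (fun n m => f m n)]
  have h2 : ∑ m ∈ Finset.Ico 1 X, ∑ n ∈ Finset.Ico (m + 1) X, f m n =
      ∑ m ∈ Finset.Ico 1 X, ∑ n ∈ Finset.Ico 1 m, f m n := by
    rw [Finset.sum_Ico_Ico_comm' 1 X (fun m n => f m n)]
    exact Finset.sum_congr rfl fun m _ => Finset.sum_congr rfl fun n _ => hf n m
  rw [h2]
  ring

/-- The off-diagonal part of the Gaussian mean square of `dirPoly X`, with `m = n + h`. -/
noncomputable def offSum (G : ℝ) (X : ℕ) (t : ℝ) : ℂ :=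
  ∑ h ∈ Finset.Icc 1 X, (1 / h : ℂ) * ∑ n ∈ Finset.Icc 1 (X - 1 - h), oscAmp (gaussAmp G) t ((n:ℝ) / h)

lemma re_offSum (G : ℝ) (X : ℕ) (t : ℝ) :
    (offSum G X t).re = ∑ n ∈ Finset.Ico 1 X, ∑ m ∈ Finset.Ico (n + 1) X,
      (√m)⁻¹ * (√n)⁻¹ * (rexp (-(G * (log m - log n)) ^ 2 / 2) * cos (t * (log m - log n))) := by
  have h1 : ∀ n ∈ Finset.Ico 1 X, ∑ m ∈ Finset.Ico (n + 1) X,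
      (√m)⁻¹ * (√n)⁻¹ * (rexp (-(G * (log m - log n)) ^ 2 / 2) * cos (t * (log m - log n)))
      = ∑ h ∈ Finset.Ico 1 (X - n), (√((n + h : ℕ) : ℝ))⁻¹ * (√n)⁻¹ *
        (rexp (-(G * (log ((n + h : ℕ) : ℝ) - log n)) ^ 2 / 2) * cos (t * (log ((n + h : ℕ) : ℝ) - log n))) := by
    intro n hn
    rw [Finset.mem_Ico] at hn
    rw [Finset.sum_Ico_add (fun m : ℕ => (√(m:ℝ))⁻¹ * (√n)⁻¹ * (rexp (-(G * (log m - log n)) ^ 2 / 2) * cos (t * (log m - log n)))) 1 (X - n) n,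
      show 1 + n = n + 1 by omega, show X - n + n = X by omega]
  rw [Finset.sum_congr rfl h1, offSum, Complex.re_sum]
  rw [Finset.sum_comm' (t' := Finset.Icc 1 X) (s' := fun h => Finset.Icc 1 (X - 1 - h))
    (by intro n h; simp only [Finset.mem_Ico, Finset.mem_Icc]; omega)]
  refine Finset.sum_congr rfl fun h hh => ?_
  rw [Finset.mul_sum, Complex.re_sum]
  refine Finset.sum_congr rfl fun n hn => ?_
  rw [Finset.mem_Icc] at hh hn
  have hh0 : (0:ℝ) < h := by exact_mod_cast hh.1
  have hn0 : (0:ℝ) < n := by exact_mod_cast hn.1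
  have hhn : 1 ≤ h := hh.1
  have e1 : phi ((n:ℝ) / h) = log ((n + h : ℕ) : ℝ) - log n := by
    rw [phi, ← log_div (by positivity) (by positivity), ← log_div (by positivity) (by positivity)]
    congr 1
    push_cast
    field_simp
  have e2 : √((n:ℝ) / h * (n / h + 1)) = √n * √((n + h : ℕ) : ℝ) / h := by
    rw [← Real.sqrt_mul hn0.le, Real.sqrt_eq_iff_eq_sq (by positivity) (by positivity), div_pow,
      Real.sq_sqrt (by positivity)]
    push_cast
    field_simp
  rw [oscAmp, gaussAmp, e1, e2, show (1 / (h:ℂ)) = ((1 / h : ℝ) : ℂ) by push_cast; rfl, Complex.re_ofReal_mul,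
    Complex.re_ofReal_mul, Complex.exp_ofReal_mul_I_re]
  field_simp

lemma exists_sum_sq_dirPoly_le : ∃ C : ℝ, 0 ≤ C ∧ ∀ (X : ℕ) (M ϖ : ℝ), 1 ≤ X → 1 ≤ M → 2 * log X ≤ M ^ 2 →
    0 < ϖ → ϖ * log X ≤ π → ∀ (θ : ℝ) (k : ℤ) (A : Finset ℤ), (∀ j ∈ A, |(j:ℝ) - k| ≤ M) →
      ∑ j ∈ A, ‖dirPoly X (θ + j * ϖ)‖ ^ 2 ≤ 5 * M * (log X + C + 2 * (offSum (M * ϖ) X (θ + k * ϖ)).re) := by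
  obtain ⟨C, hC0, hC⟩ := exists_hasSum_gauss
  refine ⟨C + 1, by linarith, fun X M ϖ hX hM hMX hϖ hϖX θ k A hA => ?_⟩
  have hM0 : 0 < M := by linarith
  set τ : ℝ := θ + k * ϖ with hτ
  have hlog : ∀ m ∈ Finset.Ico 1 X, 0 ≤ log (m:ℝ) ∧ log (m:ℝ) ≤ log X := by
    intro m hm
    rw [Finset.mem_Ico] at hm
    have : (1:ℝ) ≤ m := by exact_mod_cast hm.1
    exact ⟨log_nonneg this, log_le_log (by linarith) (by exact_mod_cast hm.2.le)⟩
  have hy : ∀ m ∈ Finset.Ico 1 X, ∀ n ∈ Finset.Ico 1 X, |ϖ * (log m - log n)| ≤ π := by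
    intro m hm n hn
    have h1 := hlog m hm
    have h2 := hlog n hn
    rw [abs_mul, abs_of_pos hϖ]
    refine le_trans ?_ hϖX
    gcongr
    rw [abs_le]
    constructor <;> linarith
  choose! r hr hrs using hC M hM
  set a : ℕ → ℝ := fun n => (√n)⁻¹ with ha
  have ha0 : ∀ n, 0 ≤ a n := fun n => by simp only [ha]; positivity
  have ha1 : ∀ n ∈ Finset.Ico 1 X, a n ≤ 1 := by
    intro n hn
    rw [Finset.mem_Ico] at hn
    exact inv_le_one_of_one_le₀ (Real.one_le_sqrt.2 (by exact_mod_cast hn.1))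
  set lam : ℕ → ℕ → ℝ := fun m n => log m - log n with hlam
  have hsq : ∀ t : ℝ, ((‖dirPoly X t‖ ^ 2 : ℝ) : ℂ) = ∑ m ∈ Finset.Ico 1 X, ∑ n ∈ Finset.Ico 1 X,
      ((a m * a n : ℝ) : ℂ) * Complex.exp (-((t * lam m n : ℝ) : ℂ) * Complex.I) := by
    intro t
    push_cast
    rw [← Complex.mul_conj', dirPoly, map_sum, Finset.sum_mul_sum]
    refine Finset.sum_congr rfl fun m _ => Finset.sum_congr rfl fun n _ => ?_
    rw [map_mul, Complex.conj_ofReal, ← Complex.exp_conj, mul_mul_mul_comm, ← Complex.exp_add]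
    simp only [ha, hlam, map_mul, map_neg, Complex.conj_ofReal, Complex.conj_I]
    push_cast
    congr 2
    ring
  have hH : HasSum (fun j : ℤ => ((rexp (-(j:ℝ) ^ 2 / (2 * M ^ 2)) * ‖dirPoly X (τ + j * ϖ)‖ ^ 2 : ℝ) : ℂ))
      (∑ m ∈ Finset.Ico 1 X, ∑ n ∈ Finset.Ico 1 X, ((a m * a n : ℝ) : ℂ) *
        Complex.exp (-((τ * lam m n : ℝ) : ℂ) * Complex.I) *
        ((M * √(2 * π) * (rexp (-(M * (ϖ * lam m n)) ^ 2 / 2) + r (ϖ * lam m n)) : ℝ) : ℂ)) := by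
    have := hasSum_sum (s := Finset.Ico 1 X) fun m hm => hasSum_sum (s := Finset.Ico 1 X) fun n hn =>
      (hrs (ϖ * lam m n) (hy m hm n hn)).mul_left (((a m * a n : ℝ) : ℂ) *
        Complex.exp (-((τ * lam m n : ℝ) : ℂ) * Complex.I))
    refine this.congr_fun ?_
    intro j
    rw [Complex.ofReal_mul, hsq, Finset.mul_sum]
    refine Finset.sum_congr rfl fun m _ => ?_
    rw [Finset.mul_sum]
    refine Finset.sum_congr rfl fun n _ => ?_
    rw [mul_mul_mul_comm, ← mul_assoc, ← Complex.exp_add, mul_comm ((rexp _ : ℝ) : ℂ)]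
    congr 2
    push_cast
    ring
  have hR := Complex.hasSum_re hH
  simp only [Complex.ofReal_re] at hR
  set F := ∑ m ∈ Finset.Ico 1 X, ∑ n ∈ Finset.Ico 1 X,
    a m * a n * (rexp (-(M * ϖ * lam m n) ^ 2 / 2) * cos (τ * lam m n)) with hF
  have hFle : (∑ m ∈ Finset.Ico 1 X, ∑ n ∈ Finset.Ico 1 X, ((a m * a n : ℝ) : ℂ) *
        Complex.exp (-((τ * lam m n : ℝ) : ℂ) * Complex.I) *
        ((M * √(2 * π) * (rexp (-(M * (ϖ * lam m n)) ^ 2 / 2) + r (ϖ * lam m n)) : ℝ) : ℂ)).re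
        ≤ M * √(2 * π) * (F + C) := by
    have h1 : ∀ m ∈ Finset.Ico 1 X, ∀ n ∈ Finset.Ico 1 X, (((a m * a n : ℝ) : ℂ) *
        Complex.exp (-((τ * lam m n : ℝ) : ℂ) * Complex.I) *
        ((M * √(2 * π) * (rexp (-(M * (ϖ * lam m n)) ^ 2 / 2) + r (ϖ * lam m n)) : ℝ) : ℂ)).re
        ≤ M * √(2 * π) * (a m * a n * (rexp (-(M * ϖ * lam m n) ^ 2 / 2) * cos (τ * lam m n)) + C * rexp (-M ^ 2)) := by
      intro m hm n hn
      have e : (((a m * a n : ℝ) : ℂ) *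
        Complex.exp (-((τ * lam m n : ℝ) : ℂ) * Complex.I) *
        ((M * √(2 * π) * (rexp (-(M * (ϖ * lam m n)) ^ 2 / 2) + r (ϖ * lam m n)) : ℝ) : ℂ)).re
        = M * √(2 * π) * (a m * a n * (rexp (-(M * ϖ * lam m n) ^ 2 / 2) * cos (τ * lam m n))
          + a m * a n * cos (τ * lam m n) * r (ϖ * lam m n)) := by
        rw [Complex.re_mul_ofReal, Complex.re_ofReal_mul, ← Complex.ofReal_neg, Complex.exp_ofReal_mul_I_re,
          Real.cos_neg, mul_assoc M ϖ]
        ring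
      rw [e]
      refine mul_le_mul_of_nonneg_left (add_le_add le_rfl ?_) (by positivity)
      refine (le_abs_self _).trans ?_
      rw [abs_mul, abs_mul, abs_mul, abs_of_nonneg (ha0 m), abs_of_nonneg (ha0 n)]
      have h3 : a m * a n * |cos (τ * lam m n)| ≤ 1 * 1 * 1 := by
        gcongr
        · exact ha1 m hm
        · exact ha1 n hn
        · exact Real.abs_cos_le_one _
      have h4 := hr (ϖ * lam m n) (hy m hm n hn)
      nlinarith [abs_nonneg (r (ϖ * lam m n)), mul_nonneg (mul_nonneg (ha0 m) (ha0 n)) (abs_nonneg (cos (τ * lam m n)))]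
    rw [Complex.re_sum]
    simp_rw [Complex.re_sum]
    refine (Finset.sum_le_sum fun m hm => Finset.sum_le_sum fun n hn => h1 m hm n hn).trans ?_
    simp_rw [← Finset.mul_sum, Finset.sum_add_distrib]
    rw [← hF]
    gcongr
    simp only [Finset.sum_const, Nat.card_Ico, nsmul_eq_mul]
    have hX0 : (0:ℝ) < X := by exact_mod_cast hX
    have h5 : rexp (-M ^ 2) ≤ ((X:ℝ) ^ 2)⁻¹ := by
      rw [Real.exp_neg]
      gcongr
      rw [← Real.log_le_iff_le_exp (by positivity), Real.log_pow]
      exact_mod_cast hMX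
    have h6 : (((X - 1 : ℕ)) : ℝ) ≤ X := by exact_mod_cast Nat.sub_le X 1
    calc _ ≤ (X:ℝ) * (X * (C * ((X:ℝ) ^ 2)⁻¹)) := by gcongr
      _ = C := by field_simp
  have hFeq : F ≤ log X + 1 + 2 * (offSum (M * ϖ) X τ).re := by
    rw [hF, sum_Ico_Ico_symm (f := fun m n => a m * a n * (rexp (-(M * ϖ * lam m n) ^ 2 / 2) * cos (τ * lam m n))),
      re_offSum]
    · refine add_le_add ?_ le_rfl
      have h1 : ∀ m ∈ Finset.Ico 1 X, a m * a m * (rexp (-(M * ϖ * lam m m) ^ 2 / 2) * cos (τ * lam m m))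
          = ((m:ℝ))⁻¹ := by
        intro m hm
        simp only [hlam, ha, sub_self, mul_zero, Real.cos_zero]
        rw [← mul_inv, Real.mul_self_sqrt (by positivity)]
        simp
      rw [Finset.sum_congr rfl h1]
      have h2 := harmonic_le_one_add_log X
      rw [harmonic_eq_sum_Icc] at h2
      push_cast at h2
      refine le_trans (Finset.sum_le_sum_of_subset_of_nonneg ?_ fun _ _ _ => by positivity) (h2.trans_eq (add_comm _ _))
      intro m hm
      simp only [Finset.mem_Ico, Finset.mem_Icc] at hm ⊢
      omega
    · intro m n
      have : lam m n = - lam n m := by simp only [hlam]; ring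
      simp only [this, mul_neg, neg_sq, Real.cos_neg]
      ring
  have hA' : ∑ j ∈ A, ‖dirPoly X (θ + j * ϖ)‖ ^ 2 ≤ rexp (1 / 2) *
      ∑ i ∈ A.map (Equiv.subRight k).toEmbedding, rexp (-(i:ℝ) ^ 2 / (2 * M ^ 2)) * ‖dirPoly X (τ + i * ϖ)‖ ^ 2 := by
    rw [Finset.sum_map, Finset.mul_sum]
    refine Finset.sum_le_sum fun j hj => ?_
    have h1 := hA j hj
    simp only [Equiv.coe_toEmbedding, Equiv.subRight_apply, Int.cast_sub]
    rw [show τ + ((j:ℝ) - k) * ϖ = θ + j * ϖ by rw [hτ]; ring, ← mul_assoc, ← Real.exp_add]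
    have h2 : 0 ≤ 1 / 2 + -((j:ℝ) - k) ^ 2 / (2 * M ^ 2) := by
      have : ((j:ℝ) - k) ^ 2 ≤ M ^ 2 := by rw [← sq_abs]; gcongr
      have h3 : ((j:ℝ) - k) ^ 2 / (2 * M ^ 2) ≤ 1 / 2 := by rw [div_le_iff₀ (by positivity)]; linarith
      rw [neg_div]
      linarith
    have h3 := Real.one_le_exp h2
    nlinarith [sq_nonneg ‖dirPoly X (θ + j * ϖ)‖]
  have hsum := (sum_le_hasSum (A.map (Equiv.subRight k).toEmbedding) (fun i _ => by positivity) hR).trans hFle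
  have hB : 0 ≤ log X + (C + 1) + 2 * (offSum (M * ϖ) X τ).re := by
    have h0 : 0 ≤ M * √(2 * π) * (F + C) := le_trans (Finset.sum_nonneg fun i _ => by positivity) hsum
    have h1 : 0 < M * √(2 * π) := by positivity
    have h2 : 0 ≤ F + C := nonneg_of_mul_nonneg_right h0 h1
    linarith
  have hnum : rexp (1 / 2) * √(2 * π) ≤ 5 := by
    have h1 : rexp (1 / 2) * √(2 * π) = √(rexp 1 * (2 * π)) := by
      rw [Real.sqrt_mul (Real.exp_pos _).le, ← Real.exp_half]
    rw [h1, Real.sqrt_le_left (by norm_num)]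
    nlinarith [Real.exp_one_lt_d9, Real.pi_lt_d2, Real.pi_pos, Real.exp_pos 1]
  calc _ ≤ rexp (1 / 2) * (M * √(2 * π) * (F + C)) := hA'.trans (by gcongr)
    _ ≤ rexp (1 / 2) * (M * √(2 * π) * (log X + (C + 1) + 2 * (offSum (M * ϖ) X τ).re)) := by
        refine mul_le_mul_of_nonneg_left (mul_le_mul_of_nonneg_left (by linarith) (by positivity)) (by positivity)
    _ = rexp (1 / 2) * √(2 * π) * M * (log X + (C + 1) + 2 * (offSum (M * ϖ) X τ).re) := by ring
    _ ≤ _ := by gcongr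

end gaussGrid

section offDiagonal

lemma meanBound_mul_le {R U T T0 G L g : ℝ} (hR : R ≤ R ^ 2) (hR0 : 0 ≤ R) (hU : 1 ≤ U) (hT : 1 ≤ T)
    (hUT : U ≤ 9 * T) (hT0 : 0 ≤ T0) (hT03 : T0 ≤ 3 * T) (hG : 1 ≤ G) (hT0G : T0 ≤ 3 * G ^ 3) (hL : 1 ≤ L)
    (hg : 1 ≤ g) (hGU : G ≤ U * g) :
    meanBound R U T T0 G L * ((1 + T / U ^ 2) / U ^ 2) ≤ 73000 * L * g ^ 3 * (R ^ 2 + R * T / G ^ 3) := by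
  have hU0 : 0 < U := by linarith
  have hG0 : 0 < G := by linarith
  have hT' : 0 < T := by linarith
  have hg3 : 1 ≤ g ^ 3 := one_le_pow₀ hg
  have hinv : 1 / U ≤ g / G := by rw [div_le_div_iff₀ hU0 hG0]; linarith
  have i1 : 1 / U ≤ 1 := by rw [div_le_one hU0]; exact hU
  have i2 : T / U ^ 3 ≤ g ^ 3 * (T / G ^ 3) := by
    calc T / U ^ 3 = T * (1 / U) ^ 3 := by field_simp
      _ ≤ T * (g / G) ^ 3 := by gcongr
      _ = _ := by field_simp
  have i3 : T / (G * U ^ 2) ≤ g ^ 3 * (T / G ^ 3) := by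
    calc T / (G * U ^ 2) = T / G * (1 / U) ^ 2 := by field_simp
      _ ≤ T / G * (g / G) ^ 2 := by gcongr
      _ = g ^ 2 * (T / G ^ 3) := by field_simp
      _ ≤ _ := by gcongr; norm_num
  have i4 : 1 / G ≤ 1 := by rw [div_le_one hG0]; exact hG
  have i5 : √(U * T0) / T ≤ 6 := by
    rw [div_le_iff₀ hT', Real.sqrt_le_left (by positivity)]
    nlinarith [mul_le_mul hUT hT03 hT0 (by positivity)]
  have i6 : √(U * T0) / U ^ 2 ≤ 2 * g ^ 3 := by
    rw [div_le_iff₀ (by positivity), Real.sqrt_le_left (by positivity)]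
    have h1 : G ^ 3 ≤ (U * g) ^ 3 := by gcongr
    calc U * T0 ≤ U * (3 * (U * g) ^ 3) := by gcongr; linarith
      _ = 3 * U ^ 4 * (g ^ 3 * 1) := by ring
      _ ≤ 4 * U ^ 4 * (g ^ 3 * g ^ 3) := by gcongr; norm_num
      _ = _ := by ring
  have i7 : U / T ≤ 9 := by rw [div_le_iff₀ hT']; linarith
  have e : meanBound R U T T0 G L * ((1 + T / U ^ 2) / U ^ 2) =
      3 * R * (1 / U + T / U ^ 3) + 227 * R * L * (1 / G + T / (G * U ^ 2)) +
      4000 * R ^ 2 * L * (U / T + 1 / U + (√(U * T0) / T + √(U * T0) / U ^ 2)) := by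
    unfold meanBound
    field_simp
  rw [e]
  set q := T / G ^ 3 with hq
  have hq0 : 0 ≤ q := by positivity
  have hRq : R * T / G ^ 3 = R * q := by rw [hq]; ring
  rw [hRq]
  have hLg : 1 ≤ L * g ^ 3 := by nlinarith
  have hLgL : L ≤ L * g ^ 3 := by nlinarith
  calc _ ≤ 3 * R * (1 + g ^ 3 * q) + 227 * R * L * (1 + g ^ 3 * q) +
        4000 * R ^ 2 * L * (9 + 1 + (6 + 2 * g ^ 3)) := by gcongr
    _ ≤ 3 * (L * g ^ 3 * R ^ 2 + L * g ^ 3 * (R * q)) + 227 * (L * g ^ 3 * R ^ 2 + L * g ^ 3 * (R * q)) +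
        4000 * (18 * (L * g ^ 3 * R ^ 2)) := by
        have a1 : R ≤ L * g ^ 3 * R ^ 2 := by nlinarith [sq_nonneg R]
        have a2 : g ^ 3 * (R * q) ≤ L * g ^ 3 * (R * q) := by
          have : 0 ≤ R * q := by positivity
          have : 0 ≤ g ^ 3 * (R * q) := by positivity
          nlinarith
        have a3 : R * L ≤ L * g ^ 3 * R ^ 2 := by
          calc R * L ≤ R ^ 2 * (L * g ^ 3) := by gcongr
            _ = _ := by ring
        have a4 : R ^ 2 * L ≤ L * g ^ 3 * R ^ 2 := by
          calc R ^ 2 * L ≤ R ^ 2 * (L * g ^ 3) := by gcongr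
            _ = _ := by ring
        linarith
    _ ≤ _ := by
        have : 0 ≤ L * g ^ 3 * R ^ 2 := by positivity
        have : 0 ≤ L * g ^ 3 * (R * q) := by positivity
        linarith

/-- The sum of `oscSum` over the points `n / h` that occur in `offSum`. -/
noncomputable def gridSum (X : ℕ) (S : Finset ℤ) (t : ℤ → ℝ) (b : ℝ → ℝ) : ℂ :=
  ∑ h ∈ Finset.Icc 1 X, (1 / h : ℂ) * ∑ n ∈ Finset.Icc 1 (X - 1 - h), oscSum S 1 t b ((n:ℝ) / h)

lemma sum_offSum (G : ℝ) (X : ℕ) (S : Finset ℤ) (t : ℤ → ℝ) :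
    ∑ c ∈ S, offSum G X (t c) = gridSum X S t (gaussAmp G) := by
  simp only [offSum, gridSum, oscSum, Pi.one_apply, one_mul]
  rw [Finset.sum_comm]
  refine Finset.sum_congr rfl fun h _ => ?_
  rw [← Finset.mul_sum, Finset.sum_comm]

lemma norm_oscSum_le (S : Finset ℤ) (t : ℤ → ℝ) (b : ℝ → ℝ) (x : ℝ) :
    ‖oscSum S 1 t b x‖ ≤ S.card * |b x| := by
  rw [oscSum]
  refine (norm_sum_le _ _).trans ?_
  simp [norm_oscAmp]

set_option maxHeartbeats 1000000 in
lemma exists_norm_gridSum_le {δ : ℝ} (hδ : 0 < δ) (hδ1 : δ ≤ 1 / 3) :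
    ∃ C : ℝ, 1 ≤ C ∧ ∀ {U : ℝ} {b b' : ℝ → ℝ} {S : Finset ℤ} {t : ℤ → ℝ} {T T0 G L : ℝ} {X : ℕ},
      IsAmp U b b' → 1 ≤ U → U < X → 8 * T ≤ X → X ≤ 9 * T → IsFreq S t T T0 G L → 1 + log (6 * X) ≤ L →
      1 ≤ G → G ≤ U * T ^ δ → 0 ≤ T0 → T0 ≤ 3 * T → T0 ≤ 3 * G ^ 3 →
      ‖gridSum X S t b‖ ≤ C * U * (L * T ^ (3 * δ) * (S.card + √(S.card * T / G ^ 3))) := by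
  obtain ⟨C, hC1, hC⟩ := exists_norm_sum_oscSum_le hδ hδ1
  refine ⟨1620 + 376 + C * 1700, by linarith, ?_⟩
  intro U b b' S t T T0 G L X hb hU hUX hX8 hX9 hF hL hG hGU hT0 hT03 hT0G
  have hT := hF.pos
  have hX0 : (0:ℝ) < X := by linarith
  have hX1 : 1 ≤ X := by exact_mod_cast hX0
  set R : ℝ := (S.card : ℝ) with hRdef
  have hR0 : 0 ≤ R := by positivity
  have hR2 : R ≤ R ^ 2 := by
    rw [hRdef]
    exact_mod_cast Nat.le_self_pow two_ne_zero _
  have hL1 : 1 ≤ L := by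
    have : 0 ≤ log (6 * X) := log_nonneg (by linarith)
    linarith
  have hT0' : 0 < T := by linarith
  set g := T ^ δ with hg
  have hg1 : 1 ≤ g := Real.one_le_rpow hT hδ.le
  have hg3 : T ^ (3 * δ) = g ^ 3 := by
    rw [hg, ← Real.rpow_natCast, ← Real.rpow_mul hT0'.le]; congr 1; push_cast; ring
  have hgg : 1 ≤ g ^ 3 := one_le_pow₀ hg1
  have hharm : ∀ m : ℕ, (m:ℝ) ≤ 6 * X → ∑ j ∈ Finset.Icc 1 m, 1 / (j:ℝ) ≤ L := by
    intro m hm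
    rcases Nat.eq_zero_or_pos m with rfl | hm0
    · simp; linarith
    have h2 := harmonic_le_one_add_log m
    rw [harmonic_eq_sum_Icc] at h2
    push_cast at h2
    simp_rw [one_div]
    have : log (m:ℝ) ≤ log (6 * X) := log_le_log (by exact_mod_cast hm0) hm
    linarith
  -- the number of complete sums
  set Y : ℕ := ⌈(X:ℝ) / (4 * U + 1)⌉₊ - 1 with hY
  have hYX : Y ≤ X := by
    have : ⌈(X:ℝ) / (4 * U + 1)⌉₊ ≤ X := by
      rw [Nat.ceil_le, div_le_iff₀ (by linarith)]
      nlinarith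
    omega
  have hYlt : ∀ h, h ≤ Y → 1 ≤ h → (h:ℝ) * (4 * U + 1) < X := by
    intro h hh hh1
    have : h < ⌈(X:ℝ) / (4 * U + 1)⌉₊ := by omega
    rwa [Nat.lt_ceil, lt_div_iff₀ (by linarith)] at this
  have hYge : ∀ h, Y < h → (X:ℝ) ≤ h * (4 * U + 1) := by
    intro h hh
    have : ⌈(X:ℝ) / (4 * U + 1)⌉₊ ≤ h := by omega
    rwa [Nat.ceil_le, div_le_iff₀ (by linarith)] at this
  have hYU : (Y:ℝ) * U ≤ 9 / 4 * T := by
    rcases Nat.eq_zero_or_pos Y with h0 | h0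
    · rw [h0]; simp; linarith
    · have := hYlt Y le_rfl h0
      have hY0 : (0:ℝ) ≤ Y := by positivity
      linarith
  set N : ℕ := ⌊4 * U⌋₊ + 1 with hN
  have hN1 : 4 * U < N := by rw [hN]; push_cast; exact Nat.lt_floor_add_one _
  have hN2 : (N:ℝ) ≤ 6 * U := by
    rw [hN]; push_cast
    linarith [Nat.floor_le (by linarith : 0 ≤ 4 * U)]
  set K : ℝ := 1 + T / U ^ 2 with hK
  have hK1 : 1 ≤ K := by rw [hK]; have : 0 ≤ T / U ^ 2 := by positivity
                         linarith
  have hKT : T / U ^ 2 ≤ K := by rw [hK]; linarith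
  have hmain := hC hb hU hF hN1 hN2 (hharm N (by linarith)) hK1 hKT Y (fun h => N * h + X)
    (fun h _ => Nat.le_add_right _ _)
  have hsplit : gridSum X S t b =
      ∑ h ∈ Finset.Icc 1 Y, (1 / h : ℂ) * ∑ n ∈ Finset.Icc 1 (N * h + X), oscSum S 1 t b (n / h) +
      ∑ h ∈ Finset.Icc (Y + 1) X, (1 / h : ℂ) * ∑ n ∈ Finset.Icc 1 (X - 1 - h), oscSum S 1 t b (n / h) := by
    have h1 : Finset.Icc 1 X = Finset.Icc 1 Y ∪ Finset.Icc (Y + 1) X := by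
      ext i; simp only [Finset.mem_union, Finset.mem_Icc]; omega
    rw [gridSum, h1, Finset.sum_union]
    · congr 1
      refine Finset.sum_congr rfl fun h hh => ?_
      rw [Finset.mem_Icc] at hh
      congr 1
      refine Finset.sum_subset ?_ ?_
      · intro n; simp only [Finset.mem_Icc]; omega
      · intro n hn1 hn2
        refine oscSum_eq_zero (hb.supp _ fun hmem => ?_)
        have h2 := hmem.2
        have hh0 : (0:ℝ) < h := by exact_mod_cast hh.1
        rw [div_le_iff₀ hh0] at h2
        have h3 := hYlt h hh.2 hh.1
        have h4 : X ≤ n + h := by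
          simp only [Finset.mem_Icc] at hn1 hn2
          omega
        have h5 : (X:ℝ) ≤ n + h := by exact_mod_cast h4
        linarith
    · rw [Finset.disjoint_left]; intro i; simp only [Finset.mem_Icc]; omega
  have hedge : ‖∑ h ∈ Finset.Icc (Y + 1) X, (1 / h : ℂ) * ∑ n ∈ Finset.Icc 1 (X - 1 - h), oscSum S 1 t b (n / h)‖
      ≤ 1620 * U * (L * R) := by
    calc _ ≤ ∑ h ∈ Finset.Icc (Y + 1) X, (1 / h : ℝ) * (R * (1620 * U)) := by
          refine norm_sum_le_of_le _ fun h hh => ?_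
          rw [Finset.mem_Icc] at hh
          rw [norm_mul]
          have e1 : ‖(1 / h : ℂ)‖ = 1 / h := by simp
          rw [e1]
          gcongr
          simp only [oscSum, Pi.one_apply, one_mul]
          rw [Finset.sum_comm]
          refine (norm_sum_le_of_le _ fun c hc => norm_edge_sum_le hb hU hT (hF.lower c hc) (hF.upper c hc)
            hX8 hX9 (by omega) (hYge h (by omega)) ?_).trans_eq ?_
          · have : X - 1 - h + h ≤ X := by omega
            exact_mod_cast this
          · simp [hRdef]
      _ = (∑ h ∈ Finset.Icc (Y + 1) X, (1 / h : ℝ)) * (R * (1620 * U)) := by rw [Finset.sum_mul]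
      _ ≤ L * (R * (1620 * U)) := by
          gcongr
          refine le_trans (Finset.sum_le_sum_of_subset_of_nonneg ?_ fun _ _ _ => by positivity) (hharm X (by linarith))
          intro i; simp only [Finset.mem_Icc]; omega
      _ = _ := by ring
  have hfull : (Y:ℝ) * (167 * R * U ^ 2 / T) ≤ 376 * U * R := by
    calc (Y:ℝ) * (167 * R * U ^ 2 / T) = (Y * U) * (167 * R * U / T) := by ring
      _ ≤ 9 / 4 * T * (167 * R * U / T) := by gcongr
      _ = 9 / 4 * 167 * (U * R) := by field_simp
      _ ≤ _ := by have : 0 ≤ U * R := by positivity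
                  linarith
  have hmB := meanBound_mul_le hR2 hR0 hU hT (by linarith : U ≤ 9 * T) hT0 hT03 hG hT0G hL1 hg1 hGU
  rw [← hK] at hmB
  set Q : ℝ := R ^ 2 + R * T / G ^ 3 with hQ
  have hQ0 : 0 ≤ Q := by have : 0 < G := by linarith
                         positivity
  have hKg : K ^ (3 * δ) ≤ 2 * g ^ 3 := by
    have h1 : K ≤ 2 * T := by
      have : T / U ^ 2 ≤ T := div_le_self hT0'.le (one_le_pow₀ hU)
      rw [hK]; linarith
    calc K ^ (3 * δ) ≤ (2 * T) ^ (3 * δ) := by gcongr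
      _ = 2 ^ (3 * δ) * g ^ 3 := by rw [Real.mul_rpow (by norm_num) hT0'.le, hg3]
      _ ≤ 2 ^ (1:ℝ) * g ^ 3 := by gcongr <;> linarith
      _ = _ := by rw [Real.rpow_one]
  have hosc : K ^ ((1 + 3 * δ) / 2) * √(2 * (9 * meanBound R U T T0 G L + 2 * R ^ 2 / K ^ 2))
      ≤ U * (1700 * g ^ 3 * L * √Q) := by
    have hK0 : 0 < K := by linarith
    have e1 : K ^ ((1 + 3 * δ) / 2) = √(K * K ^ (3 * δ)) := by
      rw [Real.sqrt_eq_rpow, ← Real.rpow_one_add' hK0.le (by linarith), ← Real.rpow_mul hK0.le]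
      congr 1; ring
    rw [e1, ← Real.sqrt_mul (by positivity), Real.sqrt_le_left (by have : 0 < U := by linarith
                                                                   positivity)]
    have e2 : (U * (1700 * g ^ 3 * L * √Q)) ^ 2 = U ^ 2 * (1700 ^ 2 * (g ^ 3) ^ 2 * L ^ 2 * Q) := by
      rw [mul_pow, mul_pow, Real.sq_sqrt hQ0]; ring
    rw [e2]
    have h1 : K * (9 * meanBound R U T T0 G L + 2 * R ^ 2 / K ^ 2) ≤ U ^ 2 * (660000 * L * g ^ 3 * Q) := by
      have h2 : meanBound R U T T0 G L * K ≤ U ^ 2 * (73000 * L * g ^ 3 * Q) := by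
        rw [← mul_div_assoc, div_le_iff₀ (by positivity)] at hmB
        linarith
      have h3 : K * (2 * R ^ 2 / K ^ 2) ≤ 2 * R ^ 2 := by
        rw [show K * (2 * R ^ 2 / K ^ 2) = 2 * R ^ 2 / K by field_simp]
        exact div_le_self (by positivity) hK1
      have h4 : R ^ 2 ≤ Q := by
        rw [hQ]; have : 0 ≤ R * T / G ^ 3 := by have : 0 < G := by linarith
                                                positivity
        linarith
      have h5 : Q ≤ U ^ 2 * (L * g ^ 3 * Q) := by
        have h6 : 1 ≤ U ^ 2 * (L * g ^ 3) := by
          have := one_le_pow₀ hU (n := 2)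
          exact one_le_mul_of_one_le_of_one_le this (one_le_mul_of_one_le_of_one_le hL1 hgg)
        calc Q ≤ U ^ 2 * (L * g ^ 3) * Q := le_mul_of_one_le_left hQ0 h6
          _ = _ := by ring
      linarith
    calc K * K ^ (3 * δ) * (2 * (9 * meanBound R U T T0 G L + 2 * R ^ 2 / K ^ 2))
        = 2 * K ^ (3 * δ) * (K * (9 * meanBound R U T T0 G L + 2 * R ^ 2 / K ^ 2)) := by ring
      _ ≤ 2 * K ^ (3 * δ) * (U ^ 2 * (660000 * L * g ^ 3 * Q)) := by gcongr
      _ ≤ 2 * (2 * g ^ 3) * (U ^ 2 * (660000 * L * g ^ 3 * Q)) := by gcongr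
      _ = U ^ 2 * (2640000 * (g ^ 3) ^ 2 * L * Q) := by ring
      _ ≤ _ := by
          gcongr
          · norm_num
          · exact le_self_pow₀ hL1 two_ne_zero
  have hsq : √Q ≤ R + √(R * T / G ^ 3) := by
    have h1 : 0 ≤ R * T / G ^ 3 := by have : 0 < G := by linarith
                                      positivity
    rw [hQ, Real.sqrt_le_left (by positivity), add_sq, Real.sq_sqrt h1]
    have : 0 ≤ R * √(R * T / G ^ 3) := by positivity
    linarith
  rw [hsplit, hg3]
  set Z := R + √(R * T / G ^ 3) with hZ
  have hRZ : R ≤ Z := by rw [hZ]; have := Real.sqrt_nonneg (R * T / G ^ 3); linarith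
  have hU0 : 0 < U := by linarith
  refine (norm_add_le _ _).trans ((add_le_add hmain hedge).trans ?_)
  have hZ0 : 0 ≤ Z := hR0.trans hRZ
  have b1 : 1620 * U * (L * R) ≤ 1620 * U * (L * g ^ 3 * Z) := by
    have : L * R ≤ L * g ^ 3 * Z := by
      calc L * R ≤ L * Z := by gcongr
        _ = L * 1 * Z := by ring
        _ ≤ _ := by gcongr
    gcongr
  have b2 : 376 * U * R ≤ 376 * U * (L * g ^ 3 * Z) := by
    have : R ≤ L * g ^ 3 * Z := by
      calc R ≤ Z := hRZ
        _ = 1 * Z := by ring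
        _ ≤ _ := by gcongr; exact one_le_mul_of_one_le_of_one_le hL1 hgg
    gcongr
  have b3 : C * K ^ ((1 + 3 * δ) / 2) * √(2 * (9 * meanBound R U T T0 G L + 2 * R ^ 2 / K ^ 2))
      ≤ C * 1700 * U * (L * g ^ 3 * Z) := by
    calc _ = C * (K ^ ((1 + 3 * δ) / 2) * √(2 * (9 * meanBound R U T T0 G L + 2 * R ^ 2 / K ^ 2))) := by ring
      _ ≤ C * (U * (1700 * g ^ 3 * L * √Q)) := by gcongr
      _ ≤ C * (U * (1700 * g ^ 3 * L * Z)) := by gcongr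
      _ = _ := by ring
  linarith

end offDiagonal

section offDiagonalTotal

lemma gridSum_eq_add_sum {X : ℕ} {S : Finset ℤ} {t : ℤ → ℝ} {b b₀ : ℝ → ℝ} {k : ℕ} {B : ℕ → ℝ → ℝ}
    (h : ∀ n h : ℕ, 1 ≤ n → 1 ≤ h → n ≤ X →
      b ((n:ℝ) / h) = b₀ ((n:ℝ) / h) + ∑ i ∈ Finset.range k, B i ((n:ℝ) / h)) :
    gridSum X S t b = gridSum X S t b₀ + ∑ i ∈ Finset.range k, gridSum X S t (B i) := by
  unfold gridSum
  rw [Finset.sum_comm, ← Finset.sum_add_distrib]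
  refine Finset.sum_congr rfl fun j hj => ?_
  rw [← Finset.mul_sum, Finset.sum_comm, ← mul_add, ← Finset.sum_add_distrib]
  congr 1
  refine Finset.sum_congr rfl fun n hn => ?_
  rw [Finset.mem_Icc] at hj hn
  unfold oscSum
  rw [Finset.sum_comm, ← Finset.sum_add_distrib]
  refine Finset.sum_congr rfl fun r _ => ?_
  rw [← Finset.mul_sum, ← mul_add]
  unfold oscAmp
  rw [← Finset.sum_mul, ← add_mul, h n j hn.1 hj.1 (by omega)]
  push_cast
  rfl

lemma gridSum_const_mul (X : ℕ) (S : Finset ℤ) (t : ℤ → ℝ) (a : ℝ) (b : ℝ → ℝ) :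
    gridSum X S t (fun u => a * b u) = a * gridSum X S t b := by
  simp only [gridSum, oscSum, oscAmp, Finset.mul_sum, Complex.ofReal_mul]
  refine Finset.sum_congr rfl fun _ _ => Finset.sum_congr rfl fun _ _ => Finset.sum_congr rfl fun _ _ => ?_
  ring

lemma gridSum_eq_zero {X : ℕ} {S : Finset ℤ} {t : ℤ → ℝ} {b : ℝ → ℝ} (h : ∀ u < (X:ℝ), b u = 0) :
    gridSum X S t b = 0 := by
  unfold gridSum
  refine Finset.sum_eq_zero fun j hj => ?_
  rw [Finset.sum_eq_zero, mul_zero]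
  intro n hn
  rw [Finset.mem_Icc] at hj hn
  refine oscSum_eq_zero (h _ ?_)
  have h1 : (1:ℝ) ≤ j := by exact_mod_cast hj.1
  have h2 : (n:ℝ) < X := by exact_mod_cast (by omega : n < X)
  exact (div_le_self (by positivity) h1).trans_lt h2

lemma natCast_clog_le {X : ℕ} (hX : 1 < X) : (Nat.clog 2 X : ℝ) ≤ 1 + 2 * log X := by
  have h1 := Nat.pow_pred_clog_lt_self one_lt_two hX
  have hk1 : 1 ≤ Nat.clog 2 X := Nat.clog_pos one_lt_two hX
  obtain ⟨j, hj⟩ : ∃ j, Nat.clog 2 X = j + 1 := ⟨Nat.clog 2 X - 1, by omega⟩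
  rw [hj, Nat.pred_succ] at h1
  have h2 : (2:ℝ) ^ j ≤ X := by exact_mod_cast h1.le
  have h3 := log_le_log (by positivity) h2
  rw [log_pow] at h3
  have h5 := Real.log_two_gt_d9
  have h6 : (0:ℝ) ≤ j := by positivity
  rw [hj]
  push_cast
  nlinarith

lemma eventually_log_le {δ : ℝ} (hδ : 0 < δ) (a b : ℝ) : ∀ᶠ T : ℝ in Filter.atTop, a + b * log T ≤ T ^ δ := by
  have h1 := (isLittleO_log_rpow_atTop hδ).bound (c := 1 / (2 * (|b| + 1))) (by positivity)
  have h2 := (tendsto_rpow_atTop hδ).eventually_ge_atTop (2 * |a|)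
  filter_upwards [h1, h2, Filter.eventually_ge_atTop 1] with T h1 h2 h3
  have hp : 0 ≤ T ^ δ := by positivity
  rw [Real.norm_of_nonneg (log_nonneg h3), Real.norm_of_nonneg hp] at h1
  have h4 : |b| * log T ≤ T ^ δ / 2 := by
    calc |b| * log T ≤ (|b| + 1) * (1 / (2 * (|b| + 1)) * T ^ δ) := by
          gcongr
          · exact log_nonneg h3
          · linarith
      _ = _ := by have : |b| + 1 ≠ 0 := by positivity
                  field_simp
  have h5 : b * log T ≤ |b| * log T := by
    gcongr
    · exact log_nonneg h3
    · exact le_abs_self b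
  linarith [le_abs_self a]

lemma eventually_sq_mul_exp_le {δ : ℝ} (hδ : 0 < δ) :
    ∀ᶠ T : ℝ in Filter.atTop, (9 * T) ^ 2 * rexp (-(T ^ δ) ^ 2 / 18) ≤ 1 := by
  have h1 := (tendsto_rpow_mul_exp_neg_mul_atTop_nhds_zero (1 / δ) (1 / 18) (by norm_num)).comp
    (tendsto_rpow_atTop (by linarith : 0 < 2 * δ))
  have h2 := h1.eventually (gt_mem_nhds (by norm_num : (0:ℝ) < 1 / 81))
  filter_upwards [h2, Filter.eventually_ge_atTop 1] with T h2 h3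
  have hT0 : 0 < T := by linarith
  simp only [Function.comp_apply] at h2
  have e1 : (T ^ (2 * δ)) ^ (1 / δ) = T ^ 2 := by
    rw [← Real.rpow_mul hT0.le, ← Real.rpow_natCast]
    congr 1
    push_cast
    field_simp
  have e2 : T ^ (2 * δ) = (T ^ δ) ^ 2 := by
    rw [← Real.rpow_natCast, ← Real.rpow_mul hT0.le]
    congr 1
    push_cast
    ring
  rw [e1, e2, show -(1 / 18) * (T ^ δ) ^ 2 = -(T ^ δ) ^ 2 / 18 by ring] at h2
  nlinarith

set_option maxHeartbeats 1000000 in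
lemma exists_norm_sum_offSum_le {δ : ℝ} (hδ : 0 < δ) (hδ1 : δ ≤ 1 / 3) :
    ∃ C : ℝ, 1 ≤ C ∧ ∀ᶠ T : ℝ in Filter.atTop, ∀ {S : Finset ℤ} {t : ℤ → ℝ} {T0 G : ℝ} {X : ℕ},
      8 * T ≤ X → X ≤ 9 * T → IsFreq S t T T0 G (T ^ δ) → (T ^ δ) ^ 2 ≤ G → 0 ≤ T0 → T0 ≤ 3 * T →
      T0 ≤ 3 * G ^ 3 →
      ‖∑ c ∈ S, offSum G X (t c)‖ ≤ C * (T ^ δ) ^ 5 * (S.card + √(S.card * T / G ^ 3)) := by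
  obtain ⟨C₁, hC₁, hblock⟩ := exists_norm_gridSum_le hδ hδ1
  obtain ⟨C₂, hC₂, hamp⟩ := exists_isAmp_gaussAmp
  refine ⟨1 + 2 * (C₂ * C₁), by nlinarith, ?_⟩
  filter_upwards [eventually_log_le hδ (1 + log 54) 1, eventually_sq_mul_exp_le hδ,
    Filter.eventually_ge_atTop 1] with T hlog hexp hT S t T0 G X hX8 hX9 hF hG hT0 hT03 hT0G
  have hT' : 0 < T := by linarith
  set g := T ^ δ with hg
  have hg1 : 1 ≤ g := Real.one_le_rpow hT hδ.le
  have hg0 : 0 < g := by linarith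
  have hG1 : 1 ≤ G := le_trans (one_le_pow₀ hg1) hG
  have hG0 : 0 < G := by linarith
  have hX0 : (0:ℝ) < X := by linarith
  have hlogX : 1 + log (6 * X) ≤ g := by
    have h1 : log (6 * X) ≤ log (54 * T) := log_le_log (by positivity) (by linarith)
    rw [log_mul (by norm_num) hT'.ne'] at h1
    linarith
  set U0 := G / g with hU0
  have hU01 : 1 ≤ U0 := by rw [hU0, le_div_iff₀ hg0]; nlinarith
  set R : ℝ := (S.card : ℝ) with hR
  have hR0 : 0 ≤ R := by positivity
  set Z := R + √(R * T / G ^ 3) with hZ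
  have hRZ : R ≤ Z := by rw [hZ]; have := Real.sqrt_nonneg (R * T / G ^ 3); linarith
  have hZ0 : 0 ≤ Z := hR0.trans hRZ
  set k := Nat.clog 2 X with hk
  have hXk : (X:ℝ) ≤ 2 ^ k := by exact_mod_cast Nat.le_pow_clog one_lt_two X
  have hkg : (k:ℝ) ≤ 2 * g := by
    have hX2 : 1 < X := by
      have : (1:ℝ) < X := by linarith
      exact_mod_cast this
    have h4 : log (X:ℝ) ≤ log (6 * X) := log_le_log hX0 (by linarith)
    linarith [natCast_clog_le hX2]
  set b₀ : ℝ → ℝ := fun u => gaussAmp G u * (1 - cutoff (u / U0)) with hb₀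
  set B : ℕ → ℝ → ℝ := fun i u => gaussAmp G u * bump (u / (U0 * 2 ^ i)) with hB
  have hdec : gridSum X S t (gaussAmp G) = gridSum X S t b₀ + ∑ i ∈ Finset.range k, gridSum X S t (B i) := by
    refine gridSum_eq_add_sum fun n h hn hh hnX => ?_
    have h1 : (1:ℝ) ≤ h := by exact_mod_cast hh
    have h2 : (n:ℝ) ≤ X := by exact_mod_cast hnX
    have h3 : (n:ℝ) / h / U0 ≤ 2 ^ k :=
      ((div_le_self (by positivity) hU01).trans (div_le_self (by positivity) h1)).trans (h2.trans hXk)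
    simp only [hb₀, hB]
    rw [← Finset.mul_sum, ← mul_add]
    simp_rw [← div_div _ U0]
    rw [sum_bump _ _ h3]
    ring
  have hb₀le : ‖gridSum X S t b₀‖ ≤ R := by
    have hpt : ∀ n h : ℕ, 1 ≤ n → 1 ≤ h → |b₀ ((n:ℝ) / h)| ≤ h * rexp (-g ^ 2 / 18) := by
      intro n h hn hh
      have h1 : (1:ℝ) ≤ h := by exact_mod_cast hh
      have h2 : (1:ℝ) ≤ n := by exact_mod_cast hn
      set u : ℝ := (n:ℝ) / h with hu
      have hu0 : 0 < u := by positivity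
      have h1u : 1 / u ≤ h := by
        rw [hu, one_div_div]; exact div_le_self (by linarith) h2
      rcases le_or_gt (2 * U0) u with h3 | h3
      · have : cutoff (u / U0) = 1 := cutoff_eq_one (by rw [le_div_iff₀ (by linarith)]; exact h3)
        simp only [hb₀, this, sub_self, mul_zero, abs_zero]
        positivity
      · have h4 : |1 - cutoff (u / U0)| ≤ 1 := by
          rw [abs_le]
          constructor <;> linarith [cutoff_nonneg (u / U0), cutoff_le_one (u / U0)]
        have h5 : g / 3 ≤ G * phi u := by
          have h6 := one_div_add_one_le_phi hu0
          have h7 : 1 / (3 * U0) ≤ phi u := le_trans (by gcongr; linarith) h6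
          calc g / 3 = G * (1 / (3 * U0)) := by rw [hU0]; field_simp
            _ ≤ _ := by gcongr
        have h8 : |gaussAmp G u| ≤ h * rexp (-g ^ 2 / 18) := by
          rw [abs_of_nonneg (gaussAmp_nonneg _ _), gaussAmp]
          have h9 : rexp (-(G * phi u) ^ 2 / 2) ≤ rexp (-g ^ 2 / 18) := by
            refine Real.exp_le_exp.2 ?_
            nlinarith
          have h10 : (√(u * (u + 1)))⁻¹ ≤ h := by
            refine le_trans ?_ h1u
            rw [one_div]
            gcongr
            exact Real.le_sqrt_of_sq_le (by nlinarith)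
          gcongr
        calc |b₀ u| = |gaussAmp G u| * |1 - cutoff (u / U0)| := by simp only [hb₀]; rw [abs_mul]
          _ ≤ h * rexp (-g ^ 2 / 18) * 1 := by gcongr
          _ = _ := by ring
    calc ‖gridSum X S t b₀‖ ≤ ∑ h ∈ Finset.Icc 1 X, (X:ℝ) * (R * rexp (-g ^ 2 / 18)) := by
          unfold gridSum
          refine norm_sum_le_of_le _ fun h hh => ?_
          rw [Finset.mem_Icc] at hh
          have hh0 : (0:ℝ) < h := by exact_mod_cast hh.1
          rw [norm_mul]
          have e1 : ‖(1 / h : ℂ)‖ = 1 / h := by simp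
          rw [e1, div_mul_eq_mul_div, one_mul, div_le_iff₀ hh0]
          calc _ ≤ ∑ n ∈ Finset.Icc 1 (X - 1 - h), R * (h * rexp (-g ^ 2 / 18)) := by
                refine norm_sum_le_of_le _ fun n hn => ?_
                rw [Finset.mem_Icc] at hn
                refine (norm_oscSum_le S t b₀ _).trans ?_
                gcongr
                exact hpt n h hn.1 hh.1
            _ = ((X - 1 - h : ℕ) : ℝ) * (R * (h * rexp (-g ^ 2 / 18))) := by simp
            _ ≤ (X:ℝ) * (R * (h * rexp (-g ^ 2 / 18))) := by
                gcongr
                omega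
            _ = _ := by ring
      _ = R * ((X:ℝ) ^ 2 * rexp (-g ^ 2 / 18)) := by simp; ring
      _ ≤ R * ((9 * T) ^ 2 * rexp (-g ^ 2 / 18)) := by gcongr
      _ ≤ R * 1 := by gcongr
      _ = R := mul_one R
  have hBle : ∀ i, ‖gridSum X S t (B i)‖ ≤ C₂ * C₁ * (g ^ 4 * Z) := by
    intro i
    set U := U0 * 2 ^ i with hU
    have hU0U : U0 ≤ U := by
      rw [hU]
      exact le_mul_of_one_le_right (by linarith) (one_le_pow₀ one_le_two)
    have hU1 : 1 ≤ U := hU01.trans hU0U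
    rcases lt_or_ge U (X:ℝ) with hUX | hUX
    · obtain ⟨b', hb'⟩ := hamp G U hU1
      have h1 := hblock hb' hU1 hUX hX8 hX9 hF hlogX hG1 (by
        rw [← hg]
        calc G = U0 * g := by rw [hU0]; field_simp
          _ ≤ U * g := by gcongr) hT0 hT03 hT0G
      rw [gridSum_const_mul, norm_mul, Complex.norm_real, Real.norm_of_nonneg (by positivity)] at h1
      have hg3 : T ^ (3 * δ) = g ^ 3 := by
        rw [hg, ← Real.rpow_natCast, ← Real.rpow_mul hT'.le]; congr 1; push_cast; ring
      rw [hg3, div_mul_eq_mul_div, div_le_iff₀ (by linarith)] at h1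
      have h2 : U * ‖gridSum X S t (B i)‖ ≤ U * (C₂ * C₁ * (g ^ 4 * Z)) := by
        refine h1.trans_eq ?_
        ring
      exact le_of_mul_le_mul_left h2 (by linarith)
    · have : gridSum X S t (B i) = 0 := gridSum_eq_zero fun u hu => by
        simp only [hB]
        rw [bump_eq_zero, mul_zero]
        exact fun h => absurd h.1 (not_le.2 ((div_lt_one (by linarith)).2 (hu.trans_le hUX)))
      rw [this, norm_zero]
      positivity
  rw [sum_offSum, hdec]
  have hg5 : 1 ≤ g ^ 5 := one_le_pow₀ hg1
  calc _ ≤ R + ∑ i ∈ Finset.range k, C₂ * C₁ * (g ^ 4 * Z) :=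
        (norm_add_le _ _).trans (add_le_add hb₀le (norm_sum_le_of_le _ fun i _ => hBle i))
    _ = R + k * (C₂ * C₁ * (g ^ 4 * Z)) := by simp
    _ ≤ g ^ 5 * Z + 2 * g * (C₂ * C₁ * (g ^ 4 * Z)) := by
        gcongr
        exact hRZ.trans (le_mul_of_one_le_left hZ0 hg5)
    _ = _ := by ring

end offDiagonalTotal

section largeValues

lemma sum_one_div_abs_sub_le {N : ℕ} {S : Finset ℤ} (hS : S ⊆ Finset.Ico 0 (N:ℤ)) {r : ℤ} (hr : r ∈ S) :
    ∑ s ∈ S.erase r, 1 / |(r:ℝ) - s| ≤ 2 * (1 + log N) := by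
  have hmaps : ∀ s ∈ S.erase r, (r - s).natAbs ∈ Finset.Icc 1 N := by
    intro s hs
    have h1 := Finset.mem_Ico.1 (hS (Finset.mem_of_mem_erase hs))
    have h2 := Finset.mem_Ico.1 (hS hr)
    have h3 := Finset.ne_of_mem_erase hs
    rw [Finset.mem_Icc]
    omega
  rw [← Finset.sum_fiberwise_of_maps_to hmaps]
  have hfib : ∀ d ∈ Finset.Icc 1 N, ∑ s ∈ S.erase r with (r - s).natAbs = d, 1 / |(r:ℝ) - s| ≤ 2 * (d:ℝ)⁻¹ := by
    intro d _
    calc ∑ s ∈ S.erase r with (r - s).natAbs = d, 1 / |(r:ℝ) - s|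
        = ∑ s ∈ S.erase r with (r - s).natAbs = d, (d:ℝ)⁻¹ := by
          refine Finset.sum_congr rfl fun s hs => ?_
          rw [← (Finset.mem_filter.1 hs).2, Nat.cast_natAbs, one_div]
          push_cast
          rfl
      _ = ((S.erase r).filter fun s => (r - s).natAbs = d).card * (d:ℝ)⁻¹ := by simp
      _ ≤ 2 * (d:ℝ)⁻¹ := by
          refine mul_le_mul_of_nonneg_right ?_ (by positivity)
          have hsub : ((S.erase r).filter fun s => (r - s).natAbs = d) ⊆ {r - d, r + d} := by
            intro s hs
            have := (Finset.mem_filter.1 hs).2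
            rw [Finset.mem_insert, Finset.mem_singleton]
            omega
          exact_mod_cast (Finset.card_le_card hsub).trans Finset.card_le_two
  refine (Finset.sum_le_sum hfib).trans ?_
  rw [← Finset.mul_sum]
  have h := harmonic_le_one_add_log N
  rw [harmonic_eq_sum_Icc] at h
  push_cast at h
  linarith

lemma isFreq_cells {T G τ ϖ : ℝ} {N M W : ℕ} {S : Finset ℤ} {w : ℤ} {L : ℝ} (hT : 1 ≤ T) (hM : 1 ≤ M)
    (hϖ : 0 < ϖ) (hG : G = M * ϖ) (hτ : 2 * T ≤ τ) (hS : S ⊆ Finset.Ico 0 (N:ℤ))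
    (hS4 : ∀ c ∈ S, τ + ((c * M : ℤ) : ℝ) * ϖ ≤ 4 * T) (hw : ∀ c ∈ S, c / (W:ℤ) = w) (hW : 1 ≤ W)
    (hL : 2 * (1 + log N) ≤ L) :
    IsFreq S (fun c => τ + ((c * M : ℤ) : ℝ) * ϖ) T (min (W * G) (2 * T)) G L := by
  have hM0 : (0:ℝ) < M := by exact_mod_cast hM
  have hG0 : 0 < G := by rw [hG]; positivity
  have hlow : ∀ c ∈ S, 2 * T ≤ τ + ((c * M : ℤ) : ℝ) * ϖ := by
    intro c hc
    have : (0:ℝ) ≤ ((c * M : ℤ) : ℝ) := by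
      have h0 := (Finset.mem_Ico.1 (hS hc)).1
      exact_mod_cast (by positivity : 0 ≤ c * (M:ℤ))
    have : 0 ≤ ((c * M : ℤ) : ℝ) * ϖ := by positivity
    linarith
  have hdiff : ∀ r s : ℤ, |(τ + ((r * M : ℤ) : ℝ) * ϖ) - (τ + ((s * M : ℤ) : ℝ) * ϖ)| = |(r:ℝ) - s| * G := by
    intro r s
    rw [hG]
    push_cast
    rw [show τ + (r:ℝ) * M * ϖ - (τ + (s:ℝ) * M * ϖ) = ((r:ℝ) - s) * (M * ϖ) by ring, abs_mul,
      abs_of_pos (by positivity : 0 < (M:ℝ) * ϖ)]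
  refine ⟨hT, fun r hr => by linarith [hlow r hr], hS4, fun r hr s hs => le_min ?_ ?_, ?_, ?_⟩
  · rw [hdiff]
    refine mul_le_mul_of_nonneg_right ?_ hG0.le
    have hW' : (0:ℤ) < W := by exact_mod_cast hW
    have h1 := hw r hr
    have h2 := hw s hs
    have h3 := Int.emod_add_mul_ediv r W
    have h4 := Int.emod_add_mul_ediv s W
    have h5 := Int.emod_nonneg r hW'.ne'
    have h6 := Int.emod_lt_of_pos r hW'
    have h7 := Int.emod_nonneg s hW'.ne'
    have h8 := Int.emod_lt_of_pos s hW'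
    rw [h1] at h3
    rw [h2] at h4
    have : |r - s| ≤ (W:ℤ) := by
      rw [abs_le]
      constructor <;> linarith
    exact_mod_cast this
  · rw [abs_le]
    have h1 := hlow r hr
    have h2 := hlow s hs
    have h3 := hS4 r hr
    have h4 := hS4 s hs
    constructor <;> linarith
  · intro r hr s hs hrs heq
    have h1 := hdiff r s
    rw [heq, sub_self, abs_zero] at h1
    have h2 : |(r:ℝ) - s| = 0 := by
      rcases mul_eq_zero.1 h1.symm with h | h
      · exact h
      · exact absurd h hG0.ne'
    rw [abs_eq_zero, sub_eq_zero] at h2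
    exact hrs (by exact_mod_cast h2)
  · intro r hr
    simp_rw [hdiff, ← div_div]
    rw [← Finset.sum_div]
    gcongr
    exact (sum_one_div_abs_sub_le hS hr).trans hL

set_option maxHeartbeats 1000000 in
lemma exists_card_window_le {δ : ℝ} (hδ : 0 < δ) (hδ1 : δ ≤ 1 / 3) :
    ∀ᶠ T : ℝ in Filter.atTop, ∀ {X N M W : ℕ} {ϖ τ V : ℝ} {w : ℤ} {K : Finset ℤ},
      8 * T ≤ X → X ≤ 9 * T → N * ϖ = 2 * T → (T ^ δ)⁻¹ ≤ ϖ → ϖ ≤ 2 * (T ^ δ)⁻¹ → 2 * T ≤ τ →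
      τ ≤ 2 * T + ϖ → (T ^ δ) ^ 3 ≤ M → 0 ≤ V → M * (T ^ δ) ^ 6 ≤ V ^ 2 → 1 ≤ W → W ≤ (M * ϖ) ^ 2 →
      K ⊆ Finset.Ico 0 (N:ℤ) → (∀ k ∈ K, V ≤ ‖dirPoly X (τ + k * ϖ)‖) → (∀ k ∈ K, k / (M:ℤ) / (W:ℤ) = w) →
      (K.card : ℝ) ≤ T / (M * ϖ) ^ 3 := by
  obtain ⟨C₁, hC₁, hoff⟩ := exists_norm_sum_offSum_le hδ hδ1
  obtain ⟨C₂, hC₂, hsq⟩ := exists_sum_sq_dirPoly_le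
  filter_upwards [hoff, eventually_log_le hδ (2 * log 9 + C₂ + 2 * log 2 + 2) 4,
    eventually_log_le hδ (30 * C₁) 0, Filter.eventually_ge_atTop 1]
    with T hoff hlog hgC hT X N M W ϖ τ V w K hX8 hX9 hNϖ hϖ1 hϖ2 hτ1 hτ2 hM hV hMV hW hWG hK hKV hKw
  have hT0 : 0 < T := by linarith
  have hgT : T ^ δ ≤ T := by
    calc T ^ δ ≤ T ^ (1:ℝ) := Real.rpow_le_rpow_of_exponent_le hT (by linarith)
      _ = T := Real.rpow_one T
  set g := T ^ δ with hg
  have hg30 : 30 * C₁ ≤ g := by linarith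
  have hg1 : 1 ≤ g := by linarith
  have hg0 : 0 < g := by linarith
  have hlog2 : 0 ≤ log 2 := log_nonneg one_le_two
  have hlogT : 0 ≤ log T := log_nonneg hT
  have hlog9 : 0 ≤ log 9 := log_nonneg (by norm_num)
  have hlogX : log X ≤ log 9 + log T := by
    rw [← log_mul (by norm_num) hT0.ne']
    exact log_le_log (by linarith) hX9
  have hϖ0 : 0 < ϖ := lt_of_lt_of_le (by positivity) hϖ1
  have hN0 : (0:ℝ) < N := by
    by_contra! h
    nlinarith
  have hNT : (N:ℝ) ≤ 2 * T ^ 2 := by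
    have h1 : (N:ℝ) * g⁻¹ ≤ 2 * T := by rw [← hNϖ]; gcongr
    rw [← div_eq_mul_inv, div_le_iff₀ hg0] at h1
    nlinarith
  have hlogN : log N ≤ log 2 + 2 * log T := by
    have := log_le_log hN0 hNT
    rwa [log_mul (by norm_num) (by positivity), log_pow, Nat.cast_ofNat] at this
  have hg3 : 1 ≤ g ^ 3 := one_le_pow₀ hg1
  have hgg3 : g ≤ g ^ 3 := le_self_pow₀ hg1 (by norm_num)
  have hM1 : (1:ℝ) ≤ M := hg3.trans hM
  have hM1' : 1 ≤ M := by exact_mod_cast hM1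
  set G := (M:ℝ) * ϖ with hG
  have hgG : g ^ 2 ≤ G := by
    calc g ^ 2 = g ^ 3 * g⁻¹ := by field_simp
      _ ≤ _ := by rw [hG]; gcongr
  have hG1 : 1 ≤ G := le_trans (one_le_pow₀ hg1) hgG
  have hG0 : 0 < G := by linarith
  have hX1 : 1 ≤ X := by
    have : (1:ℝ) ≤ X := by linarith
    exact_mod_cast this
  set S := K.image fun k => k / (M:ℤ) with hS
  have hMZ : (0:ℤ) < M := by exact_mod_cast hM1'
  have hSN : S ⊆ Finset.Ico 0 (N:ℤ) := by
    intro c hc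
    obtain ⟨k, hk, rfl⟩ := Finset.mem_image.1 hc
    have h1 := Finset.mem_Ico.1 (hK hk)
    rw [Finset.mem_Ico]
    exact ⟨Int.ediv_nonneg h1.1 hMZ.le, (Int.ediv_le_self _ h1.1).trans_lt h1.2⟩
  have hS4 : ∀ c ∈ S, τ + ((c * M : ℤ) : ℝ) * ϖ ≤ 4 * T := by
    intro c hc
    obtain ⟨k, hk, rfl⟩ := Finset.mem_image.1 hc
    have h1 := Finset.mem_Ico.1 (hK hk)
    have h2 : k / (M:ℤ) * M ≤ N - 1 := (Int.ediv_mul_le k hMZ.ne').trans (by omega)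
    have h3 : ((k / (M:ℤ) * M : ℤ) : ℝ) ≤ N - 1 := by exact_mod_cast h2
    have h4 := mul_le_mul_of_nonneg_right h3 hϖ0.le
    linarith
  have hF : IsFreq S (fun c => τ + ((c * M : ℤ) : ℝ) * ϖ) T (min (W * G) (2 * T)) G g := by
    refine isFreq_cells hT hM1' hϖ0 hG hτ1 hSN hS4 (w := w) ?_ hW (by linarith)
    intro c hc
    obtain ⟨k, hk, rfl⟩ := Finset.mem_image.1 hc
    exact hKw k hk
  have hWG0 : 0 ≤ W * G := by positivity
  have hbound := hoff hX8 hX9 hF hgG (le_min hWG0 (by linarith)) ((min_le_right _ _).trans (by linarith))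
    ((min_le_left _ _).trans (by
      have : W * G ≤ G ^ 2 * G := mul_le_mul_of_nonneg_right hWG hG0.le
      nlinarith [pow_pos hG0 3]))
  set R : ℝ := (S.card : ℝ) with hR
  set n : ℝ := (K.card : ℝ) with hn
  have hn0 : 0 ≤ n := by positivity
  have hR0 : 0 ≤ R := by positivity
  have hRn : R ≤ n := by
    rw [hR, hn]
    exact_mod_cast Finset.card_image_le
  have hcell : ∀ c ∈ S, ∑ k ∈ K with k / (M:ℤ) = c, ‖dirPoly X (τ + k * ϖ)‖ ^ 2 ≤
      5 * M * (log X + C₂ + 2 * (offSum G X (τ + ((c * M : ℤ) : ℝ) * ϖ)).re) := by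
    intro c _
    refine hsq X M ϖ hX1 hM1 ?_ hϖ0 ?_ τ (c * M) _ ?_
    · have : g ≤ (M:ℝ) ^ 2 := (hgg3.trans hM).trans (le_self_pow₀ hM1 (by norm_num))
      linarith
    · have h1 : log X ≤ g := by linarith
      calc ϖ * log X ≤ 2 * g⁻¹ * g := by
            refine mul_le_mul hϖ2 h1 (log_nonneg (by exact_mod_cast hX1)) (by positivity)
        _ = 2 := by field_simp
        _ ≤ π := by linarith [Real.pi_gt_three]
    · intro j hj
      have h1 := (Finset.mem_filter.1 hj).2
      have h2 := Int.emod_add_mul_ediv j M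
      have h3 := Int.emod_nonneg j hMZ.ne'
      have h4 := Int.emod_lt_of_pos j hMZ
      rw [h1] at h2
      have h5 : |j - c * M| ≤ (M:ℤ) := by
        rw [abs_le]
        constructor <;> linarith
      exact_mod_cast h5
  have hsum : n * V ^ 2 ≤ 5 * M * (R * (log X + C₂) + 2 * ‖∑ c ∈ S, offSum G X (τ + ((c * M : ℤ) : ℝ) * ϖ)‖) := by
    calc n * V ^ 2 = ∑ k ∈ K, V ^ 2 := by simp [hn]
      _ ≤ ∑ k ∈ K, ‖dirPoly X (τ + k * ϖ)‖ ^ 2 :=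
          Finset.sum_le_sum fun k hk => pow_le_pow_left₀ hV (hKV k hk) 2
      _ = ∑ c ∈ S, ∑ k ∈ K with k / (M:ℤ) = c, ‖dirPoly X (τ + k * ϖ)‖ ^ 2 :=
          (Finset.sum_fiberwise_of_maps_to (fun k hk => Finset.mem_image_of_mem _ hk) _).symm
      _ ≤ _ := Finset.sum_le_sum hcell
      _ = 5 * M * (R * (log X + C₂) + 2 * (∑ c ∈ S, offSum G X (τ + ((c * M : ℤ) : ℝ) * ϖ)).re) := by
          rw [← Finset.mul_sum, Finset.sum_add_distrib, ← Finset.mul_sum, Complex.re_sum, Finset.sum_const,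
            nsmul_eq_mul]
      _ ≤ _ := by
          have := Complex.re_le_norm (∑ c ∈ S, offSum G X (τ + ((c * M : ℤ) : ℝ) * ϖ))
          refine mul_le_mul_of_nonneg_left ?_ (by positivity)
          linarith
  set Q := T / G ^ 3 with hQ
  have hQ0 : 0 ≤ Q := by positivity
  have hsqrt : √(R * T / G ^ 3) ≤ √(n * Q) := by
    rw [mul_div_assoc]
    exact Real.sqrt_le_sqrt (mul_le_mul_of_nonneg_right hRn hQ0)
  have hg5 : g ≤ g ^ 5 := le_self_pow₀ hg1 (by norm_num)
  have hg50 : 0 < g ^ 5 := by positivity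
  have hs0 : 0 ≤ √(n * Q) := Real.sqrt_nonneg _
  have hfin : n * V ^ 2 ≤ V ^ 2 * ((n + √(n * Q)) / 2) := by
    have hlogXC : R * (log X + C₂) ≤ n * g ^ 5 :=
      mul_le_mul hRn (by linarith) (add_nonneg (log_nonneg (by exact_mod_cast hX1)) hC₂) hn0
    have hoffle : ‖∑ c ∈ S, offSum G X (τ + ((c * M : ℤ) : ℝ) * ϖ)‖ ≤ C₁ * g ^ 5 * (n + √(n * Q)) :=
      hbound.trans (mul_le_mul_of_nonneg_left (add_le_add hRn hsqrt) (by positivity))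
    have hCn : n * g ^ 5 ≤ C₁ * g ^ 5 * (n + √(n * Q)) := by
      have h1 : n ≤ C₁ * (n + √(n * Q)) := by nlinarith
      calc n * g ^ 5 ≤ C₁ * (n + √(n * Q)) * g ^ 5 := mul_le_mul_of_nonneg_right h1 hg50.le
        _ = _ := by ring
    calc n * V ^ 2 ≤ 5 * M * (3 * (C₁ * g ^ 5 * (n + √(n * Q)))) := by
          refine hsum.trans (mul_le_mul_of_nonneg_left ?_ (by positivity))
          linarith
      _ = 30 * C₁ * (M * g ^ 5) * ((n + √(n * Q)) / 2) := by ring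
      _ ≤ g * (M * g ^ 5) * ((n + √(n * Q)) / 2) := by
          refine mul_le_mul_of_nonneg_right ?_ (by positivity)
          exact mul_le_mul_of_nonneg_right hg30 (by positivity)
      _ = M * g ^ 6 * ((n + √(n * Q)) / 2) := by ring
      _ ≤ _ := mul_le_mul_of_nonneg_right hMV (by positivity)
  have hV2 : 0 < V ^ 2 := lt_of_lt_of_le (by positivity) hMV
  have hle : n ≤ √(n * Q) := by
    rw [mul_comm] at hfin
    have := le_of_mul_le_mul_left hfin hV2
    linarith
  have hle2 : n * n ≤ n * Q := by
    have h1 := mul_self_le_mul_self hn0 hle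
    rwa [Real.mul_self_sqrt (by positivity)] at h1
  rcases hn0.eq_or_lt with h | h
  · rw [← h]; exact hQ0
  · exact le_of_mul_le_mul_left hle2 h

lemma exists_card_large_le {δ : ℝ} (hδ : 0 < δ) (hδ1 : δ ≤ 1 / 3) :
    ∀ᶠ T : ℝ in Filter.atTop, ∀ {X N : ℕ} {ϖ τ V : ℝ},
      8 * T ≤ X → X ≤ 9 * T → N * ϖ = 2 * T → (T ^ δ)⁻¹ ≤ ϖ → ϖ ≤ 2 * (T ^ δ)⁻¹ → 2 * T ≤ τ →
      τ ≤ 2 * T + ϖ → (T ^ δ) ^ 5 ≤ V →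
      (((Finset.Ico 0 (N:ℤ)).filter fun k : ℤ => V ≤ ‖dirPoly X (τ + k * ϖ)‖).card : ℝ) * V ^ 12 ≤
        320 * (T ^ δ) ^ 42 * T ^ 2 := by
  filter_upwards [exists_card_window_le hδ hδ1, eventually_log_le hδ 2 0, Filter.eventually_ge_atTop 1]
    with T hwin hg2 hT X N ϖ τ V hX8 hX9 hNϖ hϖ1 hϖ2 hτ1 hτ2 hV
  have hT0 : 0 < T := by linarith
  set g := T ^ δ with hg
  have hg2' : 2 ≤ g := by linarith
  have hg1 : 1 ≤ g := by linarith
  have hg0 : 0 < g := by linarith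
  have hϖ0 : 0 < ϖ := lt_of_lt_of_le (by positivity) hϖ1
  have hV0 : 0 < V := lt_of_lt_of_le (by positivity) hV
  have hVg : g ^ 4 ≤ V ^ 2 / g ^ 6 := by
    rw [le_div_iff₀ (by positivity)]
    calc g ^ 4 * g ^ 6 = (g ^ 5) ^ 2 := by ring
      _ ≤ V ^ 2 := by gcongr
  have hg3 : 1 ≤ g ^ 3 := one_le_pow₀ hg1
  have hg34 : 2 * g ^ 3 ≤ g ^ 4 := by
    calc 2 * g ^ 3 ≤ g * g ^ 3 := mul_le_mul_of_nonneg_right hg2' (by positivity)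
      _ = g ^ 4 := by ring
  set M := ⌊V ^ 2 / g ^ 6⌋₊ with hM
  have hMle : (M:ℝ) ≤ V ^ 2 / g ^ 6 := Nat.floor_le (by positivity)
  have hMge : V ^ 2 / g ^ 6 / 2 ≤ M := by
    have := Nat.lt_floor_add_one (V ^ 2 / g ^ 6)
    linarith
  have hMg3 : g ^ 3 ≤ M := by linarith
  have hM0 : (0:ℝ) < M := by linarith
  set G := (M:ℝ) * ϖ with hG
  have hGge : V ^ 2 / (2 * g ^ 7) ≤ G := by
    calc V ^ 2 / (2 * g ^ 7) = V ^ 2 / g ^ 6 / 2 * g⁻¹ := by field_simp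
      _ ≤ G := mul_le_mul hMge hϖ1 (by positivity) (by positivity)
  have hG1 : 1 ≤ G := by
    calc (1:ℝ) ≤ g ^ 2 := one_le_pow₀ hg1
      _ = g ^ 3 * g⁻¹ := by field_simp
      _ ≤ G := mul_le_mul hMg3 hϖ1 (by positivity) (by positivity)
  have hG0 : 0 < G := by linarith
  have hGsq : 1 ≤ G ^ 2 := one_le_pow₀ hG1
  set W := ⌊G ^ 2⌋₊ with hW
  have hWle : (W:ℝ) ≤ G ^ 2 := Nat.floor_le (by positivity)
  have hW1 : 1 ≤ W := Nat.le_floor (by exact_mod_cast hGsq)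
  have hWge : G ^ 2 / 2 ≤ W := by
    have h1 := Nat.lt_floor_add_one (G ^ 2)
    have h2 : (1:ℝ) ≤ W := by exact_mod_cast hW1
    linarith
  set K := (Finset.Ico 0 (N:ℤ)).filter fun k : ℤ => V ≤ ‖dirPoly X (τ + k * ϖ)‖ with hK
  have hfib : ∀ w : ℤ, ((K.filter fun k => k / (M:ℤ) / (W:ℤ) = w).card : ℝ) ≤ T / G ^ 3 := by
    intro w
    refine hwin hX8 hX9 hNϖ hϖ1 hϖ2 hτ1 hτ2 hMg3 hV0.le ?_ hW1 hWle ?_ ?_ (w := w) ?_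
    · rwa [le_div_iff₀ (by positivity)] at hMle
    · exact (Finset.filter_subset _ _).trans (Finset.filter_subset _ _)
    · exact fun k hk => (Finset.mem_filter.1 (Finset.mem_filter.1 hk).1).2
    · exact fun k hk => (Finset.mem_filter.1 hk).2
  have hQV : T / G ^ 3 ≤ 8 * g ^ 21 * T / V ^ 6 := by
    calc T / G ^ 3 ≤ T / (V ^ 2 / (2 * g ^ 7)) ^ 3 := by gcongr
      _ = _ := by field_simp; ring
  have hQ0 : 0 ≤ T / G ^ 3 := by positivity
  have hMZ : (0:ℤ) < M := by exact_mod_cast hM0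
  have hWZ : (0:ℤ) < W := by exact_mod_cast hW1
  have hcard : (K.card : ℝ) ≤ 5 * (T / G ^ 3) ^ 2 := by
    have hmaps : ∀ k ∈ K, k / (M:ℤ) / (W:ℤ) ∈ Finset.Icc 0 ((N:ℤ) / M / W) := by
      intro k hk
      have h1 := Finset.mem_Ico.1 (Finset.mem_filter.1 hk).1
      rw [Finset.mem_Icc]
      exact ⟨Int.ediv_nonneg (Int.ediv_nonneg h1.1 hMZ.le) hWZ.le,
        Int.ediv_le_ediv hWZ (Int.ediv_le_ediv hMZ h1.2.le)⟩
    have h1 := Finset.card_le_mul_card_image_of_maps_to hmaps ⌊T / G ^ 3⌋₊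
      fun w _ => Nat.le_floor (hfib w)
    have h2 : (K.card : ℝ) ≤ (⌊T / G ^ 3⌋₊ : ℝ) * ((N / M / W : ℕ) + 1) := by
      have h3 : (Finset.Icc 0 ((N:ℤ) / M / W)).card = N / M / W + 1 := by
        rw [Int.card_Icc]
        have : ((N:ℤ) / M / W) = ((N / M / W : ℕ) : ℤ) := by push_cast; rfl
        rw [this]
        generalize N / M / W = q
        omega
      rw [h3] at h1
      exact_mod_cast h1
    rcases lt_or_ge (T / G ^ 3) 1 with h3 | h3
    · rw [Nat.floor_eq_zero.2 h3] at h2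
      simp only [Nat.cast_zero, zero_mul] at h2
      exact h2.trans (by positivity)
    · have h4 : ((N / M / W : ℕ) : ℝ) ≤ 4 * (T / G ^ 3) := by
        calc ((N / M / W : ℕ) : ℝ) ≤ ((N / M : ℕ) : ℝ) / W := Nat.cast_div_le
          _ ≤ (N:ℝ) / M / W := by gcongr; exact Nat.cast_div_le
          _ ≤ (N:ℝ) / M / (G ^ 2 / 2) := by gcongr
          _ = 2 * (N * ϖ) / (M * ϖ * G ^ 2) := by field_simp
          _ = 4 * (T / G ^ 3) := by rw [hNϖ, ← hG]; field_simp; ring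
      calc (K.card : ℝ) ≤ (⌊T / G ^ 3⌋₊ : ℝ) * ((N / M / W : ℕ) + 1) := h2
        _ ≤ T / G ^ 3 * (5 * (T / G ^ 3)) := by
            refine mul_le_mul (Nat.floor_le hQ0) (by linarith) (by positivity) hQ0
        _ = _ := by ring
  calc (K.card : ℝ) * V ^ 12 ≤ 5 * (8 * g ^ 21 * T / V ^ 6) ^ 2 * V ^ 12 := by
        refine mul_le_mul_of_nonneg_right (hcard.trans ?_) (by positivity)
        exact mul_le_mul_of_nonneg_left (pow_le_pow_left₀ hQ0 hQV 2) (by norm_num)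
    _ = _ := by field_simp; ring

end largeValues

section dyadic

lemma pow_twelve_le_sum_ite {V x : ℝ} (hx : 0 ≤ x) (k : ℕ) (hxk : x ≤ V * 2 ^ k) :
    x ^ 12 ≤ V ^ 12 + ∑ i ∈ Finset.range k, if V * 2 ^ i ≤ x then (V * 2 ^ (i + 1)) ^ 12 else 0 := by
  induction k with
  | zero =>
    rw [Finset.range_zero, Finset.sum_empty, add_zero]
    exact pow_le_pow_left₀ hx (by simpa using hxk) 12
  | succ k ih =>
    rw [Finset.sum_range_succ, ← add_assoc]
    have h0 : 0 ≤ ∑ i ∈ Finset.range k, if V * 2 ^ i ≤ x then (V * 2 ^ (i + 1)) ^ 12 else 0 :=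
      Finset.sum_nonneg fun i _ => by split_ifs <;> positivity
    rcases le_total x (V * 2 ^ k) with h | h
    · refine (ih h).trans (le_add_of_nonneg_right ?_)
      split_ifs <;> positivity
    · rw [if_pos h]
      have h1 : x ^ 12 ≤ (V * 2 ^ (k + 1)) ^ 12 := pow_le_pow_left₀ hx hxk 12
      have h2 : 0 ≤ V ^ 12 := by positivity
      linarith

lemma sum_pow_twelve_le {A : Finset ℤ} {f : ℤ → ℝ} {V B : ℝ} {k : ℕ} (hV : 0 ≤ V) (hf : ∀ j ∈ A, 0 ≤ f j)
    (hfk : ∀ j ∈ A, f j ≤ V * 2 ^ k)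
    (hB : ∀ V', V ≤ V' → ((A.filter fun j => V' ≤ f j).card : ℝ) * V' ^ 12 ≤ B) :
    ∑ j ∈ A, f j ^ 12 ≤ A.card * V ^ 12 + k * (4096 * B) := by
  calc ∑ j ∈ A, f j ^ 12
      ≤ ∑ j ∈ A, (V ^ 12 + ∑ i ∈ Finset.range k, if V * 2 ^ i ≤ f j then (V * 2 ^ (i + 1)) ^ 12 else 0) :=
        Finset.sum_le_sum fun j hj => pow_twelve_le_sum_ite (hf j hj) k (hfk j hj)
    _ = A.card * V ^ 12 + ∑ i ∈ Finset.range k,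
          4096 * (((A.filter fun j => V * 2 ^ i ≤ f j).card : ℝ) * (V * 2 ^ i) ^ 12) := by
        rw [Finset.sum_add_distrib, Finset.sum_comm, Finset.sum_const, nsmul_eq_mul]
        congr 1
        refine Finset.sum_congr rfl fun i _ => ?_
        rw [← Finset.sum_filter, Finset.sum_const, nsmul_eq_mul]
        ring
    _ ≤ A.card * V ^ 12 + ∑ i ∈ Finset.range k, 4096 * B := by
        gcongr with i
        exact hB _ (le_mul_of_one_le_right hV (one_le_pow₀ one_le_two))
    _ = _ := by simp

lemma continuous_dirPoly (X : ℕ) : Continuous (dirPoly X) := by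
  unfold dirPoly
  fun_prop

lemma norm_dirPoly_le (X : ℕ) (t : ℝ) : ‖dirPoly X t‖ ≤ X := by
  unfold dirPoly
  calc _ ≤ ∑ n ∈ Finset.Ico 1 X, (1:ℝ) := by
        refine norm_sum_le_of_le _ fun n hn => ?_
        have h1 : (1:ℝ) ≤ n := by exact_mod_cast (Finset.mem_Ico.1 hn).1
        rw [norm_mul, ← Complex.ofReal_neg, Complex.norm_exp_ofReal_mul_I, mul_one, Complex.norm_real,
          Real.norm_of_nonneg (by positivity)]
        exact inv_le_one_of_one_le₀ (Real.one_le_sqrt.2 h1)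
    _ ≤ X := by simp

lemma integral_eq_integral_sum {f : ℝ → ℝ} (hf : Continuous f) (a ϖ : ℝ) (N : ℕ) :
    ∫ t in a..(a + N * ϖ), f t = ∫ θ in (0:ℝ)..ϖ, ∑ k ∈ Finset.range N, f (a + θ + k * ϖ) := by
  have h1 := intervalIntegral.sum_integral_adjacent_intervals (f := f) (μ := volume) (n := N)
    (a := fun k : ℕ => a + k * ϖ) fun k _ => hf.intervalIntegrable _ _
  simp only [Nat.cast_zero, zero_mul, add_zero] at h1
  rw [← h1, intervalIntegral.integral_finsetSum fun k _ => (by fun_prop : Continuous _).intervalIntegrable _ _]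
  refine Finset.sum_congr rfl fun k _ => ?_
  have h2 := intervalIntegral.integral_comp_add_right (a := 0) (b := ϖ) f (a + k * ϖ)
  rw [show (0:ℝ) + (a + k * ϖ) = a + k * ϖ by ring, show ϖ + (a + k * ϖ) = a + ((k + 1 : ℕ) : ℝ) * ϖ by
    push_cast; ring] at h2
  rw [← h2]
  exact intervalIntegral.integral_congr fun θ _ => by ring_nf

lemma exists_integral_dirPoly_le {δ : ℝ} (hδ : 0 < δ) (hδ1 : δ ≤ 1 / 3) :
    ∀ᶠ T : ℝ in Filter.atTop, ∀ {X : ℕ}, 8 * T ≤ X → X ≤ 9 * T →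
      ∫ t in (2 * T)..(4 * T), ‖dirPoly X t‖ ^ 12 ≤ 3000000 * (T ^ δ) ^ 60 * T ^ 2 := by
  filter_upwards [exists_card_large_le hδ hδ1, eventually_log_le hδ (1 + 2 * log 9) 2,
    Filter.eventually_ge_atTop 1] with T hcard hlog hT X hX8 hX9
  have hT0 : 0 < T := by linarith
  set g := T ^ δ with hg
  have hg1 : 1 ≤ g := Real.one_le_rpow hT hδ.le
  have hg0 : 0 < g := by linarith
  set N := ⌈T * g⌉₊ with hN
  have hTg : 1 ≤ T * g := one_le_mul_of_one_le_of_one_le hT hg1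
  have hNge : T * g ≤ N := Nat.le_ceil _
  have hNle : (N:ℝ) ≤ 2 * (T * g) := by
    have := Nat.ceil_lt_add_one (by linarith : 0 ≤ T * g)
    linarith
  have hN0 : (0:ℝ) < N := by linarith
  set ϖ := 2 * T / N with hϖ
  have hNϖ : N * ϖ = 2 * T := by rw [hϖ]; field_simp
  have hϖ1 : g⁻¹ ≤ ϖ := by
    rw [hϖ, le_div_iff₀ hN0, inv_mul_le_iff₀ hg0]
    linarith
  have hϖ2 : ϖ ≤ 2 * g⁻¹ := by
    rw [hϖ, div_le_iff₀ hN0, ← div_eq_mul_inv, div_mul_eq_mul_div, le_div_iff₀ hg0]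
    linarith
  have hϖ0 : 0 < ϖ := lt_of_lt_of_le (by positivity) hϖ1
  have hϖ2' : ϖ ≤ 2 := hϖ2.trans (by linarith [inv_le_one_of_one_le₀ hg1])
  have hX1 : 1 < X := by
    have : (1:ℝ) < X := by linarith
    exact_mod_cast this
  set k := Nat.clog 2 X with hk
  have hXk : (X:ℝ) ≤ 2 ^ k := by exact_mod_cast Nat.le_pow_clog one_lt_two X
  have hkg : (k:ℝ) ≤ g := by
    have h1 : log X ≤ log 9 + log T := by
      rw [← log_mul (by norm_num) hT0.ne']
      exact log_le_log (by linarith) hX9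
    linarith [natCast_clog_le hX1]
  have hpt : ∀ θ ∈ Set.Icc 0 ϖ, ∑ j ∈ Finset.range N, ‖dirPoly X (2 * T + θ + j * ϖ)‖ ^ 12 ≤
      N * (g ^ 5) ^ 12 + k * (4096 * (320 * g ^ 42 * T ^ 2)) := by
    intro θ hθ
    have h1 := sum_pow_twelve_le (A := Finset.Ico 0 (N:ℤ)) (f := fun j => ‖dirPoly X (2 * T + θ + j * ϖ)‖)
      (V := g ^ 5) (B := 320 * g ^ 42 * T ^ 2) (k := k) (by positivity) (fun j _ => norm_nonneg _)
      (fun j _ => ((norm_dirPoly_le X _).trans hXk).trans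
        (le_mul_of_one_le_left (by positivity) (one_le_pow₀ hg1)))
      (fun V' hV' => hcard hX8 hX9 hNϖ hϖ1 hϖ2 (by linarith [hθ.1]) (by linarith [hθ.2]) hV')
    have h2 : ∑ j ∈ Finset.Ico 0 (N:ℤ), ‖dirPoly X (2 * T + θ + j * ϖ)‖ ^ 12 =
        ∑ j ∈ Finset.range N, ‖dirPoly X (2 * T + θ + j * ϖ)‖ ^ 12 := by
      symm
      refine Finset.sum_nbij (fun j : ℕ => (j:ℤ)) ?_ ?_ ?_ ?_
      · intro j hj
        rw [Finset.mem_range] at hj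
        rw [Finset.mem_Ico]
        omega
      · exact fun a _ b _ h => Int.natCast_inj.1 h
      · intro j hj
        rw [Finset.mem_coe, Finset.mem_Ico] at hj
        exact ⟨j.toNat, by rw [Finset.mem_coe, Finset.mem_range]; omega, by simp only; omega⟩
      · intro j _
        simp
    rw [h2, Int.card_Ico, sub_zero, Int.toNat_natCast] at h1
    exact h1
  have hcont : Continuous fun t => ‖dirPoly X t‖ ^ 12 := (continuous_dirPoly X).norm.pow 12
  rw [show 4 * T = 2 * T + N * ϖ by rw [hNϖ]; ring, integral_eq_integral_sum hcont]
  have hintegr := intervalIntegral.integral_mono_on (μ := volume) hϖ0.le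
    ((continuous_finsetSum _ fun j _ => hcont.comp
      (by fun_prop : Continuous fun θ : ℝ => 2 * T + θ + (j:ℕ) * ϖ)).intervalIntegrable 0 ϖ)
    (intervalIntegrable_const (c := N * (g ^ 5) ^ 12 + k * (4096 * (320 * g ^ 42 * T ^ 2)))) hpt
  refine hintegr.trans ?_
  rw [intervalIntegral.integral_const, smul_eq_mul, sub_zero, mul_add]
  have e1 : ϖ * (N * (g ^ 5) ^ 12) = 2 * T * g ^ 60 := by
    rw [← mul_assoc, mul_comm ϖ, hNϖ]; ring
  have hTT : T ≤ T ^ 2 := le_self_pow₀ hT (by norm_num)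
  have e2 : 2 * T * g ^ 60 ≤ 2 * (g ^ 60 * T ^ 2) := by
    have := mul_le_mul_of_nonneg_left hTT (by positivity : 0 ≤ g ^ 60)
    linarith
  have e3 : ϖ * (k * (4096 * (320 * g ^ 42 * T ^ 2))) ≤ 2621440 * (g ^ 60 * T ^ 2) := by
    calc ϖ * (k * (4096 * (320 * g ^ 42 * T ^ 2))) ≤ 2 * (g * (4096 * (320 * g ^ 42 * T ^ 2))) :=
          mul_le_mul hϖ2' (mul_le_mul_of_nonneg_right hkg (by positivity)) (by positivity) (by norm_num)
      _ = 2621440 * (g ^ 43 * T ^ 2) := by ring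
      _ ≤ _ := by
          have : g ^ 43 ≤ g ^ 60 := pow_le_pow_right₀ hg1 (by norm_num)
          gcongr
  rw [e1]
  have : 0 ≤ g ^ 60 * T ^ 2 := by positivity
  linarith

lemma continuous_zeta_half : Continuous fun t : ℝ => riemannZeta (1 / 2 + t * Complex.I) := by
  refine continuous_iff_continuousAt.2 fun t => ?_
  have h1 : (1 / 2 + t * Complex.I : ℂ) ≠ 1 := by
    intro h
    have := congrArg Complex.re h
    norm_num at this
  exact ContinuousAt.comp (f := fun t : ℝ => (1 / 2 + t * Complex.I : ℂ))
    (differentiableAt_riemannZeta h1).continuousAt (by fun_prop)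

lemma exists_integral_zeta_le {δ : ℝ} (hδ : 0 < δ) (hδ1 : δ ≤ 1 / 3) :
    ∃ C : ℝ, 0 < C ∧ ∀ᶠ T : ℝ in Filter.atTop,
      ∫ t in (2 * T)..(4 * T), ‖riemannZeta (1 / 2 + t * Complex.I)‖ ^ 12 ≤ C * ((T ^ δ) ^ 60 * T ^ 2) := by
  refine ⟨2 ^ 11 * (3000000 + 2 * 1000 ^ 12), by positivity, ?_⟩
  filter_upwards [exists_integral_dirPoly_le hδ hδ1, Filter.eventually_ge_atTop 1] with T hD hT
  have hT0 : 0 < T := by linarith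
  set X := ⌈8 * T⌉₊ with hX
  have hX8 : 8 * T ≤ X := Nat.le_ceil _
  have hX9 : (X:ℝ) ≤ 9 * T := by
    have := Nat.ceil_lt_add_one (by linarith : 0 ≤ 8 * T)
    linarith
  have hcont : Continuous fun t => ‖dirPoly X t‖ ^ 12 := (continuous_dirPoly X).norm.pow 12
  have hg60 : 1 ≤ (T ^ δ) ^ 60 := one_le_pow₀ (Real.one_le_rpow hT hδ.le)
  have hTT : T ≤ T ^ 2 := le_self_pow₀ hT (by norm_num)
  calc ∫ t in (2 * T)..(4 * T), ‖riemannZeta (1 / 2 + t * Complex.I)‖ ^ 12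
      ≤ ∫ t in (2 * T)..(4 * T), 2 ^ 11 * (‖dirPoly X t‖ ^ 12 + 1000 ^ 12) := by
        refine intervalIntegral.integral_mono_on (by linarith)
          ((continuous_zeta_half.norm.pow 12).intervalIntegrable _ _)
          ((by fun_prop : Continuous _).intervalIntegrable _ _) fun t ht => ?_
        have h1 := norm_zeta_sub_dirPoly_le hT (by linarith [ht.1]) ht.2 hX8 hX9
        have h2 : ‖riemannZeta (1 / 2 + t * Complex.I)‖ ≤ ‖dirPoly X t‖ + 1000 := by
          have := norm_le_norm_add_norm_sub' (riemannZeta (1 / 2 + t * Complex.I)) (dirPoly X t)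
          linarith
        exact (pow_le_pow_left₀ (norm_nonneg _) h2 12).trans
          (add_pow_le (norm_nonneg _) (by norm_num) 12)
    _ = 2 ^ 11 * ((∫ t in (2 * T)..(4 * T), ‖dirPoly X t‖ ^ 12) + 2 * T * 1000 ^ 12) := by
        rw [intervalIntegral.integral_const_mul, intervalIntegral.integral_add (hcont.intervalIntegrable _ _)
          intervalIntegrable_const, intervalIntegral.integral_const, smul_eq_mul]
        ring
    _ ≤ 2 ^ 11 * (3000000 * (T ^ δ) ^ 60 * T ^ 2 + 2 * ((T ^ δ) ^ 60 * T ^ 2) * 1000 ^ 12) := by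
        have h1 := hD hX8 hX9
        have h2 : T ≤ (T ^ δ) ^ 60 * T ^ 2 := hTT.trans (le_mul_of_one_le_left (by positivity) hg60)
        linarith
    _ = _ := by ring

lemma le_mul_rpow_of_dyadic {F : ℝ → ℝ} {C T₁ a : ℝ} (hF : Monotone F) (hF0 : 0 ≤ F 0) (hC : 0 ≤ C) (ha : 1 ≤ a)
    (hT₁ : 1 ≤ T₁) (h : ∀ T, T₁ ≤ T → F (4 * T) - F (2 * T) ≤ C * T ^ a) :
    ∀ T, 1 ≤ T → F T ≤ (F (4 * T₁) + 2 * C) * T ^ a := by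
  set A := F (4 * T₁) + 2 * C with hA
  have hF1 : 0 ≤ F (4 * T₁) := hF0.trans (hF (by linarith))
  have key : ∀ n : ℕ, ∀ T, 1 ≤ T → T ≤ 4 * T₁ * 2 ^ n → F T ≤ A * T ^ a := by
    intro n
    induction n with
    | zero =>
      intro T hT hTn
      have h1 : 1 ≤ T ^ a := Real.one_le_rpow hT (by linarith)
      calc F T ≤ F (4 * T₁) := hF (by simpa using hTn)
        _ ≤ A := by rw [hA]; linarith
        _ ≤ A * T ^ a := le_mul_of_one_le_right (by rw [hA]; linarith) h1
    | succ n ih =>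
      intro T hT hTn
      rcases le_total T (4 * T₁ * 2 ^ n) with hle | hge
      · exact ih T hT hle
      have h2n : (1:ℝ) ≤ 2 ^ n := one_le_pow₀ one_le_two
      have hT4 : 4 * T₁ ≤ T := (le_mul_of_one_le_right (by linarith) h2n).trans hge
      have h1 := h (T / 4) (by linarith)
      rw [show 4 * (T / 4) = T by ring, show 2 * (T / 4) = T / 2 by ring] at h1
      have h2 := ih (T / 2) (by linarith) (by rw [pow_succ] at hTn; linarith)
      have h3 : (T / 4) ^ a ≤ T ^ a := Real.rpow_le_rpow (by linarith) (by linarith) (by linarith)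
      have h4 : (T / 2) ^ a ≤ T ^ a / 2 := by
        rw [Real.div_rpow (by linarith) (by norm_num)]
        gcongr
        calc (2:ℝ) = 2 ^ (1:ℝ) := (Real.rpow_one 2).symm
          _ ≤ 2 ^ a := Real.rpow_le_rpow_of_exponent_le one_le_two ha
      have h5 := mul_le_mul_of_nonneg_left h3 hC
      have h6 := mul_le_mul_of_nonneg_left h4 (by rw [hA]; linarith : 0 ≤ A)
      have h7 : 0 ≤ T ^ a := by positivity
      have h8 : C * T ^ a ≤ A / 2 * T ^ a := mul_le_mul_of_nonneg_right (by rw [hA]; linarith) h7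
      linarith
  intro T hT
  obtain ⟨n, hn⟩ := pow_unbounded_of_one_lt T one_lt_two
  refine key n T hT (hn.le.trans (le_mul_of_one_le_left (by positivity) (by linarith)))

end dyadic

end TwelfthMoment

theorem twelfth_moment_zeta (ε : ℝ) (hε : 0 < ε) :
    ∃ C : ℝ, 0 < C ∧ ∀ T : ℝ, 2 ≤ T →
      (∫ t in (0:ℝ)..T, ‖riemannZeta (1 / 2 + t * Complex.I)‖ ^ 12) ≤ C * T ^ ((2:ℝ) + ε) := by
  obtain ⟨δ, hδ, hδ1, hδε⟩ : ∃ δ : ℝ, 0 < δ ∧ δ ≤ 1 / 3 ∧ δ * 60 ≤ ε :=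
    ⟨min (1 / 3) (ε / 60), by positivity, min_le_left _ _, by linarith [min_le_right (1 / 3) (ε / 60)]⟩
  obtain ⟨C, hC, hev⟩ := TwelfthMoment.exists_integral_zeta_le hδ hδ1
  obtain ⟨T₀, hT₀⟩ := Filter.eventually_atTop.1 hev
  have hintegr : ∀ a b : ℝ, IntervalIntegrable (fun t : ℝ => ‖riemannZeta (1 / 2 + t * Complex.I)‖ ^ 12) volume a b :=
    fun a b => (TwelfthMoment.continuous_zeta_half.norm.pow 12).intervalIntegrable a b
  set F : ℝ → ℝ := fun T => ∫ t in (0:ℝ)..T, ‖riemannZeta (1 / 2 + t * Complex.I)‖ ^ 12 with hF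
  have hdiff : ∀ a b, F b - F a = ∫ t in a..b, ‖riemannZeta (1 / 2 + t * Complex.I)‖ ^ 12 := fun a b =>
    intervalIntegral.integral_interval_sub_left (hintegr _ _) (hintegr _ _)
  have hmono : Monotone F := fun a b hab => by
    rw [← sub_nonneg, hdiff]
    exact intervalIntegral.integral_nonneg hab fun t _ => by positivity
  have hF0 : F 0 = 0 := intervalIntegral.integral_same
  have hmain := TwelfthMoment.le_mul_rpow_of_dyadic (F := F) (C := C) (T₁ := max T₀ 1) (a := 2 + ε) hmono hF0.ge hC.le
    (by linarith) (le_max_right _ _) fun T hT => by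
      have hT1 : 1 ≤ T := (le_max_right _ _).trans hT
      have hT0 : 0 < T := by linarith
      rw [hdiff]
      refine (hT₀ T ((le_max_left _ _).trans hT)).trans (mul_le_mul_of_nonneg_left ?_ hC.le)
      calc (T ^ δ) ^ 60 * T ^ 2 = T ^ (δ * 60 + 2) := by
            rw [Real.rpow_add hT0, Real.rpow_mul hT0.le]
            norm_cast
        _ ≤ T ^ (2 + ε) := Real.rpow_le_rpow_of_exponent_le hT1 (by linarith)
  have hpos : 0 ≤ F (4 * max T₀ 1) := by
    rw [← hF0]
    exact hmono (by positivity)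
  exact ⟨_, by linarith, fun T hT => hmain T (by linarith)⟩
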